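/- Let N ≥ 2, α ∈ (0,2) with α < N, let Ω ⊂ ℝ^N be a bounded open set and f a bounded continuous function on Ω. Let w be a classical solution of the extension problem on the cylinder C_Ω = Ω × (0,∞) with data f, and let v be a classical solution of the extension problem on C_{Ω^#} = Ω^# × (0,∞) with data f^#, which is radially symmetric and radially nonincreasing in x for each y ≥ 0. Then for every y ∈ [0,∞) and every s ∈ [0,|Ω|] one has ∫_0^s w*(σ,y) dσ ≤ ∫_0^s v*(σ,y) dσ. -/

import Mathlib

open MeasureTheory Filter Set

noncomputable section

abbrev Euc (N : ℕ) := EuclideanSpace ℝ (Fin N)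

/-- Decreasing rearrangement of `g` on `E`:
`g*(s) = sup {t ≥ 0 : |{x ∈ E : |g x| > t}| > s}`. -/
def rearr {N : ℕ} (E : Set (Euc N)) (g : Euc N → ℝ) (s : ℝ) : ℝ :=
  sSup {t : ℝ | 0 ≤ t ∧ ENNReal.ofReal s < volume {x | x ∈ E ∧ t < |g x|}}

/-- Measure of the unit ball of `ℝ^N`. -/
def omegaN (N : ℕ) : ℝ := (volume (Metric.ball (0 : Euc N) 1)).toReal

/-- Radius of the ball centered at the origin with the same measure as `Ω`. -/
def ballRad {N : ℕ} (Ω : Set (Euc N)) : ℝ := ((volume Ω).toReal / omegaN N) ^ ((N : ℝ)⁻¹)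

/-- `Ω^#`: the ball centered at the origin with the same measure as `Ω`. -/
def symmBall {N : ℕ} (Ω : Set (Euc N)) : Set (Euc N) := Metric.ball 0 (ballRad Ω)

/-- Schwarz rearrangement `f^#(x) = f*(ω_N |x|^N)`. -/
def schwarz {N : ℕ} (Ω : Set (Euc N)) (f : Euc N → ℝ) (x : Euc N) : ℝ :=
  rearr Ω f (omegaN N * ‖x‖ ^ N)

/-- `κ_α = 2^{1-α} Γ(1-α/2) / Γ(α/2)`. -/
def kappa (α : ℝ) : ℝ := (2 : ℝ) ^ (1 - α) * Real.Gamma (1 - α / 2) / Real.Gamma (α / 2)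

/-- Laplacian of `w` with respect to the `x` variables. -/
def lapx {N : ℕ} (w : Euc N → ℝ → ℝ) (x : Euc N) (y : ℝ) : ℝ :=
  ∑ i : Fin N, deriv (deriv fun t : ℝ => w (x + t • EuclideanSpace.single i (1 : ℝ)) y) 0

/-- A classical solution of the extension problem on `C_Ω = Ω × (0,∞)` with data `f`:
continuous and bounded up to the boundary, smooth with bounded derivatives up to
order two inside, satisfying the extension PDE, vanishing on the lateral boundary,
decaying uniformly as `y → ∞`, and with the Neumann data `f`. -/
structure IsExtSol {N : ℕ} (α : ℝ) (Ω : Set (Euc N)) (f : Euc N → ℝ)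
    (w : Euc N → ℝ → ℝ) : Prop where
  cont : ContinuousOn (fun p : Euc N × ℝ => w p.1 p.2) (closure (Ω ×ˢ Ioi (0 : ℝ)))
  bdd : ∃ M : ℝ, ∀ p ∈ closure (Ω ×ˢ Ioi (0 : ℝ)), |w (Prod.fst p) p.2| ≤ M
  smooth : ContDiffOn ℝ 2 (fun p : Euc N × ℝ => w p.1 p.2) (Ω ×ˢ Ioi (0 : ℝ))
  derivBdd : ∃ M : ℝ, ∀ p ∈ Ω ×ˢ Ioi (0 : ℝ),
    ‖fderiv ℝ (fun q : Euc N × ℝ => w q.1 q.2) p‖ ≤ M ∧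
    ‖fderiv ℝ (fderiv ℝ fun q : Euc N × ℝ => w q.1 q.2) p‖ ≤ M
  pde : ∀ x ∈ Ω, ∀ y ∈ Ioi (0 : ℝ),
    lapx w x y + ((1 - α) / y) * deriv (w x) y + deriv (deriv (w x)) y = 0
  lateral : ∀ x ∈ frontier Ω, ∀ y ∈ Ici (0 : ℝ), w x y = 0
  decay : ∀ ε > (0 : ℝ), ∃ Y : ℝ, ∀ y ≥ Y, ∀ x ∈ Ω, |w x y| ≤ ε
  neumann : ∀ x ∈ Ω,
    Tendsto (fun y : ℝ => y ^ (1 - α) * deriv (w x) y) (nhdsWithin 0 (Ioi 0))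
      (nhds (-(kappa α) * f x))

/-- `v` is radially symmetric and radially nonincreasing in `x` for each `y ≥ 0`. -/
def RadialDecr {N : ℕ} (v : Euc N → ℝ → ℝ) : Prop :=
  ∀ y : ℝ, 0 ≤ y → ∀ x x' : Euc N, ‖x‖ ≤ ‖x'‖ → v x' y ≤ v x y

/-- A reflection in an affine hyperplane, with a chosen closed side `H` containing the origin. -/
structure Polarizer (N : ℕ) where
  σ : Euc N ≃ᵢ Euc N
  H : Set (Euc N)
  measH : MeasurableSet H
  mp : MeasurePreserving σ volume volume
  invol : ∀ a, σ (σ a) = a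
  near : ∀ a ∈ H, ∀ b ∈ H, dist a b ≤ dist a (σ b)
  cover : ∀ a, a ∉ H → σ a ∈ H
  zero_mem : (0 : Euc N) ∈ H

namespace Polarizer

variable {N : ℕ} (P : Polarizer N)

lemma fix {a : Euc N} (ha : a ∈ P.H) (hs : P.σ a ∈ P.H) : P.σ a = a := by
  have h := P.near _ hs _ ha
  rw [dist_self] at h
  exact dist_le_zero.1 h

lemma dist_swap (a b : Euc N) : dist (P.σ a) b = dist a (P.σ b) := by
  rw [← P.σ.dist_eq a, P.invol]

lemma norm_le {a : Euc N} (ha : a ∈ P.H) : ‖a‖ ≤ ‖P.σ a‖ := by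
  simpa [dist_eq_norm] using P.near 0 P.zero_mem a ha

/-- Two-point rearrangement of `g` with respect to `P`. -/
def pol (g : Euc N → ℝ) (x : Euc N) : ℝ :=
  open Classical in if x ∈ P.H then max (g x) (g (P.σ x)) else min (g x) (g (P.σ x))

lemma pol_mem {g : Euc N → ℝ} {x : Euc N} (hx : x ∈ P.H) :
    P.pol g x = max (g x) (g (P.σ x)) := by simp [pol, hx]

lemma pol_refl {g : Euc N → ℝ} {x : Euc N} (hx : x ∈ P.H) :
    P.pol g (P.σ x) = min (g x) (g (P.σ x)) := by
  by_cases h : P.σ x ∈ P.H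
  · simp [pol, P.fix hx h, hx]
  · simp [pol, h, P.invol, min_comm]

lemma exists_rep (x : Euc N) : ∃ x' ∈ P.H, x = x' ∨ x = P.σ x' := by
  by_cases h : x ∈ P.H
  · exact ⟨x, h, Or.inl rfl⟩
  · exact ⟨P.σ x, P.cover x h, Or.inr (P.invol x).symm⟩

lemma pol_modulus {g : Euc N → ℝ} {δ ε : ℝ} (h : ∀ x y, dist x y ≤ δ → |g x - g y| ≤ ε)
    (x y : Euc N) (hxy : dist x y ≤ δ) : |P.pol g x - P.pol g y| ≤ ε := by
  obtain ⟨a, ha, hxa⟩ := P.exists_rep x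
  obtain ⟨b, hb, hyb⟩ := P.exists_rep y
  have hss : dist (P.σ a) (P.σ b) = dist a b := P.σ.dist_eq a b
  have hab : dist a b ≤ δ := by
    rcases hxa with rfl | rfl <;> rcases hyb with rfl | rfl
    · exact hxy
    · exact (P.near _ ha _ hb).trans hxy
    · exact (P.near _ ha _ hb).trans (by rwa [← P.dist_swap])
    · rwa [← hss]
  have h1 := abs_le.1 (h a b hab)
  have h2 := abs_le.1 (h (P.σ a) (P.σ b) (hss.trans_le hab))
  have mm : |max (g a) (g (P.σ a)) - max (g b) (g (P.σ b))| ≤ ε := by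
    rw [abs_le]
    rcases max_cases (g a) (g (P.σ a)) with h3 | h3 <;>
      rcases max_cases (g b) (g (P.σ b)) with h4 | h4 <;> constructor <;> linarith
  have mn : |min (g a) (g (P.σ a)) - min (g b) (g (P.σ b))| ≤ ε := by
    rw [abs_le]
    rcases min_cases (g a) (g (P.σ a)) with h3 | h3 <;>
      rcases min_cases (g b) (g (P.σ b)) with h4 | h4 <;> constructor <;> linarith
  have cross : dist a (P.σ b) ≤ δ →
      |max (g a) (g (P.σ a)) - min (g b) (g (P.σ b))| ≤ ε ∧
      |min (g a) (g (P.σ a)) - max (g b) (g (P.σ b))| ≤ ε := by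
    intro hd
    have h3 := abs_le.1 (h a (P.σ b) hd)
    have h4 := abs_le.1 (h (P.σ a) b (by rwa [P.dist_swap]))
    rw [abs_le, abs_le]
    rcases max_cases (g a) (g (P.σ a)) with h5 | h5 <;>
      rcases max_cases (g b) (g (P.σ b)) with h6 | h6 <;>
      rcases min_cases (g a) (g (P.σ a)) with h7 | h7 <;>
      rcases min_cases (g b) (g (P.σ b)) with h8 | h8 <;>
      refine ⟨⟨?_, ?_⟩, ?_, ?_⟩ <;> linarith
  rcases hxa with rfl | rfl <;> rcases hyb with rfl | rfl
  · rwa [P.pol_mem ha, P.pol_mem hb]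
  · rw [P.pol_mem ha, P.pol_refl hb]; exact (cross hxy).1
  · rw [P.pol_refl ha, P.pol_mem hb]; exact (cross (by rwa [← P.dist_swap])).2
  · rwa [P.pol_refl ha, P.pol_refl hb]

lemma pol_comp_add (φ : ℝ → ℝ) (g : Euc N → ℝ) (x : Euc N) :
    φ (P.pol g x) + φ (P.pol g (P.σ x)) = φ (g x) + φ (g (P.σ x)) := by
  obtain ⟨a, ha, hxa⟩ := P.exists_rep x
  have key : φ (P.pol g a) + φ (P.pol g (P.σ a)) = φ (g a) + φ (g (P.σ a)) := by
    rw [P.pol_mem ha, P.pol_refl ha]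
    rcases le_total (g a) (g (P.σ a)) with h | h <;> simp [h, add_comm]
  rcases hxa with rfl | rfl
  · exact key
  · rw [P.invol]; linarith

lemma two_point {φ : ℝ → ℝ} (hφ : Monotone φ) (a a' b b' : ℝ) :
    φ a * b + φ a' * b' ≤ φ (max a a') * max b b' + φ (min a a') * min b b' := by
  rcases le_total a a' with h | h <;> rcases le_total b b' with h' | h' <;> simp only [h, h', max_eq_left, max_eq_right, min_eq_left, min_eq_right] <;> have := hφ h <;> nlinarith

/-- Sum of the interaction over the orbit of `(x, y)` under the reflection in each variable. -/
def quad (φ k : ℝ → ℝ) (g : Euc N → ℝ) (x y : Euc N) : ℝ :=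
  φ (g x) * k (dist x y) * g y + φ (g (P.σ x)) * k (dist (P.σ x) y) * g y +
    (φ (g x) * k (dist x (P.σ y)) * g (P.σ y) +
      φ (g (P.σ x)) * k (dist (P.σ x) (P.σ y)) * g (P.σ y))

lemma quad_le {φ k : ℝ → ℝ} (hφ : Monotone φ) (hk : Antitone k) (g : Euc N → ℝ)
    (x y : Euc N) : P.quad φ k g x y ≤ P.quad φ k (P.pol g) x y := by
  obtain ⟨a, ha, hxa⟩ := P.exists_rep x
  obtain ⟨b, hb, hyb⟩ := P.exists_rep y
  have hx : ∀ f : Euc N → ℝ, ∀ y, P.quad φ k f x y = P.quad φ k f a y := by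
    intro f y
    rcases hxa with rfl | rfl
    · rfl
    · simp only [quad, P.invol]; ring
  have hy : ∀ f : Euc N → ℝ, ∀ x, P.quad φ k f x y = P.quad φ k f x b := by
    intro f x
    rcases hyb with rfl | rfl
    · rfl
    · simp only [quad, P.invol]; ring
  rw [hx, hx, hy, hy]
  have hss : dist (P.σ a) (P.σ b) = dist a b := P.σ.dist_eq a b
  simp only [quad, P.pol_mem ha, P.pol_mem hb, P.pol_refl ha, P.pol_refl hb, P.dist_swap a b, hss]
  have h1 := two_point hφ (g a) (g (P.σ a)) (g b) (g (P.σ b))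
  have h2 := hk (P.near a ha b hb)
  have h3 : φ (max (g a) (g (P.σ a))) + φ (min (g a) (g (P.σ a))) = φ (g a) + φ (g (P.σ a)) := by
    rcases le_total (g a) (g (P.σ a)) with h | h <;> simp [h, add_comm]
  have h4 : max (g b) (g (P.σ b)) + min (g b) (g (P.σ b)) = g b + g (P.σ b) := max_add_min _ _
  have h5 : (φ (max (g a) (g (P.σ a))) + φ (min (g a) (g (P.σ a)))) *
      (max (g b) (g (P.σ b)) + min (g b) (g (P.σ b))) =
      (φ (g a) + φ (g (P.σ a))) * (g b + g (P.σ b)) := by rw [h3, h4]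
  generalize φ (max (g a) (g (P.σ a))) = A at *
  generalize φ (min (g a) (g (P.σ a))) = A' at *
  generalize max (g b) (g (P.σ b)) = B at *
  generalize min (g b) (g (P.σ b)) = B' at *
  nlinarith [mul_nonneg (sub_nonneg.2 h1) (sub_nonneg.2 h2), congrArg (fun t => t * k (dist a (P.σ b))) h5]

lemma weight_le {ρ : ℝ → ℝ} (hρ : Antitone ρ) (g : Euc N → ℝ) (x : Euc N) :
    g x * ρ ‖x‖ + g (P.σ x) * ρ ‖P.σ x‖ ≤
      P.pol g x * ρ ‖x‖ + P.pol g (P.σ x) * ρ ‖P.σ x‖ := by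
  obtain ⟨a, ha, hxa⟩ := P.exists_rep x
  have key : g a * ρ ‖a‖ + g (P.σ a) * ρ ‖P.σ a‖ ≤
      P.pol g a * ρ ‖a‖ + P.pol g (P.σ a) * ρ ‖P.σ a‖ := by
    rw [P.pol_mem ha, P.pol_refl ha]
    have := hρ (P.norm_le ha)
    rcases le_total (g a) (g (P.σ a)) with h | h <;> simp only [h, max_eq_left, max_eq_right, min_eq_left, min_eq_right] <;> nlinarith
  rcases hxa with rfl | rfl
  · exact key
  · rw [P.invol]; linarith

lemma exists_of_norm_le {x x' : Euc N} (hne : x ≠ x') (hle : ‖x‖ ≤ ‖x'‖) :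
    ∃ P : Polarizer N, P.σ x = x' ∧ P.H = {a | dist a x ≤ dist a x'} := by
  set e := x' - x with he
  have he0 : e ≠ 0 := sub_ne_zero.2 hne.symm
  set m : Euc N := (2⁻¹ : ℝ) • (x + x') with hm
  let R := (Submodule.span ℝ {e})ᗮ.reflection
  let σ : Euc N ≃ᵢ Euc N :=
    ((IsometryEquiv.subRight m).trans R.toIsometryEquiv).trans (IsometryEquiv.addRight m)
  have hσ : ∀ a, σ a = a - (2 * inner ℝ e (a - m) / ‖e‖ ^ 2) • e := by
    intro a
    change R (a - m) + m = _
    have : R (a - m) = (a - m) - (2 * inner ℝ e (a - m) / ‖e‖ ^ 2) • e := by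
      simp only [R]
      rw [Submodule.reflection_orthogonal_apply, Submodule.reflection_singleton_apply]
      simp only [RCLike.ofReal_real_eq_id, id]
      rw [neg_sub]; congr 1
      rw [← smul_assoc]
      simp [mul_div_assoc]
    rw [this]; abel
  have hinv : ∀ a, σ (σ a) = a := by
    intro a
    change R (R (a - m) + m - m) + m = a
    simp [R]
  have hn : 0 < ‖e‖ ^ 2 := by positivity
  have hH : ∀ a, dist a x ≤ dist a x' ↔ inner ℝ e (a - m) ≤ 0 := by
    intro a
    have hx : a - x = (a - m) + (2⁻¹ : ℝ) • e := by rw [hm, he]; module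
    have hx' : a - x' = (a - m) - (2⁻¹ : ℝ) • e := by rw [hm, he]; module
    rw [dist_eq_norm, dist_eq_norm, ← sq_le_sq₀ (norm_nonneg _) (norm_nonneg _), hx, hx']
    generalize a - m = b
    rw [norm_add_sq_real, norm_sub_sq_real, inner_smul_right, real_inner_comm]
    constructor <;> intro h <;> linarith
  refine ⟨⟨σ, {a | dist a x ≤ dist a x'}, ?_, ?_, hinv, ?_, ?_, ?_⟩, ?_, rfl⟩
  · exact (isClosed_le (by fun_prop) (by fun_prop)).measurableSet
  · have h1 : MeasurePreserving (fun a : Euc N => a - m) volume volume :=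
      measurePreserving_sub_right volume m
    have h2 : MeasurePreserving R volume volume := R.measurePreserving
    have h3 : MeasurePreserving (fun a : Euc N => a + m) volume volume :=
      measurePreserving_add_right volume m
    exact h3.comp (h2.comp h1)
  · intro a ha b hb
    have ha' := (hH a).1 ha
    have hb' := (hH b).1 hb
    rw [dist_eq_norm, dist_eq_norm, ← sq_le_sq₀ (norm_nonneg _) (norm_nonneg _), hσ]
    set c := 2 * inner ℝ e (b - m) / ‖e‖ ^ 2 with hc
    have h1 : a - (b - c • e) = (a - b) + c • e := by abel
    rw [h1, norm_add_sq_real, inner_smul_right, norm_smul, mul_pow, Real.norm_eq_abs, sq_abs]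
    have h2 : inner ℝ (a - b) e = inner ℝ e (a - m) - inner ℝ e (b - m) := by
      rw [real_inner_comm, ← inner_sub_right]; congr 1; abel
    have h3 : c * ‖e‖ ^ 2 = 2 * inner ℝ e (b - m) := by rw [hc]; field_simp
    have h4 : c ≤ 0 := by rw [hc]; exact div_nonpos_of_nonpos_of_nonneg (by linarith) hn.le
    rw [h2]
    nlinarith [mul_nonneg_of_nonpos_of_nonpos h4 ha']
  · intro a ha
    have ha' : ¬ _ := fun h => ha ((hH a).2 h)
    refine (hH _).2 ?_
    rw [hσ]
    have : a - (2 * inner ℝ e (a - m) / ‖e‖ ^ 2) • e - m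
      = (a - m) - (2 * inner ℝ e (a - m) / ‖e‖ ^ 2) • e := by abel
    rw [this, inner_sub_right, inner_smul_right, real_inner_self_eq_norm_sq]
    field_simp
    push Not at ha'
    linarith
  · simpa [dist_eq_norm] using hle
  · change σ x = x'
    rw [hσ]
    have h1 : x - m = -((2⁻¹ : ℝ) • e) := by rw [hm, he]; module
    rw [h1, inner_neg_right, inner_smul_right, real_inner_self_eq_norm_sq]
    have : 2 * -(2⁻¹ * ‖e‖ ^ 2) / ‖e‖ ^ 2 = -1 := by field_simp
    rw [this, he]; module

end Polarizer

/-- Indicator of `[0, h)` as a function of the distance. -/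
def kb (h d : ℝ) : ℝ := if d < h then 1 else 0

lemma kb_antitone (h : ℝ) : Antitone (kb h) := by
  intro a b hab
  unfold kb
  split_ifs <;> norm_num
  linarith

lemma kb_nonneg (h d : ℝ) : 0 ≤ kb h d := by unfold kb; split_ifs <;> norm_num

lemma kb_le_one (h d : ℝ) : kb h d ≤ 1 := by unfold kb; split_ifs <;> norm_num

lemma measurable_kb (h : ℝ) : Measurable (kb h) := (kb_antitone h).measurable

/-- Interaction energy of `φ ∘ g` and `g` at range `h`. -/
def interact {N : ℕ} (φ : ℝ → ℝ) (h : ℝ) (g : Euc N → ℝ) : ℝ :=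
  ∫ p : Euc N × Euc N, φ (g p.1) * kb h (dist p.1 p.2) * g p.2

/-- Dominating function for the interaction integrand. -/
def interactBound (N : ℕ) (R M C h : ℝ) : Euc N × Euc N → ℝ :=
  (Metric.closedBall (0 : Euc N) (R + h) ×ˢ Metric.closedBall (0 : Euc N) R).indicator
    fun _ => C * M

lemma integrable_interactBound (N : ℕ) (R M C h : ℝ) : Integrable (interactBound N R M C h) := by
  refine (integrable_indicator_iff ?_).2 ?_
  · exact Metric.isClosed_closedBall.measurableSet.prod Metric.isClosed_closedBall.measurableSet
  · refine integrableOn_const ?_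
    exact ((isCompact_closedBall _ _).prod (isCompact_closedBall _ _)).measure_lt_top.ne

lemma interact_norm_le {N : ℕ} {R M C h : ℝ} {φ : ℝ → ℝ} {g : Euc N → ℝ}
    (hC : ∀ s, 0 ≤ s → s ≤ M → |φ s| ≤ C) (hb : ∀ x, 0 ≤ g x ∧ g x ≤ M)
    (hs : ∀ x, R < ‖x‖ → g x = 0) (p : Euc N × Euc N) :
    ‖φ (g p.1) * kb h (dist p.1 p.2) * g p.2‖ ≤ interactBound N R M C h p := by
  have hC0 : 0 ≤ C := (abs_nonneg _).trans (hC (g p.1) (hb _).1 (hb _).2)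
  have hM0 : 0 ≤ M := (hb p.1).1.trans (hb p.1).2
  unfold interactBound
  by_cases hp : p ∈ Metric.closedBall (0 : Euc N) (R + h) ×ˢ Metric.closedBall (0 : Euc N) R
  · rw [indicator_of_mem hp, norm_mul, norm_mul, Real.norm_eq_abs, Real.norm_eq_abs,
      Real.norm_eq_abs, abs_of_nonneg (kb_nonneg _ _), abs_of_nonneg (hb p.2).1]
    have h1 := hC (g p.1) (hb _).1 (hb _).2
    have h2 : |φ (g p.1)| * kb h (dist p.1 p.2) ≤ C * 1 :=
      mul_le_mul h1 (kb_le_one _ _) (kb_nonneg _ _) hC0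
    rw [mul_one] at h2
    exact mul_le_mul h2 (hb p.2).2 (hb p.2).1 hC0
  · rw [indicator_of_notMem hp]
    suffices h0 : φ (g p.1) * kb h (dist p.1 p.2) * g p.2 = 0 by rw [h0, norm_zero]
    by_cases h2 : ‖p.2‖ ≤ R
    · have h1 : ¬ ‖p.1‖ ≤ R + h := fun h1 => hp ⟨by simpa using h1, by simpa using h2⟩
      have : ¬ dist p.1 p.2 < h := by
        intro hd
        rw [dist_eq_norm] at hd
        have := norm_le_norm_add_norm_sub' p.1 p.2
        linarith
      simp [kb, this]
    · rw [hs _ (not_le.1 h2), mul_zero]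

lemma interact_measurable {N : ℕ} {h : ℝ} {φ : ℝ → ℝ} {g : Euc N → ℝ} (hφ : Measurable φ)
    (hg : Measurable g) :
    Measurable fun p : Euc N × Euc N => φ (g p.1) * kb h (dist p.1 p.2) * g p.2 := by
  have := measurable_kb h
  fun_prop

lemma interact_integrable {N : ℕ} {R M C h : ℝ} {φ : ℝ → ℝ} {g : Euc N → ℝ} (hφ : Measurable φ)
    (hg : Measurable g)
    (hC : ∀ s, 0 ≤ s → s ≤ M → |φ s| ≤ C) (hb : ∀ x, 0 ≤ g x ∧ g x ≤ M)
    (hs : ∀ x, R < ‖x‖ → g x = 0) :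
    Integrable fun p : Euc N × Euc N => φ (g p.1) * kb h (dist p.1 p.2) * g p.2 :=
  (integrable_interactBound N R M C h).mono' (interact_measurable hφ hg).aestronglyMeasurable
    (Eventually.of_forall (interact_norm_le hC hb hs))

/-- Functions with the same range, support and modulus bounds as `u`, equimeasurable with `u`
and with larger self-interaction at every range. -/
structure Adm {N : ℕ} (u : Euc N → ℝ) (R M : ℝ) (g : Euc N → ℝ) : Prop where
  bd : ∀ x, 0 ≤ g x ∧ g x ≤ M
  supp : ∀ x, R < ‖x‖ → g x = 0
  modulus : ∀ ε δ, (∀ x y, dist x y ≤ δ → |u x - u y| ≤ ε) → ∀ x y, dist x y ≤ δ → |g x - g y| ≤ ε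
  meas : ∀ φ : ℝ → ℝ, Continuous φ → Monotone φ → φ 0 = 0 → ∫ x, φ (g x) = ∫ x, φ (u x)
  inter : ∀ φ : ℝ → ℝ, Continuous φ → Monotone φ → φ 0 = 0 →
    ∀ h, interact φ h u ≤ interact φ h g

lemma bound_of_mono {φ : ℝ → ℝ} (hm : Monotone φ) (h0 : φ 0 = 0) (M : ℝ) :
    ∀ s, 0 ≤ s → s ≤ M → |φ s| ≤ φ M := fun s h1 h2 => by
  rw [abs_of_nonneg (h0 ▸ hm h1)]; exact hm h2

lemma comp_norm_le {N : ℕ} {R M : ℝ} {φ : ℝ → ℝ} {g : Euc N → ℝ} (hm : Monotone φ) (h0 : φ 0 = 0)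
    (hb : ∀ x, 0 ≤ g x ∧ g x ≤ M) (hs : ∀ x, R < ‖x‖ → g x = 0) (x : Euc N) :
    ‖φ (g x)‖ ≤ (Metric.closedBall (0 : Euc N) R).indicator (fun _ => φ M) x := by
  by_cases hx : ‖x‖ ≤ R
  · rw [indicator_of_mem (by simpa using hx)]
    exact bound_of_mono hm h0 M _ (hb x).1 (hb x).2
  · rw [indicator_of_notMem (by simpa using hx), hs _ (not_le.1 hx), h0, norm_zero]

lemma integrable_ball_const (N : ℕ) (R C : ℝ) :
    Integrable ((Metric.closedBall (0 : Euc N) R).indicator fun _ => C) :=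
  (integrable_indicator_iff Metric.isClosed_closedBall.measurableSet).2
    (integrableOn_const (isCompact_closedBall _ _).measure_lt_top.ne)

namespace Adm

variable {N : ℕ} {u g : Euc N → ℝ} {R M : ℝ}

lemma continuous (hu : UniformContinuous u) (h : Adm u R M g) : Continuous g := by
  rw [Metric.continuous_iff]
  intro b ε hε
  obtain ⟨δ, hδ, hd⟩ := Metric.uniformContinuous_iff.1 hu (ε / 2) (by positivity)
  refine ⟨δ / 2, by positivity, fun a ha => ?_⟩
  have := h.modulus (ε / 2) (δ / 2) (fun x y hxy => by
    have := hd (show dist x y < δ by linarith)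
    rw [Real.dist_eq] at this; exact this.le) a b ha.le
  rw [Real.dist_eq]; linarith

lemma norm_comp_le (h : Adm u R M g) {φ : ℝ → ℝ} (hm : Monotone φ) (h0 : φ 0 = 0) (x : Euc N) :
    ‖φ (g x)‖ ≤ (Metric.closedBall (0 : Euc N) R).indicator (fun _ => φ M) x :=
  comp_norm_le hm h0 h.bd h.supp x

lemma of_tendsto (hu : UniformContinuous u) {gs : ℕ → Euc N → ℝ} (hgs : ∀ n, Adm u R M (gs n))
    (ht : ∀ x, Tendsto (fun n => gs n x) atTop (nhds (g x))) : Adm u R M g where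
  bd x := ⟨ge_of_tendsto' (ht x) fun n => ((hgs n).bd x).1,
    le_of_tendsto' (ht x) fun n => ((hgs n).bd x).2⟩
  supp x hx := tendsto_nhds_unique (ht x) (by
    simp only [fun n => (hgs n).supp x hx]; exact tendsto_const_nhds)
  modulus ε δ h x y hxy := le_of_tendsto' ((ht x).sub (ht y)).abs
    fun n => (hgs n).modulus ε δ h x y hxy
  meas φ hc hm h0 := by
    have : Tendsto (fun n => ∫ x, φ (gs n x)) atTop (nhds (∫ x, φ (g x))) := by
      refine tendsto_integral_of_dominated_convergence _
        (fun n => (hc.comp ((hgs n).continuous hu)).aestronglyMeasurable)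
        (integrable_ball_const N R (φ M)) (fun n => Eventually.of_forall ((hgs n).norm_comp_le hm h0))
        (Eventually.of_forall fun x => (hc.tendsto _).comp (ht x))
    simp only [fun n => (hgs n).meas φ hc hm h0] at this
    exact tendsto_nhds_unique this tendsto_const_nhds |>.symm ▸ rfl
  inter φ hc hm h0 h := by
    have : Tendsto (fun n => interact φ h (gs n)) atTop (nhds (interact φ h g)) := by
      refine tendsto_integral_of_dominated_convergence (interactBound N R M (φ M) h)
        (fun n => (interact_measurable hc.measurable
          ((hgs n).continuous hu).measurable).aestronglyMeasurable)
        (integrable_interactBound _ _ _ _ _)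
        (fun n => Eventually.of_forall
          (interact_norm_le (bound_of_mono hm h0 M) (hgs n).bd (hgs n).supp))
        (Eventually.of_forall fun p => ?_)
      exact (((hc.tendsto _).comp (ht _)).mul tendsto_const_nhds).mul (ht _)
    exact ge_of_tendsto' this fun n => (hgs n).inter φ hc hm h0 h

end Adm

namespace Polarizer

variable {N : ℕ} (P : Polarizer N)

lemma integral_comp_refl (F : Euc N → ℝ) : ∫ x, F (P.σ x) = ∫ x, F x :=
  P.mp.integral_comp P.σ.isometry.isClosedEmbedding.measurableEmbedding F

lemma integrable_comp_refl {F : Euc N → ℝ} (hF : Integrable F) :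
    Integrable fun x => F (P.σ x) :=
  (P.mp.integrable_comp_emb P.σ.isometry.isClosedEmbedding.measurableEmbedding).2 hF

lemma integral_add_refl {F : Euc N → ℝ} (hF : Integrable F) :
    ∫ x, (F x + F (P.σ x)) = 2 * ∫ x, F x := by
  rw [integral_add hF (P.integrable_comp_refl hF), P.integral_comp_refl, two_mul]

lemma emb_prod_left : MeasurableEmbedding fun p : Euc N × Euc N => (P.σ p.1, p.2) :=
  (P.σ.toHomeomorph.prodCongr (Homeomorph.refl _)).measurableEmbedding

lemma emb_prod_right : MeasurableEmbedding fun p : Euc N × Euc N => (p.1, P.σ p.2) :=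
  ((Homeomorph.refl _).prodCongr P.σ.toHomeomorph).measurableEmbedding

lemma mp_prod_left :
    MeasurePreserving (fun p : Euc N × Euc N => (P.σ p.1, p.2)) volume volume :=
  P.mp.prod (MeasurePreserving.id volume)

lemma mp_prod_right :
    MeasurePreserving (fun p : Euc N × Euc N => (p.1, P.σ p.2)) volume volume :=
  (MeasurePreserving.id volume).prod P.mp

lemma integral_quad {φ : ℝ → ℝ} {h : ℝ} {g : Euc N → ℝ}
    (hI : Integrable fun p : Euc N × Euc N => φ (g p.1) * kb h (dist p.1 p.2) * g p.2) :
    Integrable (fun p : Euc N × Euc N => P.quad φ (kb h) g p.1 p.2) ∧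
    ∫ p : Euc N × Euc N, P.quad φ (kb h) g p.1 p.2 = 4 * interact φ h g := by
  set F : Euc N × Euc N → ℝ := fun p => φ (g p.1) * kb h (dist p.1 p.2) * g p.2 with hF
  have hl : ∀ G : Euc N × Euc N → ℝ, Integrable G →
      Integrable (fun p : Euc N × Euc N => G p + G (P.σ p.1, p.2)) ∧
      ∫ p : Euc N × Euc N, (G p + G (P.σ p.1, p.2)) = 2 * ∫ p, G p := by
    intro G hG
    have h1 : Integrable fun p : Euc N × Euc N => G (P.σ p.1, p.2) :=
      (P.mp_prod_left.integrable_comp_emb P.emb_prod_left).2 hG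
    refine ⟨hG.add h1, ?_⟩
    rw [integral_add hG h1, P.mp_prod_left.integral_comp P.emb_prod_left G, two_mul]
  have hr : ∀ G : Euc N × Euc N → ℝ, Integrable G →
      Integrable (fun p : Euc N × Euc N => G p + G (p.1, P.σ p.2)) ∧
      ∫ p : Euc N × Euc N, (G p + G (p.1, P.σ p.2)) = 2 * ∫ p, G p := by
    intro G hG
    have h1 : Integrable fun p : Euc N × Euc N => G (p.1, P.σ p.2) :=
      (P.mp_prod_right.integrable_comp_emb P.emb_prod_right).2 hG
    refine ⟨hG.add h1, ?_⟩
    rw [integral_add hG h1, P.mp_prod_right.integral_comp P.emb_prod_right G, two_mul]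
  obtain ⟨h1, h2⟩ := hl F hI
  obtain ⟨h3, h4⟩ := hr _ h1
  refine ⟨h3, ?_⟩
  change ∫ p : Euc N × Euc N, ((F p + F (P.σ p.1, p.2)) + (F (p.1, P.σ p.2) + F (P.σ p.1, P.σ p.2)))
    = _
  refine h4.trans ?_
  rw [h2]; unfold interact; ring

lemma pol_adm {u g : Euc N → ℝ} {R M : ℝ} (hu : UniformContinuous u) (hg : Adm u R M g) :
    Adm u R M (P.pol g) := by
  have bd : ∀ x, 0 ≤ P.pol g x ∧ P.pol g x ≤ M := by
    intro x
    unfold pol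
    split_ifs
    · exact ⟨le_max_of_le_left (hg.bd x).1, max_le (hg.bd _).2 (hg.bd _).2⟩
    · exact ⟨le_min (hg.bd _).1 (hg.bd _).1, min_le_of_left_le (hg.bd x).2⟩
  have supp : ∀ x, R < ‖x‖ → P.pol g x = 0 := by
    intro x hx
    unfold pol
    split_ifs with h
    · rw [hg.supp x hx, hg.supp _ (hx.trans_le (P.norm_le h)), max_self]
    · rw [hg.supp x hx, min_eq_left (hg.bd _).1]
  have modulus : ∀ ε δ, (∀ x y, dist x y ≤ δ → |u x - u y| ≤ ε) →
      ∀ x y, dist x y ≤ δ → |P.pol g x - P.pol g y| ≤ ε :=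
    fun ε δ h x y hxy => P.pol_modulus (hg.modulus ε δ h) x y hxy
  have cont : Continuous (P.pol g) := by
    rw [Metric.continuous_iff]
    intro b ε hε
    obtain ⟨δ, hδ, hd⟩ := Metric.uniformContinuous_iff.1 hu (ε / 2) (by positivity)
    refine ⟨δ / 2, by positivity, fun a ha => ?_⟩
    have := modulus (ε / 2) (δ / 2) (fun x y hxy => by
      have := hd (show dist x y < δ by linarith)
      rw [Real.dist_eq] at this; exact this.le) a b ha.le
    rw [Real.dist_eq]; linarith
  have gc := hg.continuous hu
  refine ⟨bd, supp, modulus, ?_, ?_⟩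
  · intro φ hc hm h0
    rw [← hg.meas φ hc hm h0]
    have i1 : Integrable fun x => φ (g x) := (integrable_ball_const N R (φ M)).mono'
      (hc.comp gc).aestronglyMeasurable (Eventually.of_forall (comp_norm_le hm h0 hg.bd hg.supp))
    have i2 : Integrable fun x => φ (P.pol g x) := (integrable_ball_const N R (φ M)).mono'
      (hc.comp cont).aestronglyMeasurable (Eventually.of_forall (comp_norm_le hm h0 bd supp))
    have e1 := P.integral_add_refl i1
    have e2 := P.integral_add_refl i2
    simp only [P.pol_comp_add] at e2
    linarith
  · intro φ hc hm h0 h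
    refine (hg.inter φ hc hm h0 h).trans ?_
    obtain ⟨i1, e1⟩ := P.integral_quad (interact_integrable (h := h) hc.measurable gc.measurable
      (bound_of_mono hm h0 M) hg.bd hg.supp)
    obtain ⟨i2, e2⟩ := P.integral_quad (interact_integrable (h := h) hc.measurable cont.measurable
      (bound_of_mono hm h0 M) bd supp)
    have := integral_mono i1 i2 fun p => P.quad_le hm (kb_antitone h) g p.1 p.2
    linarith

end Polarizer

open Classical in
/-- Extension by zero of a function on the closed ball. -/
def extBall {N : ℕ} {R : ℝ}
    (G : BoundedContinuousFunction (Metric.closedBall (0 : Euc N) R) ℝ) (x : Euc N) : ℝ :=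
  if h : x ∈ Metric.closedBall (0 : Euc N) R then G ⟨x, h⟩ else 0

lemma tendsto_extBall {N : ℕ} {R : ℝ} {ι : Type*} {l : Filter ι}
    {Gs : ι → BoundedContinuousFunction (Metric.closedBall (0 : Euc N) R) ℝ}
    {G : BoundedContinuousFunction (Metric.closedBall (0 : Euc N) R) ℝ}
    (h : Tendsto Gs l (nhds G)) (x : Euc N) :
    Tendsto (fun n => extBall (Gs n) x) l (nhds (extBall G x)) := by
  unfold extBall
  split_ifs with hx
  · exact ((BoundedContinuousFunction.lipschitz_eval_const ⟨x, hx⟩).continuous.tendsto G).comp h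
  · exact tendsto_const_nhds

lemma Adm.exists_extBall {N : ℕ} {u g : Euc N → ℝ} {R M : ℝ} (hu : UniformContinuous u)
    (hg : Adm u R M g) :
    ∃ G : BoundedContinuousFunction (Metric.closedBall (0 : Euc N) R) ℝ, extBall G = g := by
  have : CompactSpace (Metric.closedBall (0 : Euc N) R) :=
    isCompact_iff_compactSpace.1 (isCompact_closedBall _ _)
  refine ⟨BoundedContinuousFunction.mkOfCompact
    ⟨fun x => g x, (hg.continuous hu).comp continuous_subtype_val⟩, ?_⟩
  ext x
  unfold extBall
  split_ifs with hx
  · rfl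
  · exact (hg.supp x (by simpa using hx)).symm

lemma exists_adm_min {N : ℕ} {u : Euc N → ℝ} {R M : ℝ} (hu : UniformContinuous u)
    (hadm : Adm u R M u) :
    ∃ U, Adm u R M U ∧ ∀ g, Adm u R M g → ∫ x, U x * ‖x‖ ≤ ∫ x, g x * ‖x‖ := by
  have : CompactSpace (Metric.closedBall (0 : Euc N) R) :=
    isCompact_iff_compactSpace.1 (isCompact_closedBall _ _)
  set A : Set (BoundedContinuousFunction (Metric.closedBall (0 : Euc N) R) ℝ) :=
    {G | Adm u R M (extBall G)} with hA
  have hext : ∀ (G : BoundedContinuousFunction (Metric.closedBall (0 : Euc N) R) ℝ)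
      (x : Metric.closedBall (0 : Euc N) R), G x = extBall G x := by
    intro G x
    simp [extBall]
  have hcl : IsClosed A := by
    refine IsSeqClosed.isClosed fun Gs G hGs hG => ?_
    exact Adm.of_tendsto hu hGs (tendsto_extBall hG)
  have hcomp : IsCompact A := by
    refine BoundedContinuousFunction.arzela_ascoli₂ (Icc 0 M) isCompact_Icc A hcl ?_ ?_
    · intro G x hG
      rw [hext]
      exact hG.bd x
    · intro x₀
      rw [Metric.equicontinuousAt_iff_pair]
      intro ε hε
      obtain ⟨δ, hδ, hd⟩ := Metric.uniformContinuous_iff.1 hu (ε / 2) (by positivity)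
      refine ⟨Metric.ball x₀ (δ / 4), Metric.ball_mem_nhds _ (by positivity), ?_⟩
      intro x hx x' hx' G
      have hG : Adm u R M (extBall G.1) := G.2
      have h1 := hG.modulus (ε / 2) (δ / 2) (fun x y hxy => by
        have := hd (show dist x y < δ by linarith)
        rw [Real.dist_eq] at this; exact this.le) x x' (by
          have := dist_triangle_right (x : Euc N) x' x₀
          have h2 : dist (x : Euc N) x₀ < δ / 4 := hx
          have h3 : dist (x' : Euc N) x₀ < δ / 4 := hx'
          linarith)
      change dist (G.1 x) (G.1 x') < ε
      rw [hext, hext, Real.dist_eq]; linarith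
  have hne : A.Nonempty := by
    obtain ⟨G, hG⟩ := hadm.exists_extBall hu
    exact ⟨G, by change Adm u R M (extBall G); rw [hG]; exact hadm⟩
  have hcont : ContinuousOn (fun G => ∫ x, extBall G x * ‖x‖) A := by
    intro G _
    refine tendsto_integral_filter_of_dominated_convergence
      ((Metric.closedBall (0 : Euc N) R).indicator fun _ => M * R) ?_ ?_
      (integrable_ball_const _ _ _) (Eventually.of_forall fun x => ?_)
    · filter_upwards [self_mem_nhdsWithin] with G' hG'
      exact ((Adm.continuous hu hG').mul continuous_norm).aestronglyMeasurable
    · filter_upwards [self_mem_nhdsWithin] with G' hG'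
      refine Eventually.of_forall fun x => ?_
      have hG'' : Adm u R M (extBall G') := hG'
      by_cases hx : ‖x‖ ≤ R
      · rw [indicator_of_mem (by simpa using hx), norm_mul, norm_norm, Real.norm_eq_abs,
          abs_of_nonneg (hG''.bd x).1]
        exact mul_le_mul (hG''.bd x).2 hx (norm_nonneg _) ((hG''.bd x).1.trans (hG''.bd x).2)
      · rw [hG''.supp x (not_le.1 hx), zero_mul, norm_zero]
        rw [indicator_of_notMem (by simpa using hx)]
    · exact (tendsto_extBall (tendsto_id.mono_left nhdsWithin_le_nhds) x).mul tendsto_const_nhds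
  obtain ⟨G, hG, hmin⟩ := hcomp.exists_isMinOn hne hcont
  refine ⟨extBall G, hG, fun g hg => ?_⟩
  obtain ⟨G', rfl⟩ := hg.exists_extBall hu
  exact hmin hg

lemma Adm.integrable_mul_norm {N : ℕ} {u g : Euc N → ℝ} {R M : ℝ} (hu : UniformContinuous u)
    (hg : Adm u R M g) : Integrable fun x => g x * ‖x‖ := by
  refine ((hg.continuous hu).mul continuous_norm).integrable_of_hasCompactSupport ?_
  refine HasCompactSupport.intro (isCompact_closedBall (0 : Euc N) R) fun x hx => ?_
  change g x * ‖x‖ = 0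
  rw [hg.supp x (by simpa using hx), zero_mul]

/-- Rearrangement inequality: a radially decreasing function equimeasurable with `u` has larger
self-interaction at every range. -/
theorem exists_radial_adm {N : ℕ} {u : Euc N → ℝ} {R M : ℝ} (hu : UniformContinuous u)
    (hb : ∀ x, 0 ≤ u x ∧ u x ≤ M) (hs : ∀ x, R < ‖x‖ → u x = 0) :
    ∃ U, Adm u R M U ∧ ∀ x x', ‖x‖ ≤ ‖x'‖ → U x' ≤ U x := by
  have hadm : Adm u R M u := ⟨hb, hs, fun _ _ h => h, fun _ _ _ _ => rfl, fun _ _ _ _ _ => le_rfl⟩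
  obtain ⟨U, hU, hmin⟩ := exists_adm_min hu hadm
  have Uc := hU.continuous hu
  refine ⟨U, hU, ?_⟩
  have strict : ∀ x x', ‖x‖ < ‖x'‖ → U x' ≤ U x := by
    intro x x' hxx
    by_contra! hlt
    obtain ⟨P, hPx, hPH⟩ := Polarizer.exists_of_norm_le (fun h => by simp [h] at hxx) hxx.le
    have hxH : x ∈ P.H := by rw [hPH]; simp
    have hp := P.pol_adm hu hU
    have pc := hp.continuous hu
    have i1 := hU.integrable_mul_norm hu
    have i2 := hp.integrable_mul_norm hu
    have e1 := P.integral_add_refl i1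
    have e2 := P.integral_add_refl i2
    have hle := hmin _ hp
    set d : Euc N → ℝ := fun y => (U y * ‖y‖ + U (P.σ y) * ‖P.σ y‖) -
      (P.pol U y * ‖y‖ + P.pol U (P.σ y) * ‖P.σ y‖) with hd
    have hσ : Continuous P.σ := P.σ.continuous
    have dc : Continuous d := by fun_prop
    have d0 : 0 ≤ d := by
      intro y
      have := P.weight_le (ρ := fun s => -s) (fun a b h => neg_le_neg h) U y
      simp only [hd, Pi.zero_apply]
      linarith
    have iI : Integrable d :=
      (i1.add (P.integrable_comp_refl i1)).sub (i2.add (P.integrable_comp_refl i2))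
    have dI : ∫ y, d y ≤ 0 := by
      have := integral_sub (i1.add (P.integrable_comp_refl i1))
        (i2.add (P.integrable_comp_refl i2))
      refine this.le.trans ?_
      simp only [Pi.add_apply]
      rw [e1, e2]
      linarith
    have dz : ∫ y, d y = 0 := le_antisymm dI (integral_nonneg d0)
    have hae := (integral_eq_zero_iff_of_nonneg d0 iI).1 dz
    have hz := (Continuous.ae_eq_iff_eq volume dc continuous_zero).1 hae
    have hzx := congrFun hz x
    have hq := P.pol_refl (g := U) hxH
    have hq' := P.pol_mem (g := U) hxH
    rw [hPx] at hq hq'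
    simp only [hd, hPx, hq, hq', max_eq_right hlt.le, min_eq_left hlt.le,
      Pi.zero_apply] at hzx
    nlinarith
  intro x x' hxx
  rcases hxx.lt_or_eq with h | h
  · exact strict x x' h
  by_cases h0 : x' = 0
  · have : x = 0 := by rw [← norm_eq_zero, h, h0, norm_zero]
    rw [h0, this]
  have hcont : ContinuousWithinAt (fun t : ℝ => U (t • x')) (Ioi 1) 1 := by
    apply Continuous.continuousWithinAt; fun_prop
  have ht : Tendsto (fun t : ℝ => U (t • x')) (nhdsWithin 1 (Ioi 1)) (nhds (U x')) := by
    have := hcont.tendsto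
    rwa [one_smul] at this
  refine le_of_tendsto ht ?_
  filter_upwards [self_mem_nhdsWithin] with t (htt : 1 < t)
  refine strict _ _ ?_
  rw [norm_smul, Real.norm_eq_abs, abs_of_pos (by linarith), h]
  have : 0 < ‖x'‖ := norm_pos_iff.2 h0
  nlinarith

section Rearrangement

variable {N : ℕ} {E E' : Set (Euc N)} {g g' : Euc N → ℝ} {M σ τ : ℝ}

lemma rearr_nonneg (E : Set (Euc N)) (g : Euc N → ℝ) (σ : ℝ) : 0 ≤ rearr E g σ :=
  Real.sSup_nonneg fun _ ht => ht.1

lemma rearr_mem_le (hM : ∀ x ∈ E, |g x| ≤ M) {t : ℝ}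
    (ht : ENNReal.ofReal σ < volume {x | x ∈ E ∧ t < |g x|}) : t ≤ M := by
  by_contra! h
  have : {x | x ∈ E ∧ t < |g x|} = ∅ := by
    ext x
    simp only [Set.mem_ofPred_eq, mem_empty_iff_false, iff_false, not_and, not_lt]
    exact fun hx => (hM x hx).trans h.le
  simp [this] at ht

lemma rearr_le (hM0 : 0 ≤ M) (hM : ∀ x ∈ E, |g x| ≤ M) : rearr E g σ ≤ M :=
  Real.sSup_le (fun _ ht => rearr_mem_le hM ht.2) hM0

lemma lt_rearr_iff (hM : ∀ x ∈ E, |g x| ≤ M) (hτ : 0 ≤ τ) :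
    τ < rearr E g σ ↔ ENNReal.ofReal σ < volume {x | x ∈ E ∧ τ < |g x|} := by
  constructor
  · intro h
    have hne : {t : ℝ | 0 ≤ t ∧ ENNReal.ofReal σ < volume {x | x ∈ E ∧ t < |g x|}}.Nonempty := by
      by_contra hne
      rw [rearr, not_nonempty_iff_eq_empty.1 hne, Real.sSup_empty] at h
      linarith
    obtain ⟨t, ht, hτt⟩ := exists_lt_of_lt_csSup hne h
    exact ht.2.trans_le (measure_mono fun x hx => ⟨hx.1, hτt.trans hx.2⟩)
  · intro h
    have hU : {x | x ∈ E ∧ τ < |g x|} = ⋃ n : ℕ, {x | x ∈ E ∧ τ + 1 / (n + 1 : ℝ) < |g x|} := by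
      ext x
      simp only [Set.mem_ofPred_eq, mem_iUnion, exists_and_left]
      refine and_congr_right fun _ => ⟨fun hx => ?_, fun ⟨n, hn⟩ => ?_⟩
      · obtain ⟨n, hn⟩ := exists_nat_one_div_lt (sub_pos.2 hx)
        exact ⟨n, by linarith⟩
      · have : (0 : ℝ) < 1 / (n + 1 : ℝ) := by positivity
        linarith
    have hmono : Monotone fun n : ℕ => {x | x ∈ E ∧ τ + 1 / (n + 1 : ℝ) < |g x|} := by
      intro n m hnm x hx
      refine ⟨hx.1, lt_of_le_of_lt ?_ hx.2⟩
      have : (1 : ℝ) / (m + 1) ≤ 1 / (n + 1) := Nat.one_div_le_one_div hnm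
      linarith
    rw [hU, hmono.measure_iUnion] at h
    obtain ⟨n, hn⟩ := lt_iSup_iff.1 h
    have hp : (0 : ℝ) < 1 / (n + 1 : ℝ) := by positivity
    refine lt_of_lt_of_le (by linarith : τ < τ + 1 / (n + 1 : ℝ)) ?_
    exact le_csSup ⟨M, fun t ht => rearr_mem_le hM ht.2⟩ ⟨by linarith, hn⟩

lemma rearr_antitone (hM : ∀ x ∈ E, |g x| ≤ M) : Antitone (rearr E g) := by
  intro a b hab
  refine le_of_forall_lt fun τ hτ => ?_
  rcases lt_or_ge τ 0 with h | h
  · exact h.trans_le (rearr_nonneg _ _ _)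
  · rw [lt_rearr_iff hM h] at hτ ⊢
    exact (ENNReal.ofReal_le_ofReal hab).trans_lt hτ

lemma rearr_congr (h : ∀ τ, 0 ≤ τ →
    volume {x | x ∈ E ∧ τ < |g x|} = volume {x | x ∈ E' ∧ τ < |g' x|}) :
    rearr E g = rearr E' g' := by
  ext σ
  unfold rearr
  congr 1
  ext t
  simp only [Set.mem_ofPred_eq]
  exact and_congr_right fun ht => by rw [h t ht]

lemma rearr_le_add {δ M' : ℝ} (hM : ∀ x ∈ E, |g x| ≤ M) (hM' : ∀ x ∈ E, |g' x| ≤ M')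
    (hδ : 0 ≤ δ) (h : ∀ x ∈ E, |g x| ≤ |g' x| + δ) : rearr E g σ ≤ rearr E g' σ + δ := by
  refine le_of_forall_lt fun τ hτ => ?_
  rcases lt_or_ge τ δ with h1 | h1
  · exact h1.trans_le (by linarith [rearr_nonneg E g' σ])
  · rw [lt_rearr_iff hM (hδ.trans h1)] at hτ
    have : τ - δ < rearr E g' σ := by
      rw [lt_rearr_iff hM' (by linarith)]
      refine hτ.trans_le (measure_mono fun x hx => ⟨hx.1, ?_⟩)
      linarith [h x hx.1, hx.2]
    linarith

lemma volume_Ioc_lt {s : ℝ} (m : ENNReal) :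
    volume {σ | σ ∈ Ioc 0 s ∧ ENNReal.ofReal σ < m} = min (ENNReal.ofReal s) m := by
  rcases le_or_gt (ENNReal.ofReal s) m with h | h
  · rw [min_eq_left h]
    apply le_antisymm
    · refine (measure_mono fun σ hσ => hσ.1).trans (by rw [Real.volume_Ioc, sub_zero])
    · have : volume (Ioo 0 s) = ENNReal.ofReal s := by rw [Real.volume_Ioo, sub_zero]
      rw [← this]
      refine measure_mono fun σ hσ => ⟨⟨hσ.1, hσ.2.le⟩, lt_of_lt_of_le ?_ h⟩
      exact (ENNReal.ofReal_lt_ofReal_iff (hσ.1.trans hσ.2)).2 hσ.2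
  · rw [min_eq_right h.le]
    have hm : m ≠ ⊤ := (h.trans ENNReal.ofReal_lt_top).ne
    have : {σ | σ ∈ Ioc 0 s ∧ ENNReal.ofReal σ < m} = Ioo 0 m.toReal := by
      ext σ
      constructor
      · rintro ⟨h1, h2⟩
        exact ⟨h1.1, (ENNReal.ofReal_lt_iff_lt_toReal h1.1.le hm).1 h2⟩
      · rintro ⟨h1, h2⟩
        have h3 := (ENNReal.ofReal_lt_iff_lt_toReal h1.le hm).2 h2
        refine ⟨⟨h1, ?_⟩, h3⟩
        by_contra! hs
        exact absurd (h3.trans h) (not_lt.2 (ENNReal.ofReal_le_ofReal hs.le))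
    rw [this, Real.volume_Ioo, sub_zero, ENNReal.ofReal_toReal hm]

lemma lintegral_rearr (hM : ∀ x ∈ E, |g x| ≤ M) (s : ℝ) :
    ∫⁻ σ in Ioc 0 s, ENNReal.ofReal (rearr E g σ) =
      ∫⁻ τ in Ioi (0 : ℝ), min (ENNReal.ofReal s) (volume {x | x ∈ E ∧ τ < |g x|}) := by
  rw [lintegral_eq_lintegral_meas_lt _ (Eventually.of_forall fun σ => rearr_nonneg E g σ)
    (rearr_antitone hM).measurable.aemeasurable]
  refine setLIntegral_congr_fun measurableSet_Ioi fun τ hτ => ?_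
  rw [Measure.restrict_apply' measurableSet_Ioc, ← volume_Ioc_lt]
  congr 1
  ext σ
  simp only [mem_inter_iff, Set.mem_ofPred_eq, lt_rearr_iff hM (le_of_lt hτ)]
  exact and_comm

lemma intervalIntegrable_rearr (hM : ∀ x ∈ E, |g x| ≤ M) (a b : ℝ) :
    IntervalIntegrable (rearr E g) volume a b :=
  (rearr_antitone hM).intervalIntegrable

lemma integral_rearr (hM : ∀ x ∈ E, |g x| ≤ M) {s : ℝ} (hs : 0 ≤ s) :
    ∫ σ in (0 : ℝ)..s, rearr E g σ =
      (∫⁻ τ in Ioi (0 : ℝ), min (ENNReal.ofReal s) (volume {x | x ∈ E ∧ τ < |g x|})).toReal := by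
  rw [← lintegral_rearr hM, intervalIntegral.integral_of_le hs, integral_eq_lintegral_of_nonneg_ae
    (Eventually.of_forall fun σ => rearr_nonneg E g σ)
    (rearr_antitone hM).measurable.aestronglyMeasurable]

lemma lintegral_min_ne_top (hM : ∀ x ∈ E, |g x| ≤ M) (s : ℝ) :
    ∫⁻ τ in Ioi (0 : ℝ), min (ENNReal.ofReal s) (volume {x | x ∈ E ∧ τ < |g x|}) ≠ ⊤ := by
  rw [← lintegral_rearr hM]
  refine (lt_of_le_of_lt (setLIntegral_mono measurable_const fun σ _ =>
    ENNReal.ofReal_le_ofReal (rearr_le (le_max_right M 0) fun x hx =>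
      (hM x hx).trans (le_max_left _ _))) ?_).ne
  rw [setLIntegral_const, Real.volume_Ioc]
  exact ENNReal.mul_lt_top ENNReal.ofReal_lt_top ENNReal.ofReal_lt_top

lemma integral_abs_eq {A : Set (Euc N)} (hA : MeasurableSet A)
    (hg : AEStronglyMeasurable g (volume.restrict A)) :
    ∫ x in A, |g x| =
      (∫⁻ τ in Ioi (0 : ℝ), volume {x | x ∈ A ∧ τ < |g x|}).toReal := by
  have hg' : AEStronglyMeasurable (fun x => |g x|) (volume.restrict A) := hg.norm
  rw [integral_eq_lintegral_of_nonneg_ae (Eventually.of_forall fun x => abs_nonneg _) hg',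
    lintegral_eq_lintegral_meas_lt _ (Eventually.of_forall fun x => abs_nonneg _) hg'.aemeasurable]
  congr 1
  refine lintegral_congr fun τ => ?_
  rw [Measure.restrict_apply' hA]
  congr 1
  ext x
  exact and_comm

lemma setIntegral_abs_le_rearr {A : Set (Euc N)} (hM : ∀ x ∈ E, |g x| ≤ M) (hA : MeasurableSet A)
    (hAE : A ⊆ E) (hAf : volume A ≠ ⊤) (hg : AEStronglyMeasurable g (volume.restrict A)) :
    ∫ x in A, |g x| ≤ ∫ σ in (0 : ℝ)..(volume A).toReal, rearr E g σ := by
  rw [integral_rearr hM ENNReal.toReal_nonneg, integral_abs_eq hA hg]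
  refine ENNReal.toReal_mono (lintegral_min_ne_top hM _) (lintegral_mono fun τ => ?_)
  rw [ENNReal.ofReal_toReal hAf]
  exact le_min (measure_mono fun x hx => hx.1) (measure_mono fun x hx => ⟨hAE hx.1, hx.2⟩)

lemma setIntegral_abs_eq_rearr {A : Set (Euc N)} (hM : ∀ x ∈ E, |g x| ≤ M) (hA : MeasurableSet A)
    (hAE : A ⊆ E) (hAf : volume A ≠ ⊤) (hg : AEStronglyMeasurable g (volume.restrict A))
    (hsup : ∀ τ, 0 < τ → (∀ x ∈ A, τ < |g x|) ∨ ∀ x ∈ E, τ < |g x| → x ∈ A) :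
    ∫ x in A, |g x| = ∫ σ in (0 : ℝ)..(volume A).toReal, rearr E g σ := by
  rw [integral_rearr hM ENNReal.toReal_nonneg, integral_abs_eq hA hg]
  congr 1
  refine setLIntegral_congr_fun measurableSet_Ioi fun τ hτ => ?_
  rw [ENNReal.ofReal_toReal hAf]
  refine le_antisymm (le_min (measure_mono fun x hx => hx.1)
    (measure_mono fun x hx => ⟨hAE hx.1, hx.2⟩)) ?_
  rcases hsup τ hτ with h | h
  · exact (min_le_left _ _).trans (measure_mono fun x hx => ⟨hx, h x hx⟩)
  · exact (min_le_right _ _).trans (measure_mono fun x hx => ⟨h x hx.1 hx.2, hx.2⟩)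

lemma omegaN_pos (N : ℕ) : 0 < omegaN N :=
  ENNReal.toReal_pos (Metric.measure_ball_pos volume _ one_pos).ne' measure_ball_lt_top.ne

lemma ofReal_omegaN (N : ℕ) :
    ENNReal.ofReal (omegaN N) = volume (Metric.ball (0 : Euc N) 1) :=
  ENNReal.ofReal_toReal measure_ball_lt_top.ne

lemma volume_ball_rpow (hN : N ≠ 0) {m : ℝ} (hm : 0 ≤ m) :
    volume (Metric.ball (0 : Euc N) ((m / omegaN N) ^ ((N : ℝ)⁻¹))) = ENNReal.ofReal m := by
  have hω := omegaN_pos N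
  have : NeZero N := ⟨hN⟩
  rw [Measure.addHaar_ball _ _ (by positivity), finrank_euclideanSpace_fin, ← Real.rpow_natCast,
    ← Real.rpow_mul (by positivity), inv_mul_cancel₀ (by exact_mod_cast hN), Real.rpow_one,
    ← ofReal_omegaN, ← ENNReal.ofReal_mul (by positivity), div_mul_cancel₀ _ hω.ne']

lemma mem_ball_rpow_iff (hN : N ≠ 0) {m : ℝ} (hm : 0 ≤ m) (x : Euc N) :
    x ∈ Metric.ball (0 : Euc N) ((m / omegaN N) ^ ((N : ℝ)⁻¹)) ↔ omegaN N * ‖x‖ ^ N < m := by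
  have hω := omegaN_pos N
  have hN' : (0 : ℝ) < N := by exact_mod_cast Nat.pos_of_ne_zero hN
  rw [mem_ball_zero_iff, Real.lt_rpow_inv_iff_of_pos (norm_nonneg _) (by positivity) hN',
    Real.rpow_natCast, lt_div_iff₀ hω, mul_comm]

lemma volume_symmBall (hN : N ≠ 0) {Ω : Set (Euc N)} (hΩ : volume Ω ≠ ⊤) :
    volume (symmBall Ω) = volume Ω := by
  rw [symmBall, ballRad, volume_ball_rpow hN ENNReal.toReal_nonneg, ENNReal.ofReal_toReal hΩ]

lemma schwarz_nonneg (Ω : Set (Euc N)) (f : Euc N → ℝ) (x : Euc N) : 0 ≤ schwarz Ω f x :=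
  rearr_nonneg _ _ _

lemma schwarz_anti {Ω : Set (Euc N)} {f : Euc N → ℝ} (hM : ∀ x ∈ Ω, |f x| ≤ M) {x x' : Euc N}
    (h : ‖x‖ ≤ ‖x'‖) : schwarz Ω f x' ≤ schwarz Ω f x :=
  rearr_antitone hM (by have := omegaN_pos N; gcongr)

lemma rearr_schwarz (hN : N ≠ 0) {Ω : Set (Euc N)} (hΩ : volume Ω ≠ ⊤) {f : Euc N → ℝ}
    (hM : ∀ x ∈ Ω, |f x| ≤ M) :
    rearr (symmBall Ω) (schwarz Ω f) = rearr Ω f := by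
  refine rearr_congr fun τ hτ => ?_
  have hω := omegaN_pos N
  set m := volume {x | x ∈ Ω ∧ τ < |f x|} with hm
  have hle : m ≤ volume Ω := measure_mono fun x hx => hx.1
  have hmt : m ≠ ⊤ := (hle.trans_lt hΩ.lt_top).ne
  have : {x | x ∈ symmBall Ω ∧ τ < |schwarz Ω f x|} =
      Metric.ball (0 : Euc N) ((m.toReal / omegaN N) ^ ((N : ℝ)⁻¹)) := by
    ext x
    rw [mem_ball_rpow_iff hN ENNReal.toReal_nonneg, Set.mem_ofPred_eq,
      abs_of_nonneg (schwarz_nonneg _ _ _), schwarz, lt_rearr_iff hM hτ, ← hm,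
      ENNReal.ofReal_lt_iff_lt_toReal (by positivity) hmt, symmBall, ballRad,
      mem_ball_rpow_iff hN ENNReal.toReal_nonneg]
    exact and_iff_right_of_imp fun h => h.trans_le (ENNReal.toReal_mono hΩ hle)
  rw [this, volume_ball_rpow hN ENNReal.toReal_nonneg, ENNReal.ofReal_toReal hmt]

end Rearrangement

/-- A set that contains every point closer to the origin than one of its points. -/
def DownClosed {N : ℕ} (T : Set (Euc N)) : Prop :=
  ∀ x ∈ T, ∀ x', ‖x'‖ ≤ ‖x‖ → x' ∈ T

/-- Integrals of radially decreasing functions over down-closed sets. -/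
lemma setIntegral_downClosed_eq_rearr {N : ℕ} {B T : Set (Euc N)} {g : Euc N → ℝ} {M : ℝ}
    (hM : ∀ x ∈ B, |g x| ≤ M) (h0 : ∀ x ∈ B, 0 ≤ g x)
    (hg : ∀ x x', ‖x‖ ≤ ‖x'‖ → g x' ≤ g x)
    (hT : MeasurableSet T) (hTd : DownClosed T) (hTB : T ⊆ B) (hTf : volume T ≠ ⊤)
    (hgm : AEStronglyMeasurable g (volume.restrict T)) :
    ∫ x in T, g x = ∫ σ in (0 : ℝ)..(volume T).toReal, rearr B g σ := by
  rw [← setIntegral_abs_eq_rearr hM hT hTB hTf hgm]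
  · exact setIntegral_congr_fun hT fun x hx => (abs_of_nonneg (h0 x (hTB hx))).symm
  · intro τ _
    by_contra! h
    obtain ⟨⟨x, hx, hxτ⟩, x', hx', hxτ', hxT⟩ := h
    rw [abs_of_nonneg (h0 _ (hTB hx))] at hxτ
    rw [abs_of_nonneg (h0 _ hx')] at hxτ'
    rcases le_total ‖x'‖ ‖x‖ with hle | hle
    · exact hxT (hTd x hx x' hle)
    · linarith [hg _ _ hle]

/-- Continuous monotone approximation of the indicator of `[t, ∞)`. -/
def ramp (t : ℝ) (n : ℕ) (s : ℝ) : ℝ := min 1 (max 0 (1 + (n + 1) * ((s - t) / t)))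

lemma ramp_continuous (t : ℝ) (n : ℕ) : Continuous (ramp t n) := by unfold ramp; fun_prop

lemma ramp_mono {t : ℝ} (ht : 0 < t) (n : ℕ) : Monotone (ramp t n) := by
  intro a b hab
  unfold ramp
  gcongr

lemma ramp_zero {t : ℝ} (ht : 0 < t) (n : ℕ) : ramp t n 0 = 0 := by
  have : (0 - t) / t = -1 := by field_simp; simp
  rw [ramp, this, max_eq_left (by have : (0 : ℝ) ≤ n := n.cast_nonneg
                                  linarith)]
  norm_num

lemma ramp_nonneg (t : ℝ) (n : ℕ) (s : ℝ) : 0 ≤ ramp t n s :=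
  le_min zero_le_one (le_max_left _ _)

lemma ramp_abs_le (t : ℝ) (n : ℕ) (s : ℝ) : |ramp t n s| ≤ 1 := by
  rw [abs_of_nonneg (ramp_nonneg _ _ _)]; exact min_le_left _ _

/-- Indicator of `[t, ∞)`. -/
def stp (t : ℝ) : ℝ → ℝ := (Ici t).indicator 1

lemma measurable_stp (t : ℝ) : Measurable (stp t) := measurable_one.indicator measurableSet_Ici

lemma stp_abs_le (t s : ℝ) : |stp t s| ≤ 1 := by
  unfold stp indicator; split_ifs <;> simp

lemma tendsto_ramp {t : ℝ} (ht : 0 < t) (s : ℝ) :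
    Tendsto (fun n => ramp t n s) atTop (nhds (stp t s)) := by
  refine tendsto_const_nhds.congr' ?_
  rcases le_or_gt t s with h | h
  · refine Eventually.of_forall fun n => ?_
    have h1 : 0 ≤ (n + 1) * ((s - t) / t) := by
      have := sub_nonneg.2 h
      positivity
    change stp t s = ramp t n s
    rw [stp, indicator_of_mem (show s ∈ Ici t from h), ramp, max_eq_right (by linarith),
      min_eq_left (by linarith), Pi.one_apply]
  · obtain ⟨k, hk⟩ := exists_nat_gt (t / (t - s))
    filter_upwards [eventually_ge_atTop k] with n hn
    rw [stp, indicator_of_notMem (show s ∉ Ici t from not_le.2 h), ramp, max_eq_left, min_eq_right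
      zero_le_one]
    have h1 : (0 : ℝ) < t - s := sub_pos.2 h
    have h2 : (k : ℝ) ≤ n := by exact_mod_cast hn
    rw [div_lt_iff₀ h1] at hk
    have h3 : (n + 1) * ((s - t) / t) = -((n + 1) * (t - s) / t) := by ring
    have h4 : 1 ≤ (n + 1) * (t - s) / t := by
      rw [le_div_iff₀ ht]; nlinarith
    linarith

lemma tendsto_integral_ramp {N : ℕ} {R t : ℝ} {g : Euc N → ℝ} (ht : 0 < t) (hg : Measurable g)
    (hs : ∀ x, R < ‖x‖ → g x = 0) :
    Tendsto (fun n => ∫ x, ramp t n (g x)) atTop (nhds (volume.real {x | t ≤ g x})) := by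
  have : volume.real {x | t ≤ g x} = ∫ x, stp t (g x) := by
    rw [← integral_indicator_one (measurableSet_le measurable_const hg)]
    rfl
  rw [this]
  refine tendsto_integral_of_dominated_convergence
    ((Metric.closedBall (0 : Euc N) R).indicator fun _ => 1)
    (fun n => ((ramp_continuous t n).measurable.comp hg).aestronglyMeasurable)
    (integrable_ball_const _ _ _) (fun n => Eventually.of_forall fun x => ?_)
    (Eventually.of_forall fun x => tendsto_ramp ht _)
  by_cases hx : ‖x‖ ≤ R
  · rw [indicator_of_mem (by simpa using hx)]
    exact ramp_abs_le _ _ _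
  · rw [hs x (not_le.1 hx), ramp_zero ht, norm_zero]
    exact indicator_nonneg (fun _ _ => zero_le_one) _

lemma tendsto_interact_ramp {N : ℕ} {R M t : ℝ} {g : Euc N → ℝ} (ht : 0 < t) (hg : Measurable g)
    (hb : ∀ x, 0 ≤ g x ∧ g x ≤ M) (hs : ∀ x, R < ‖x‖ → g x = 0) (h : ℝ) :
    Tendsto (fun n => interact (ramp t n) h g) atTop (nhds (interact (stp t) h g)) := by
  refine tendsto_integral_of_dominated_convergence (interactBound N R M 1 h)
    (fun n => (interact_measurable (ramp_continuous t n).measurable hg).aestronglyMeasurable)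
    (integrable_interactBound _ _ _ _ _)
    (fun n => Eventually.of_forall (interact_norm_le (fun s _ _ => ramp_abs_le _ _ _) hb hs))
    (Eventually.of_forall fun p => ?_)
  exact ((tendsto_ramp ht _).mul_const _).mul_const _

lemma interact_stp {N : ℕ} {R M t : ℝ} {g : Euc N → ℝ} (hg : Measurable g)
    (hb : ∀ x, 0 ≤ g x ∧ g x ≤ M) (hs : ∀ x, R < ‖x‖ → g x = 0) (h : ℝ) :
    interact (stp t) h g = ∫ x in {x | t ≤ g x}, ∫ y in Metric.ball x h, g y := by
  have hi := interact_integrable (C := 1) (h := h) (measurable_stp t) hg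
    (fun s _ _ => stp_abs_le _ _) hb hs
  rw [interact, Measure.volume_eq_prod, integral_prod _ hi,
    ← integral_indicator (measurableSet_le measurable_const hg)]
  refine integral_congr_ae (Eventually.of_forall fun x => ?_)
  simp only [stp, indicator, mem_Ici, Set.mem_ofPred_eq]
  split_ifs with hx
  · rw [← integral_indicator measurableSet_ball]
    refine integral_congr_ae (Eventually.of_forall fun y => ?_)
    simp only [kb, indicator, Metric.mem_ball, dist_comm y x]
    split_ifs <;> simp
  · simp

lemma Adm.volume_ge {N : ℕ} {u U : Euc N → ℝ} {R M t : ℝ} (hu : UniformContinuous u)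
    (hs : ∀ x, R < ‖x‖ → u x = 0) (hU : Adm u R M U) (ht : 0 < t) :
    volume {x | t ≤ U x} = volume {x | t ≤ u x} := by
  have h1 := tendsto_integral_ramp ht (hU.continuous hu).measurable hU.supp
  have h2 := tendsto_integral_ramp ht hu.continuous.measurable hs
  simp only [hU.meas _ (ramp_continuous t _) (ramp_mono ht _) (ramp_zero ht _)] at h1
  have h3 := tendsto_nhds_unique h1 h2
  have hfin : ∀ g : Euc N → ℝ, (∀ x, R < ‖x‖ → g x = 0) → volume {x | t ≤ g x} ≠ ⊤ := by
    intro g hg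
    refine ((measure_mono fun x hx => ?_).trans_lt
      (isCompact_closedBall (0 : Euc N) R).measure_lt_top).ne
    rw [mem_closedBall_zero_iff]
    by_contra! hx'
    have : t ≤ g x := hx
    linarith [hg x hx']
  exact (measureReal_eq_measureReal_iff (hfin _ hU.supp) (hfin _ hs)).1 h3

lemma Adm.volume_gt {N : ℕ} {u U : Euc N → ℝ} {R M t : ℝ} (hu : UniformContinuous u)
    (hs : ∀ x, R < ‖x‖ → u x = 0) (hU : Adm u R M U) (ht : 0 ≤ t) :
    volume {x | t < U x} = volume {x | t < u x} := by
  have key : ∀ g : Euc N → ℝ, volume {x | t < g x} =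
      ⨆ n : ℕ, volume {x | t + 1 / (n + 1 : ℝ) ≤ g x} := by
    intro g
    have hm : Monotone fun n : ℕ => {x | t + 1 / (n + 1 : ℝ) ≤ g x} := by
      intro n m hnm x hx
      have : (1 : ℝ) / (m + 1) ≤ 1 / (n + 1) := Nat.one_div_le_one_div hnm
      have hx' : t + 1 / (n + 1 : ℝ) ≤ g x := hx
      exact le_trans (by linarith) hx'
    rw [← hm.measure_iUnion]
    congr 1
    ext x
    simp only [Set.mem_ofPred_eq, mem_iUnion]
    refine ⟨fun hx => ?_, fun ⟨n, hn⟩ => ?_⟩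
    · obtain ⟨n, hn⟩ := exists_nat_one_div_lt (sub_pos.2 hx)
      exact ⟨n, by linarith⟩
    · have : (0 : ℝ) < 1 / (n + 1 : ℝ) := by positivity
      linarith
  rw [key, key]
  refine iSup_congr fun n => hU.volume_ge hu hs ?_
  positivity

/-- Rearranging increases the ball averages over superlevel sets. -/
lemma Adm.ball_integral_le {N : ℕ} {u U : Euc N → ℝ} {R M t : ℝ} (hu : UniformContinuous u)
    (hb : ∀ x, 0 ≤ u x ∧ u x ≤ M) (hs : ∀ x, R < ‖x‖ → u x = 0) (hU : Adm u R M U) (ht : 0 < t)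
    (h : ℝ) :
    ∫ x in {x | t ≤ u x}, ∫ y in Metric.ball x h, u y ≤
      ∫ x in {x | t ≤ U x}, ∫ y in Metric.ball x h, U y := by
  have hUm := (hU.continuous hu).measurable
  rw [← interact_stp hu.continuous.measurable hb hs, ← interact_stp hUm hU.bd hU.supp]
  exact le_of_tendsto_of_tendsto' (tendsto_interact_ramp ht hu.continuous.measurable hb hs h)
    (tendsto_interact_ramp ht hUm hU.bd hU.supp h)
    fun n => hU.inter _ (ramp_continuous t n) (ramp_mono ht n) (ramp_zero ht n) h

lemma measurable_overlap {N : ℕ} {A : Set (Euc N)} (hA : MeasurableSet A) (h : ℝ) :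
    Measurable fun y => volume.real (A ∩ Metric.ball y h) := by
  have hS : MeasurableSet {p : Euc N × Euc N | p.2 ∈ A ∧ dist p.2 p.1 < h} :=
    (measurable_snd hA).inter (measurableSet_lt (measurable_snd.dist measurable_fst)
      measurable_const)
  exact (measurable_measure_prodMk_left hS).ennreal_toReal

lemma DownClosed.overlap_le {N : ℕ} {A : Set (Euc N)} (hA : MeasurableSet A) (hd : DownClosed A)
    (h : ℝ) {x x' : Euc N} (hle : ‖x‖ ≤ ‖x'‖) :
    volume (A ∩ Metric.ball x' h) ≤ volume (A ∩ Metric.ball x h) := by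
  rcases eq_or_ne x x' with rfl | hne
  · exact le_rfl
  obtain ⟨P, hPx, hPH⟩ := Polarizer.exists_of_norm_le hne hle
  set T := A ∩ Metric.ball x h with hT
  set T' := A ∩ Metric.ball x' h with hT'
  have mT : MeasurableSet T := hA.inter measurableSet_ball
  have mT' : MeasurableSet T' := hA.inter measurableSet_ball
  have hsub : T' \ T ⊆ P.σ ⁻¹' (T \ T') := by
    rintro a ⟨⟨haA, hax'⟩, haT⟩
    have hax : h ≤ dist a x := by
      by_contra! hc
      exact haT ⟨haA, hc⟩
    have hax' : dist a x' < h := hax'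
    have haH : a ∉ P.H := by
      rw [hPH]
      intro hc
      have hc : dist a x ≤ dist a x' := hc
      linarith
    have hn : ‖P.σ a‖ ≤ ‖a‖ := by
      have := P.norm_le (P.cover a haH)
      rwa [P.invol] at this
    refine ⟨⟨hd a haA _ hn, ?_⟩, fun hc => ?_⟩
    · rw [Metric.mem_ball, P.dist_swap, hPx]; exact hax'
    · have := hc.2
      rw [Metric.mem_ball, ← hPx, P.σ.dist_eq] at this
      linarith
  rw [← measure_inter_add_sdiff T' mT, ← measure_inter_add_sdiff T mT', inter_comm T T']
  refine add_le_add le_rfl ?_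
  calc volume (T' \ T) ≤ volume (P.σ ⁻¹' (T \ T')) := measure_mono hsub
    _ = volume (T \ T') := P.mp.measure_preimage (mT.diff mT').nullMeasurableSet

lemma setIntegral_ball_swap {N : ℕ} {A B : Set (Euc N)} {g : Euc N → ℝ} {h : ℝ}
    (hA : MeasurableSet A) (hB : MeasurableSet B) (hAf : volume A ≠ ⊤)
    (hAB : ∀ x ∈ A, Metric.ball x h ⊆ B) (hg : IntegrableOn g B) :
    ∫ x in A, ∫ y in Metric.ball x h, g y =
      ∫ y in B, volume.real (A ∩ Metric.ball y h) * g y := by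
  have : IsFiniteMeasure (volume.restrict A) := ⟨by simpa using hAf.lt_top⟩
  set S : Set (Euc N × Euc N) := {p | dist p.2 p.1 < h} with hS
  have mS : MeasurableSet S :=
    measurableSet_lt (measurable_snd.dist measurable_fst) measurable_const
  have hi : Integrable (S.indicator fun p => g p.2)
      ((volume.restrict A).prod (volume.restrict B)) :=
    (Integrable.comp_snd hg _).indicator mS
  have e1 : ∫ x in A, ∫ y in Metric.ball x h, g y =
      ∫ x in A, ∫ y in B, S.indicator (fun p => g p.2) (x, y) := by
    refine setIntegral_congr_fun hA fun x hx => ?_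
    have : ∀ y, S.indicator (fun p => g p.2) (x, y) = (Metric.ball x h).indicator g y := by
      intro y; rfl
    simp only [this]
    rw [setIntegral_indicator measurableSet_ball, inter_eq_self_of_subset_right (hAB x hx)]
  rw [e1, integral_integral_swap (f := fun x y => S.indicator (fun p => g p.2) (x, y)) hi]
  refine setIntegral_congr_fun hB fun y _ => ?_
  have : ∀ x, S.indicator (fun p => g p.2) (x, y) =
      (Metric.ball y h).indicator (fun _ => g y) x := by
    intro x
    simp only [indicator, hS, Set.mem_ofPred_eq, Metric.mem_ball, dist_comm x y]
  simp only [this]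
  rw [setIntegral_indicator measurableSet_ball, setIntegral_const, smul_eq_mul]

/-- If the integrals of `g` over down-closed sets are maximal at `A`, then so is its ball average
over `A`. -/
lemma DownClosed.ball_integral_le {N : ℕ} {A B : Set (Euc N)} {g : Euc N → ℝ} {h : ℝ}
    (hA : MeasurableSet A) (hd : DownClosed A) (hB : MeasurableSet B) (hAf : volume A ≠ ⊤)
    (hAB : ∀ x ∈ A, Metric.ball x h ⊆ B) (hg : IntegrableOn g B)
    (hT : ∀ T, MeasurableSet T → DownClosed T → T ⊆ B → ∫ x in T, g x ≤ ∫ x in A, g x) :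
    ∫ x in A, ∫ y in Metric.ball x h, g y ≤
      volume.real (Metric.ball (0 : Euc N) h) * ∫ x in A, g x := by
  rw [setIntegral_ball_swap hA hB hAf hAB hg]
  set φ : Euc N → ℝ := fun y => volume.real (A ∩ Metric.ball y h) with hφ
  set C := volume.real (Metric.ball (0 : Euc N) h) with hC
  have hφm : Measurable φ := measurable_overlap hA h
  have hφ0 : ∀ y, 0 ≤ φ y := fun y => measureReal_nonneg
  have hφC : ∀ y, φ y ≤ C := by
    intro y
    rw [hC, Measure.real, ← Measure.addHaar_ball_center volume y h]
    exact measureReal_mono inter_subset_right measure_ball_lt_top.ne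
  set S : Set (Euc N × ℝ) := {p | p.2 < φ p.1} with hS
  have mS : MeasurableSet S := measurableSet_lt measurable_snd (hφm.comp measurable_fst)
  have hi : Integrable (S.indicator fun p => g p.1)
      ((volume.restrict B).prod (volume.restrict (Ioc 0 C))) :=
    (Integrable.comp_fst hg _).indicator mS
  have e1 : ∫ y in B, φ y * g y =
      ∫ y in B, ∫ τ in Ioc 0 C, S.indicator (fun p => g p.1) (y, τ) := by
    refine integral_congr_ae (Eventually.of_forall fun y => ?_)
    have : ∀ τ, S.indicator (fun p => g p.1) (y, τ) = (Iio (φ y)).indicator (fun _ => g y) τ := by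
      intro τ; rfl
    simp only [this]
    rw [setIntegral_indicator measurableSet_Iio, setIntegral_const, smul_eq_mul]
    congr 1
    have hsub : Ioc 0 C ∩ Iio (φ y) = Ioo 0 (φ y) := by
      ext τ
      simp only [mem_inter_iff, mem_Ioc, mem_Iio, mem_Ioo]
      exact ⟨fun hh => ⟨hh.1.1, hh.2⟩, fun hh => ⟨⟨hh.1, hh.2.le.trans (hφC y)⟩, hh.2⟩⟩
    rw [hsub, Real.volume_real_Ioo_of_le (hφ0 y), sub_zero]
  rw [e1, integral_integral_swap (f := fun y τ => S.indicator (fun p => g p.1) (y, τ)) hi]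
  have hC0 : 0 ≤ C := measureReal_nonneg
  have e2 : ∫ τ in Ioc 0 C, ∫ x in A, g x = C * ∫ x in A, g x := by
    rw [setIntegral_const, smul_eq_mul, Real.volume_real_Ioc_of_le hC0, sub_zero]
  rw [← e2]
  refine setIntegral_mono_on hi.integral_prod_right (integrableOn_const (by simp))
    measurableSet_Ioc fun τ hτ => ?_
  have : ∀ y, S.indicator (fun p => g p.1) (y, τ) = {y | τ < φ y}.indicator g y := fun y => rfl
  simp only [this]
  have mT : MeasurableSet {y | τ < φ y} := measurableSet_lt measurable_const hφm
  have hTB : {y | τ < φ y} ⊆ B := by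
    intro y hy
    have hy : τ < φ y := hy
    have hne : (A ∩ Metric.ball y h).Nonempty := by
      by_contra hne
      have : φ y = 0 := by simp only [hφ]; rw [not_nonempty_iff_eq_empty.1 hne, measureReal_empty]
      linarith [hτ.1]
    obtain ⟨x, hxA, hxy⟩ := hne
    exact hAB x hxA (Metric.mem_ball_comm.1 hxy)
  rw [setIntegral_indicator mT, inter_eq_self_of_subset_right hTB]
  refine hT _ mT (fun x hx x' hle => ?_) hTB
  have hx : τ < φ x := hx
  exact hx.trans_le (ENNReal.toReal_mono
    ((measure_mono inter_subset_right).trans_lt measure_ball_lt_top).ne (hd.overlap_le hA h hle))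

lemma integrableOn_ball_integral {N : ℕ} {A B : Set (Euc N)} {g : Euc N → ℝ} {h : ℝ}
    (hA : MeasurableSet A) (hAf : volume A ≠ ⊤)
    (hAB : ∀ x ∈ A, Metric.ball x h ⊆ B) (hg : IntegrableOn g B) :
    IntegrableOn (fun x => ∫ y in Metric.ball x h, g y) A := by
  have : IsFiniteMeasure (volume.restrict A) := ⟨by simpa using hAf.lt_top⟩
  set S : Set (Euc N × Euc N) := {p | dist p.2 p.1 < h} with hS
  have mS : MeasurableSet S :=
    measurableSet_lt (measurable_snd.dist measurable_fst) measurable_const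
  have hi : Integrable (S.indicator fun p => g p.2)
      ((volume.restrict A).prod (volume.restrict B)) :=
    (Integrable.comp_snd hg _).indicator mS
  refine hi.integral_prod_left.congr ?_
  filter_upwards [ae_restrict_mem hA] with x hx
  have : ∀ y, S.indicator (fun p => g p.2) (x, y) = (Metric.ball x h).indicator g y := by
    intro y; rfl
  simp only [this]
  rw [setIntegral_indicator measurableSet_ball, inter_eq_self_of_subset_right (hAB x hx)]

lemma integrableOn_overlap_mul {N : ℕ} {A B : Set (Euc N)} {g : Euc N → ℝ} (h : ℝ)
    (hA : MeasurableSet A) (hg : IntegrableOn g B) :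
    IntegrableOn (fun y => volume.real (A ∩ Metric.ball y h) * g y) B := by
  refine Integrable.bdd_mul (c := volume.real (Metric.ball (0 : Euc N) h)) hg
    (measurable_overlap hA h).aestronglyMeasurable (Eventually.of_forall fun y => ?_)
  rw [Real.norm_eq_abs, abs_of_nonneg measureReal_nonneg, Measure.real, Measure.real,
    ← Measure.addHaar_ball_center volume y h]
  exact measureReal_mono inter_subset_right measure_ball_lt_top.ne

lemma DownClosed.subset_closedBall {N : ℕ} (hN : N ≠ 0) {A : Set (Euc N)} (hd : DownClosed A)
    (hAf : volume A ≠ ⊤) :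
    A ⊆ Metric.closedBall 0 (((volume A).toReal / omegaN N) ^ ((N : ℝ)⁻¹)) := by
  intro x hx
  have hω := omegaN_pos N
  have hN' : (0 : ℝ) < N := by exact_mod_cast Nat.pos_of_ne_zero hN
  have : NeZero N := ⟨hN⟩
  have h1 : volume (Metric.ball (0 : Euc N) ‖x‖) ≤ volume A :=
    measure_mono fun y hy => hd x hx y (mem_ball_zero_iff.1 hy).le
  rw [Measure.addHaar_ball _ _ (norm_nonneg _), finrank_euclideanSpace_fin, ← ofReal_omegaN,
    ← ENNReal.ofReal_mul (by positivity)] at h1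
  have h2 := (ENNReal.ofReal_le_iff_le_toReal hAf).1 h1
  rw [mem_closedBall_zero_iff, Real.le_rpow_inv_iff_of_pos (norm_nonneg _) (by positivity) hN',
    Real.rpow_natCast, le_div_iff₀ hω]
  exact h2

lemma volume_lt_of_isClosed_subset {N : ℕ} (hN : N ≠ 0) {A Ω : Set (Euc N)} (hA : IsClosed A)
    (hΩ : IsOpen Ω) (hΩf : volume Ω ≠ ⊤) (hne : Ω.Nonempty) (hAΩ : A ⊆ Ω) :
    volume A < volume Ω := by
  refine lt_of_le_of_ne (measure_mono hAΩ) fun heq => ?_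
  have h1 : volume (Ω \ A) = 0 := by
    rw [measure_sdiff hAΩ hA.measurableSet.nullMeasurableSet (heq ▸ hΩf), heq, tsub_self]
  have h2 := (hΩ.sdiff hA).measure_eq_zero_iff (μ := volume) |>.1 h1
  have h3 : Ω = A := (sdiff_eq_empty.1 h2).antisymm hAΩ
  have h4 : IsClopen Ω := ⟨h3 ▸ hA, hΩ⟩
  have h5 := h4.eq_univ hne
  have : Nonempty (Fin N) := ⟨⟨0, Nat.pos_of_ne_zero hN⟩⟩
  have : Nontrivial (Euc N) := by
    have := Fin.pos_iff_nonempty.2 this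
    infer_instance
  rw [h5, measure_univ_of_isAddLeftInvariant] at hΩf
  exact hΩf rfl

/-- At a maximum point of the difference of concentrations, the ball averages of `u` over its
superlevel set are dominated by those of the radial competitor `v₀` over a centred ball. -/
lemma exists_downClosed_ball_average_le {N : ℕ} (hN : N ≠ 0) {Ω : Set (Euc N)} (hΩo : IsOpen Ω)
    (hΩb : Bornology.IsBounded Ω) (hne : Ω.Nonempty) {u v₀ : Euc N → ℝ} {M M' t ε : ℝ}
    (hu : Continuous u) (hb : ∀ x, 0 ≤ u x ∧ u x ≤ M) (hu0 : ∀ x, x ∉ Ω → u x = 0)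
    (hv0 : ∀ x ∈ symmBall Ω, 0 ≤ v₀ x) (hvM : ∀ x ∈ symmBall Ω, |v₀ x| ≤ M')
    (hvd : ∀ x x', ‖x‖ ≤ ‖x'‖ → v₀ x' ≤ v₀ x) (hvc : ContinuousOn v₀ (symmBall Ω)) (ht : 0 < t)
    (hmax : ∀ s ∈ Icc 0 (volume Ω).toReal,
      (∫ σ in (0 : ℝ)..s, rearr Ω u σ) - (∫ σ in (0 : ℝ)..s, rearr (symmBall Ω) v₀ σ) - ε * s ≤
      (∫ σ in (0 : ℝ)..(volume {x | t ≤ u x}).toReal, rearr Ω u σ) -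
        (∫ σ in (0 : ℝ)..(volume {x | t ≤ u x}).toReal, rearr (symmBall Ω) v₀ σ) -
        ε * (volume {x | t ≤ u x}).toReal) :
    ∃ A', MeasurableSet A' ∧ DownClosed A' ∧ volume A' = volume {x | t ≤ u x} ∧
      ∃ r < ballRad Ω, A' ⊆ Metric.closedBall 0 r ∧ ∀ h, 0 < h → r + h ≤ ballRad Ω →
        ∫ x in {x | t ≤ u x}, ((∫ y in Metric.ball x h, u y) -
            volume.real (Metric.ball (0 : Euc N) h) * u x) ≤
          ∫ x in A', ((∫ y in Metric.ball x h, v₀ y) -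
            volume.real (Metric.ball (0 : Euc N) h) * v₀ x) := by
  obtain ⟨R, hR⟩ := hΩb.subset_closedBall 0
  have hsupp : ∀ x, R < ‖x‖ → u x = 0 := fun x hx =>
    hu0 x fun hxΩ => by have := hR hxΩ; rw [mem_closedBall_zero_iff] at this; linarith
  have hcs : HasCompactSupport u := HasCompactSupport.intro (isCompact_closedBall (0 : Euc N) R)
    fun x hx => hsupp x (by simpa using hx)
  have huu : UniformContinuous u := hcs.uniformContinuous_of_continuous hu
  obtain ⟨U, hU, hUd⟩ := exists_radial_adm huu hb hsupp
  have hUc := hU.continuous huu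
  have hΩf : volume Ω ≠ ⊤ := hΩb.measure_lt_top.ne
  set A : Set (Euc N) := {x | t ≤ u x} with hA
  set A' : Set (Euc N) := {x | t ≤ U x} with hA'
  set B := symmBall Ω with hB
  have hBf : volume B ≠ ⊤ := by rw [hB, volume_symmBall hN hΩf]; exact hΩf
  have mB : MeasurableSet B := measurableSet_ball
  have hAcl : IsClosed A := isClosed_le continuous_const hu
  have mA' : MeasurableSet A' := (isClosed_le continuous_const hUc).measurableSet
  have hAΩ : A ⊆ Ω := by
    intro x hx
    by_contra hc
    have hx : t ≤ u x := hx
    linarith [hu0 x hc]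
  have hvol : volume A' = volume A := hU.volume_ge huu hsupp ht
  have hlt : volume A < volume Ω := volume_lt_of_isClosed_subset hN hAcl hΩo hΩf hne hAΩ
  have hAf : volume A ≠ ⊤ := (hlt.trans hΩf.lt_top).ne
  have hA'f : volume A' ≠ ⊤ := hvol ▸ hAf
  have hd : DownClosed A' := fun x hx x' hle => le_trans (show t ≤ U x from hx) (hUd _ _ hle)
  have hω := omegaN_pos N
  have hN' : (0 : ℝ) < N := by exact_mod_cast Nat.pos_of_ne_zero hN
  have habs : ∀ x, |u x| = u x := fun x => abs_of_nonneg (hb x).1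
  have habs' : ∀ x, |U x| = U x := fun x => abs_of_nonneg (hU.bd x).1
  have hre : rearr univ U = rearr Ω u := by
    refine rearr_congr fun τ hτ => ?_
    have e1 : {x | x ∈ univ ∧ τ < |U x|} = {x | τ < U x} := by ext x; simp [habs']
    have e2 : {x | x ∈ Ω ∧ τ < |u x|} = {x | τ < u x} := by
      ext x
      simp only [habs, Set.mem_ofPred_eq, and_iff_right_iff_imp]
      intro hx
      by_contra hc
      linarith [hu0 x hc]
    rw [e1, e2, hU.volume_gt huu hsupp hτ]
  have eU : ∀ T, MeasurableSet T → DownClosed T → volume T ≠ ⊤ →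
      ∫ x in T, U x = ∫ σ in (0 : ℝ)..(volume T).toReal, rearr Ω u σ := by
    intro T mT dT fT
    rw [← hre]
    exact setIntegral_downClosed_eq_rearr (M := M) (fun x _ => by rw [habs']; exact (hU.bd x).2)
      (fun x _ => (hU.bd x).1) hUd mT dT (subset_univ _) fT hUc.aestronglyMeasurable
  have eu : ∫ x in A, u x = ∫ σ in (0 : ℝ)..(volume A).toReal, rearr Ω u σ := by
    rw [← setIntegral_abs_eq_rearr (M := M) (fun x _ => by rw [habs]; exact (hb x).2)
      hAcl.measurableSet hAΩ hAf hu.aestronglyMeasurable]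
    · simp only [habs]
    · intro τ _
      simp only [habs]
      rcases lt_or_ge τ t with h | h
      · exact Or.inl fun x hx => h.trans_le hx
      · exact Or.inr fun x _ hx => h.trans hx.le
  have ev : ∀ T, MeasurableSet T → DownClosed T → T ⊆ B →
      ∫ x in T, v₀ x = ∫ σ in (0 : ℝ)..(volume T).toReal, rearr B v₀ σ := by
    intro T mT dT hTB
    exact setIntegral_downClosed_eq_rearr hvM hv0 hvd mT dT hTB
      ((measure_mono hTB).trans_lt hBf.lt_top).ne ((hvc.mono hTB).aestronglyMeasurable mT)
  set r := ((volume A').toReal / omegaN N) ^ ((N : ℝ)⁻¹) with hr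
  have hA'r := hd.subset_closedBall hN hA'f
  have hrlt : r < ballRad Ω := by
    rw [hr, ballRad]
    have : (volume A').toReal < (volume Ω).toReal := by
      rw [hvol]; exact (ENNReal.toReal_lt_toReal hAf hΩf).2 hlt
    exact Real.rpow_lt_rpow (by positivity) (by gcongr) (by positivity)
  have hA'B : A' ⊆ B := hA'r.trans (Metric.closedBall_subset_ball hrlt)
  have iU : ∀ T, volume T ≠ ⊤ → IntegrableOn U T := fun T hT =>
    (IntegrableOn.of_bound hT.lt_top hUc.aestronglyMeasurable M
      (Eventually.of_forall fun x => by rw [Real.norm_eq_abs, habs']; exact (hU.bd x).2))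
  have iu : ∀ T, volume T ≠ ⊤ → IntegrableOn u T := fun T hT =>
    (IntegrableOn.of_bound hT.lt_top hu.aestronglyMeasurable M
      (Eventually.of_forall fun x => by rw [Real.norm_eq_abs, habs]; exact (hb x).2))
  have iv : IntegrableOn v₀ B := IntegrableOn.of_bound hBf.lt_top (hvc.aestronglyMeasurable mB) M'
    ((ae_restrict_mem mB).mono fun x hx => hvM x hx)
  have ic : ∀ T : Set (Euc N), volume T ≠ ⊤ → IntegrableOn (fun _ => ε) T := fun T hT =>
    integrableOn_const hT
  have hint : ∀ T, volume T ≠ ⊤ → T ⊆ B → ∫ x in T, (U x - v₀ x - ε) =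
      (∫ x in T, U x) - (∫ x in T, v₀ x) - ε * (volume T).toReal := by
    intro T hT hTB
    have e1 := integral_sub ((iU T hT).sub (iv.mono_set hTB)) (ic T hT)
    have e2 := integral_sub (iU T hT) (iv.mono_set hTB)
    simp only [Pi.sub_apply] at e1
    rw [e1, e2, setIntegral_const, smul_eq_mul, mul_comm ε]
    rfl
  refine ⟨A', mA', hd, hvol, r, hrlt, hA'r, fun h hh hrh => ?_⟩
  have hball : ∀ x ∈ A', Metric.ball x h ⊆ B := by
    intro x hx
    refine Metric.ball_subset_ball' ?_
    have := hA'r hx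
    rw [Metric.mem_closedBall] at this
    linarith
  have hg : IntegrableOn (fun x => U x - v₀ x - ε) B := ((iU B hBf).sub iv).sub (ic B hBf)
  have key := hd.ball_integral_le mA' mB hA'f hball hg (fun T mT dT hTB => by
    have hTf : volume T ≠ ⊤ := ((measure_mono hTB).trans_lt hBf.lt_top).ne
    rw [hint T hTf hTB, hint A' hA'f hA'B, eU T mT dT hTf, eU A' mA' hd hA'f, ev T mT dT hTB,
      ev A' mA' hd hA'B, hvol]
    refine hmax _ ⟨ENNReal.toReal_nonneg, ENNReal.toReal_mono hΩf ?_⟩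
    rw [← volume_symmBall hN hΩf]
    exact measure_mono hTB)
  set β := volume.real (Metric.ball (0 : Euc N) h) with hβ
  have hsplit : ∫ x in A', ∫ y in Metric.ball x h, (U y - v₀ y - ε) =
      (∫ x in A', ∫ y in Metric.ball x h, U y) - (∫ x in A', ∫ y in Metric.ball x h, v₀ y) -
        ε * (β * (volume A').toReal) := by
    have e0 : ∫ x in A', ∫ y in Metric.ball x h, ε = ε * (β * (volume A').toReal) := by
      have : ∀ x : Euc N, ∫ y in Metric.ball x h, ε = β * ε := by
        intro x
        rw [setIntegral_const, smul_eq_mul, hβ, Measure.real, Measure.real,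
          Measure.addHaar_ball_center volume x h]
      simp only [this]
      rw [setIntegral_const, smul_eq_mul, Measure.real]
      ring
    rw [← e0, setIntegral_ball_swap mA' mB hA'f hball hg,
      setIntegral_ball_swap mA' mB hA'f hball (iU B hBf),
      setIntegral_ball_swap mA' mB hA'f hball iv,
      setIntegral_ball_swap mA' mB hA'f hball (ic B hBf)]
    have j1 := integrableOn_overlap_mul h mA' (iU B hBf)
    have j2 := integrableOn_overlap_mul h mA' iv
    have j3 := integrableOn_overlap_mul h mA' (ic B hBf)
    have q1 := integral_sub j1 j2
    have q2 := integral_sub (j1.sub j2) j3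
    simp only [Pi.sub_apply] at q2
    rw [← q1, ← q2]
    refine integral_congr_ae (Eventually.of_forall fun x => ?_)
    ring
  have riesz := hU.ball_integral_le huu hb hsupp ht h
  rw [hsplit, hint A' hA'f hA'B, eU A' mA' hd hA'f, hvol, ← eu] at key
  have hfA : ∀ x ∈ A, Metric.ball x h ⊆ Metric.closedBall 0 (R + h) := by
    intro x hx y hy
    have h1 := hR (hAΩ hx)
    rw [Metric.mem_closedBall] at h1 ⊢
    have h2 : dist y x < h := hy
    linarith [dist_triangle y x 0]
  have k1 := integrableOn_ball_integral hAcl.measurableSet hAf hfA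
    (iu _ (isCompact_closedBall _ _).measure_lt_top.ne)
  have k2 := integrableOn_ball_integral mA' hA'f hball iv
  rw [integral_sub k1 ((iu A hAf).const_mul β),
    integral_sub k2 ((iv.mono_set hA'B).const_mul β), integral_const_mul, integral_const_mul]
  linarith

/-- The symmetric second difference is a value of the second derivative. -/
lemma exists_second_diff_eq {γ γ' γ'' : ℝ → ℝ} {k : ℝ} (hk : 0 < k)
    (h1 : ∀ t ∈ Icc (-k) k, HasDerivAt γ (γ' t) t)
    (h2 : ∀ t ∈ Icc (-k) k, HasDerivAt γ' (γ'' t) t) :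
    ∃ ζ ∈ Ioo (-k) k, γ k + γ (-k) - 2 * γ 0 = k ^ 2 * γ'' ζ := by
  have hd : ∀ t ∈ Icc 0 k, HasDerivAt (fun t => γ t + γ (-t)) (γ' t - γ' (-t)) t := by
    intro t ht
    have a := h1 t ⟨by linarith [ht.1], ht.2⟩
    have b := (h1 (-t) ⟨by linarith [ht.2], by linarith [ht.1]⟩).scomp t (hasDerivAt_neg t)
    exact (a.add b).congr_deriv (by simp [sub_eq_add_neg])
  have hs : ∀ t : ℝ, HasDerivAt (fun t : ℝ => t ^ 2) (2 * t) t := fun t => by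
    simpa using hasDerivAt_pow 2 t
  obtain ⟨τ, hτ, e1⟩ := exists_ratio_hasDerivAt_eq_ratio_slope (fun t => γ t + γ (-t)) _ hk
    (fun t ht => (hd t ht).continuousAt.continuousWithinAt)
    (fun t ht => hd t ⟨ht.1.le, ht.2.le⟩) (fun t => t ^ 2) _
    (fun t _ => (hs t).continuousAt.continuousWithinAt) (fun t _ => hs t)
  obtain ⟨ζ, hζ, e2⟩ := exists_hasDerivAt_eq_slope γ' γ'' (show -τ < τ by linarith [hτ.1])
    (fun t ht => (h2 t ⟨by linarith [ht.1, hτ.2], by linarith [ht.2, hτ.2]⟩).continuousAt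
      |>.continuousWithinAt)
    (fun t ht => h2 t ⟨by linarith [ht.1, hτ.2], by linarith [ht.2, hτ.2]⟩)
  refine ⟨ζ, ⟨by linarith [hζ.1, hτ.2], by linarith [hζ.2, hτ.2]⟩, ?_⟩
  have hτ0 := hτ.1
  rw [eq_div_iff (by linarith)] at e2
  simp only [neg_zero] at e1
  have e3 : (2 * τ) * (γ k + γ (-k) - 2 * γ 0) = (2 * τ) * (k ^ 2 * γ'' ζ) := by
    have : γ' τ - γ' (-τ) = γ'' ζ * (2 * τ) := by rw [← e2]; ring
    rw [this] at e1
    linarith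
  exact mul_left_cancel₀ (by positivity) e3

lemma exists_second_diff_line {V : Type*} [NormedAddCommGroup V] [NormedSpace ℝ V] {F : V → ℝ}
    {O : Set V} (hO : IsOpen O) (hF : ContDiffOn ℝ 2 F O) {x e : V} {k : ℝ} (hk : 0 < k)
    (hseg : ∀ t ∈ Icc (-k) k, x + t • e ∈ O) :
    ∃ ζ ∈ Ioo (-k) k, F (x + k • e) + F (x + (-k) • e) - 2 * F x =
      k ^ 2 * fderiv ℝ (fderiv ℝ F) (x + ζ • e) e e := by
  have hl : ∀ t : ℝ, HasDerivAt (fun t : ℝ => x + t • e) e t := fun t => by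
    simpa using ((hasDerivAt_id t).smul_const e).const_add x
  have hF1 : ContDiffOn ℝ 1 (fderiv ℝ F) O := hF.fderiv_of_isOpen hO (by norm_num)
  obtain ⟨ζ, hζ, h⟩ := exists_second_diff_eq (γ := fun t => F (x + t • e))
    (γ' := fun t => fderiv ℝ F (x + t • e) e)
    (γ'' := fun t => fderiv ℝ (fderiv ℝ F) (x + t • e) e e) hk
    (fun t ht => by
      have := ((hF.differentiableOn (by norm_num)).differentiableAt
        (hO.mem_nhds (hseg t ht))).hasFDerivAt
      exact this.comp_hasDerivAt t (hl t))
    (fun t ht => by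
      have := ((hF1.differentiableOn (by norm_num)).differentiableAt
        (hO.mem_nhds (hseg t ht))).hasFDerivAt
      have h2 := this.comp_hasDerivAt t (hl t)
      exact h2.clm_apply (hasDerivAt_const t e) |>.congr_deriv (by simp))
  exact ⟨ζ, hζ, by simpa using h⟩

/-- The common value of the second moments of the unit ball. -/
def momentB (N : ℕ) (i : Fin N) : ℝ := ∫ z in Metric.ball (0 : Euc N) 1, z i * z i

lemma setIntegral_ball_comp_isometry {N : ℕ} (L : Euc N ≃ₗᵢ[ℝ] Euc N) (g : Euc N → ℝ) (h : ℝ) :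
    ∫ z in Metric.ball (0 : Euc N) h, g (L z) = ∫ z in Metric.ball (0 : Euc N) h, g z := by
  have := L.measurePreserving.setIntegral_preimage_emb
    L.toHomeomorph.measurableEmbedding g (Metric.ball (0 : Euc N) h)
  rwa [show L ⁻¹' Metric.ball (0 : Euc N) h = Metric.ball 0 h by
    ext z; simp] at this

lemma momentB_eq {N : ℕ} (i j : Fin N) : momentB N i = momentB N j := by
  have := setIntegral_ball_comp_isometry
    (LinearIsometryEquiv.piLpCongrLeft 2 ℝ ℝ (Equiv.swap i j)) (fun z => z i * z i) 1
  rw [momentB, ← this, momentB]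
  simp

lemma moment_offdiag {N : ℕ} {i j : Fin N} (hij : i ≠ j) :
    ∫ z in Metric.ball (0 : Euc N) 1, z i * z j = 0 := by
  have := setIntegral_ball_comp_isometry
    (LinearIsometryEquiv.piLpCongrRight 2 fun k : Fin N =>
      if k = i then LinearIsometryEquiv.neg ℝ (E := ℝ) else LinearIsometryEquiv.refl ℝ ℝ)
    (fun z => z i * z j) 1
  simp [hij.symm, integral_neg] at this
  linarith

lemma integrableOn_ball_mul {N : ℕ} (i j : Fin N) :
    IntegrableOn (fun z : Euc N => z i * z j) (Metric.ball 0 1) :=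
  ((Continuous.continuousOn (by fun_prop)).integrableOn_compact
    (isCompact_closedBall (0 : Euc N) 1)).mono_set Metric.ball_subset_closedBall

lemma momentB_pos {N : ℕ} (i : Fin N) : 0 < momentB N i := by
  have hnn : 0 ≤ᵐ[volume.restrict (Metric.ball (0 : Euc N) 1)] fun z : Euc N => z i * z i :=
    Eventually.of_forall fun z => mul_self_nonneg (z i)
  rw [momentB, setIntegral_pos_iff_support_of_nonneg_ae hnn (integrableOn_ball_mul i i)]
  refine IsOpen.measure_pos _ ?_ ?_
  · exact (Continuous.isOpen_support (by fun_prop)).inter Metric.isOpen_ball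
  · refine ⟨EuclideanSpace.single i (1 / 2), ?_, ?_⟩
    · simp
    · simp; norm_num

lemma integral_ball_bilin {N : ℕ} (D : Euc N →L[ℝ] Euc N →L[ℝ] ℝ) (i₀ : Fin N) :
    ∫ z in Metric.ball (0 : Euc N) 1, D z z = momentB N i₀ *
      ∑ i, D (EuclideanSpace.single i 1) (EuclideanSpace.single i 1) := by
  have hz : ∀ z : Euc N, D z z = ∑ i, ∑ j,
      (z i * z j) * D (EuclideanSpace.single i 1) (EuclideanSpace.single j 1) := by
    intro z
    have e : z = ∑ i, z i • EuclideanSpace.single i (1 : ℝ) := by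
      ext j
      simp [Pi.single_apply]
    conv_lhs => rw [e]
    simp only [map_sum, map_smul, sum_apply, smul_apply,
      smul_eq_mul, Finset.mul_sum]
    refine Finset.sum_comm.trans ?_
    refine Finset.sum_congr rfl fun i _ => Finset.sum_congr rfl fun j _ => by ring
  rw [setIntegral_congr_fun measurableSet_ball fun z _ => hz z]
  rw [integral_finsetSum _ fun i _ => integrable_finsetSum _ fun j _ =>
    (integrableOn_ball_mul i j).mul_const _, Finset.mul_sum]
  refine Finset.sum_congr rfl fun i _ => ?_
  rw [integral_finsetSum _ fun j _ => (integrableOn_ball_mul i j).mul_const _,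
    Finset.sum_eq_single i]
  · rw [integral_mul_const, momentB_eq i₀ i]; rfl
  · intro j _ hj
    rw [integral_mul_const, moment_offdiag hj.symm, zero_mul]
  · simp

lemma setIntegral_ball_eq {N : ℕ} (g : Euc N → ℝ) (x : Euc N) {h : ℝ} (hh : 0 < h) :
    ∫ y in Metric.ball x h, g y = h ^ N * ∫ z in Metric.ball (0 : Euc N) 1, g (x + h • z) := by
  have h1 := Measure.setIntegral_comp_smul_of_pos volume (fun z => g (x + z))
    (Metric.ball (0 : Euc N) 1) hh
  rw [finrank_euclideanSpace_fin, smul_unitBall_of_pos hh, smul_eq_mul] at h1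
  rw [h1, ← mul_assoc, mul_inv_cancel₀ (by positivity), one_mul]
  rw [← integral_indicator measurableSet_ball, ← integral_indicator measurableSet_ball,
    ← integral_add_left_eq_self _ x]
  refine integral_congr_ae (Eventually.of_forall fun z => ?_)
  simp [indicator, Metric.mem_ball, dist_eq_norm]

/-- The Taylor remainder data of order two for a function on an open set. -/
structure SecondOrder {N : ℕ} (Ω : Set (Euc N)) (M : ℝ) (g : Euc N → ℝ)
    (D : Euc N → Euc N →L[ℝ] Euc N →L[ℝ] ℝ) : Prop where
  cont : ContinuousOn D Ω
  bound : ∀ x ∈ Ω, ‖D x‖ ≤ M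
  diff : ∀ (x z : Euc N) (k : ℝ), 0 < k → (∀ t ∈ Icc (-k) k, x + t • z ∈ Ω) →
    ∃ ζ ∈ Ioo (-k) k, g (x + k • z) + g (x + (-k) • z) - 2 * g x = k ^ 2 * D (x + ζ • z) z z

lemma bilin_abs_le {N : ℕ} {D : Euc N →L[ℝ] Euc N →L[ℝ] ℝ} {M : ℝ} (hD : ‖D‖ ≤ M) {z : Euc N}
    (hz : ‖z‖ ≤ 1) : |D z z| ≤ M := by
  have h0 : 0 ≤ M := (norm_nonneg D).trans hD
  calc |D z z| = ‖D z z‖ := rfl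
    _ ≤ ‖D‖ * ‖z‖ * ‖z‖ := D.le_opNorm₂ z z
    _ ≤ M * 1 * 1 := by gcongr
    _ = M := by ring

lemma mem_ball_of_mem_seg {N : ℕ} {x z : Euc N} {r h : ℝ} (hh0 : 0 < h)
    (hh : h ≤ r) (hz : z ∈ Metric.ball (0 : Euc N) 1) {t : ℝ} (ht : t ∈ Icc (-h) h) :
    x + t • z ∈ Metric.ball x r := by
  rw [mem_ball_zero_iff] at hz
  rw [Metric.mem_ball, dist_eq_norm, add_sub_cancel_left, norm_smul, Real.norm_eq_abs]
  have h1 : |t| ≤ h := abs_le.2 ht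
  nlinarith [norm_nonneg z, abs_nonneg t]

section BallAverage

variable {N : ℕ} {Ω : Set (Euc N)} {M Mg r : ℝ} {g : Euc N → ℝ}
  {D : Euc N → Euc N →L[ℝ] Euc N →L[ℝ] ℝ}

/-- Rescaled difference between the ball average and the value at the centre. -/
def ballDiff {N : ℕ} (g : Euc N → ℝ) (h : ℝ) (x : Euc N) : ℝ :=
  (h ^ (N + 2))⁻¹ * ((∫ y in Metric.ball x h, g y) -
    volume.real (Metric.ball (0 : Euc N) h) * g x)

lemma ballDiff_eq (hgc : ContinuousOn g Ω) (hgb : ∀ x ∈ Ω, |g x| ≤ Mg) {x : Euc N} {h : ℝ}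
    (hh0 : 0 < h) (hh : h ≤ r) (hr : Metric.ball x r ⊆ Ω) :
    IntegrableOn (fun z : Euc N => (g (x + h • z) + g (x + (-h) • z) - 2 * g x) / h ^ 2)
      (Metric.ball 0 1) ∧
    ballDiff g h x =
      2⁻¹ * ∫ z in Metric.ball (0 : Euc N) 1,
        (g (x + h • z) + g (x + (-h) • z) - 2 * g x) / h ^ 2 := by
  have hmem : ∀ z ∈ Metric.ball (0 : Euc N) 1, ∀ t ∈ Icc (-h) h, x + t • z ∈ Ω :=
    fun z hz t ht => hr (mem_ball_of_mem_seg hh0 hh hz ht)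
  have hi : ∀ t ∈ Icc (-h) h,
      IntegrableOn (fun z : Euc N => g (x + t • z)) (Metric.ball 0 1) := by
    intro t ht
    refine IntegrableOn.of_bound measure_ball_lt_top ?_ Mg
      ((ae_restrict_mem measurableSet_ball).mono fun z hz => hgb _ (hmem z hz t ht))
    refine ContinuousOn.aestronglyMeasurable ?_ measurableSet_ball
    exact hgc.comp (by fun_prop) fun z hz => hmem z hz t ht
  have i1 := hi h ⟨by linarith, le_rfl⟩
  have i2 := hi (-h) ⟨le_rfl, by linarith⟩
  have i3 : IntegrableOn (fun _ : Euc N => 2 * g x) (Metric.ball 0 1) :=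
    integrableOn_const measure_ball_lt_top.ne
  have hvol : volume.real (Metric.ball (0 : Euc N) h) =
      h ^ N * volume.real (Metric.ball (0 : Euc N) 1) := by
    have := setIntegral_ball_eq (fun _ : Euc N => (1 : ℝ)) 0 hh0
    simpa using this
  have hneg := setIntegral_ball_comp_isometry (LinearIsometryEquiv.neg ℝ (E := Euc N))
    (fun z => g (x + h • z)) 1
  simp only [LinearIsometryEquiv.coe_neg, smul_neg, ← neg_smul] at hneg
  refine ⟨((i1.add i2).sub i3).div_const _, ?_⟩
  have e1 := integral_sub (i1.add i2) i3
  have e2 := integral_add i1 i2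
  simp only [Pi.add_apply] at e1
  rw [integral_div, e1, e2, hneg, setIntegral_const, smul_eq_mul, ballDiff,
    setIntegral_ball_eq g x hh0, hvol]
  field_simp
  ring

lemma SecondOrder.diff_abs_le (hD : SecondOrder Ω M g D) {x : Euc N} {h : ℝ}
    (hh0 : 0 < h) (hh : h ≤ r) (hr : Metric.ball x r ⊆ Ω) {z : Euc N}
    (hz : z ∈ Metric.ball (0 : Euc N) 1) :
    |(g (x + h • z) + g (x + (-h) • z) - 2 * g x) / h ^ 2| ≤ M := by
  obtain ⟨ζ, hζ, e⟩ := hD.diff x z h hh0 fun t ht => hr (mem_ball_of_mem_seg hh0 hh hz ht)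
  rw [e, mul_div_cancel_left₀ _ (by positivity)]
  exact bilin_abs_le (hD.bound _ (hr (mem_ball_of_mem_seg hh0 hh hz (Ioo_subset_Icc_self hζ))))
    (mem_ball_zero_iff.1 hz).le

lemma SecondOrder.ballDiff_abs_le (hD : SecondOrder Ω M g D) (hgc : ContinuousOn g Ω)
    (hgb : ∀ x ∈ Ω, |g x| ≤ Mg) {x : Euc N} {h : ℝ}
    (hh0 : 0 < h) (hh : h ≤ r) (hr : Metric.ball x r ⊆ Ω) :
    |ballDiff g h x| ≤ 2⁻¹ * (M * volume.real (Metric.ball (0 : Euc N) 1)) := by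
  rw [(ballDiff_eq hgc hgb hh0 hh hr).2, abs_mul, abs_of_pos (by norm_num : (0 : ℝ) < 2⁻¹)]
  gcongr
  rw [← Real.norm_eq_abs]
  exact norm_setIntegral_le_of_norm_le_const measure_ball_lt_top
    fun z hz => (Real.norm_eq_abs _).le.trans (hD.diff_abs_le hh0 hh hr hz)

lemma SecondOrder.tendsto_diff (hD : SecondOrder Ω M g D) (hΩ : IsOpen Ω) (hr0 : 0 < r)
    {x : Euc N} (hr : Metric.ball x r ⊆ Ω) {z : Euc N} (hz : z ∈ Metric.ball (0 : Euc N) 1) :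
    Tendsto (fun h : ℝ => (g (x + h • z) + g (x + (-h) • z) - 2 * g x) / h ^ 2)
      (nhdsWithin 0 (Ioi 0)) (nhds (D x z z)) := by
  have hx : x ∈ Ω := hr (Metric.mem_ball_self hr0)
  have hc : ContinuousAt (fun t : ℝ => D (x + t • z) z z) 0 := by
    have h1 : ContinuousAt D (x + (0 : ℝ) • z) := by
      rw [zero_smul, add_zero]; exact hD.cont.continuousAt (hΩ.mem_nhds hx)
    have h2 : ContinuousAt (fun t : ℝ => D (x + t • z)) 0 :=
      ContinuousAt.comp (f := fun t : ℝ => x + t • z) (g := D) h1 (by fun_prop)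
    exact (h2.clm_apply continuousAt_const).clm_apply continuousAt_const
  rw [Metric.tendsto_nhdsWithin_nhds]
  intro ε hε
  obtain ⟨δ, hδ, hd⟩ := Metric.continuousAt_iff.1 hc ε hε
  refine ⟨min δ r, lt_min hδ hr0, fun {h} hh0 hh => ?_⟩
  have hh0 : 0 < h := hh0
  rw [Real.dist_eq, sub_zero, abs_of_pos hh0, lt_min_iff] at hh
  obtain ⟨ζ, hζ, e⟩ := hD.diff x z h hh0 fun t ht => hr (mem_ball_of_mem_seg hh0 hh.2.le hz ht)
  rw [e, mul_div_cancel_left₀ _ (by positivity)]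
  have := hd (x := ζ) (by
    rw [Real.dist_eq, sub_zero]; exact (abs_lt.2 hζ).trans hh.1)
  simpa using this

lemma SecondOrder.tendsto_ballDiff (hD : SecondOrder Ω M g D) (hΩ : IsOpen Ω)
    (hgc : ContinuousOn g Ω) (hgb : ∀ x ∈ Ω, |g x| ≤ Mg) (hr0 : 0 < r)
    {x : Euc N} (hr : Metric.ball x r ⊆ Ω) (i₀ : Fin N) :
    Tendsto (fun h : ℝ => ballDiff g h x) (nhdsWithin 0 (Ioi 0))
      (nhds (2⁻¹ * (momentB N i₀ *
        ∑ i, D x (EuclideanSpace.single i 1) (EuclideanSpace.single i 1)))) := by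
  have hev : ∀ᶠ h : ℝ in nhdsWithin 0 (Ioi 0), 0 < h ∧ h ≤ r := by
    filter_upwards [Ioc_mem_nhdsGT hr0] with h hh using hh
  have key : Tendsto (fun h : ℝ => 2⁻¹ * ∫ z in Metric.ball (0 : Euc N) 1,
        (g (x + h • z) + g (x + (-h) • z) - 2 * g x) / h ^ 2) (nhdsWithin 0 (Ioi 0))
      (nhds (2⁻¹ * ∫ z in Metric.ball (0 : Euc N) 1, D x z z)) := by
    refine Tendsto.const_mul _ ?_
    refine tendsto_integral_filter_of_dominated_convergence (fun _ => M) ?_ ?_ ?_ ?_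
    · filter_upwards [hev] with h hh
      exact (ballDiff_eq hgc hgb hh.1 hh.2 hr).1.aestronglyMeasurable
    · filter_upwards [hev] with h hh
      filter_upwards [ae_restrict_mem measurableSet_ball] with z hz
      exact hD.diff_abs_le hh.1 hh.2 hr hz
    · exact integrableOn_const measure_ball_lt_top.ne
    · filter_upwards [ae_restrict_mem measurableSet_ball] with z hz
      exact hD.tendsto_diff hΩ hr0 hr hz
  rw [integral_ball_bilin _ i₀] at key
  refine key.congr' ?_
  filter_upwards [hev] with h hh
  exact (ballDiff_eq hgc hgb hh.1 hh.2 hr).2.symm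

/-- Weighted ball averages converge to the weighted integral of the Laplacian. -/
lemma SecondOrder.tendsto_integral_ballDiff (hD : SecondOrder Ω M g D) (hΩ : IsOpen Ω)
    (hΩf : volume Ω ≠ ⊤)
    (hgc : ContinuousOn g Ω) (hgb : ∀ x ∈ Ω, |g x| ≤ Mg) (hr0 : 0 < r) {A : Set (Euc N)}
    (mA : MeasurableSet A) (hr : ∀ x ∈ A, Metric.ball x r ⊆ Ω) {s : Euc N → ℝ}
    (hs : AEStronglyMeasurable s (volume.restrict A)) (hs1 : ∀ x, |s x| ≤ 1) (i₀ : Fin N) :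
    (∀ h, 0 < h → h ≤ r → IntegrableOn (fun x => s x * ballDiff g h x) A) ∧
    Tendsto (fun h : ℝ => ∫ x in A, s x * ballDiff g h x) (nhdsWithin 0 (Ioi 0))
      (nhds (∫ x in A, s x * (2⁻¹ * (momentB N i₀ *
        ∑ i, D x (EuclideanSpace.single i 1) (EuclideanSpace.single i 1))))) := by
  have hAΩ : A ⊆ Ω := fun x hx => hr x hx (Metric.mem_ball_self hr0)
  have hAf : volume A ≠ ⊤ := ((measure_mono hAΩ).trans_lt hΩf.lt_top).ne
  have gi : IntegrableOn g Ω := IntegrableOn.of_bound hΩf.lt_top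
    (hgc.aestronglyMeasurable hΩ.measurableSet) Mg
    ((ae_restrict_mem hΩ.measurableSet).mono fun x hx => hgb x hx)
  have hev : ∀ᶠ h : ℝ in nhdsWithin 0 (Ioi 0), 0 < h ∧ h ≤ r := by
    filter_upwards [Ioc_mem_nhdsGT hr0] with h hh using hh
  have hi : ∀ h, 0 < h → h ≤ r → IntegrableOn (fun x => ballDiff g h x) A := fun h _ hh => by
    have := integrableOn_ball_integral mA hAf
      (fun x hx => (Metric.ball_subset_ball hh).trans (hr x hx)) gi
    exact (this.sub ((gi.mono_set hAΩ).const_mul _)).const_mul _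
  have hbd : ∀ h, 0 < h → h ≤ r → ∀ᵐ x ∂(volume.restrict A),
      ‖s x * ballDiff g h x‖ ≤ 2⁻¹ * (M * volume.real (Metric.ball (0 : Euc N) 1)) := by
    intro h h0 hh
    filter_upwards [ae_restrict_mem mA] with x hx
    rw [norm_mul, Real.norm_eq_abs, Real.norm_eq_abs]
    have := hD.ballDiff_abs_le hgc hgb h0 hh (hr x hx)
    nlinarith [hs1 x, abs_nonneg (s x), abs_nonneg (ballDiff g h x)]
  refine ⟨fun h h0 hh => IntegrableOn.of_bound hAf.lt_top
    (hs.mul (hi h h0 hh).aestronglyMeasurable) _ (hbd h h0 hh), ?_⟩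
  refine tendsto_integral_filter_of_dominated_convergence _ ?_ ?_
    (integrableOn_const hAf (C := 2⁻¹ * (M * volume.real (Metric.ball (0 : Euc N) 1)))) ?_
  · filter_upwards [hev] with h hh
    exact hs.mul (hi h hh.1 hh.2).aestronglyMeasurable
  · filter_upwards [hev] with h hh using hbd h hh.1 hh.2
  · filter_upwards [ae_restrict_mem mA] with x hx
    exact (hD.tendsto_ballDiff hΩ hgc hgb hr0 (hr x hx) i₀).const_mul _

end BallAverage

section Line

variable {V : Type*} [NormedAddCommGroup V] [NormedSpace ℝ V] {F : V → ℝ} {O : Set V}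

lemma hasDerivAt_line (hO : IsOpen O) (hF : ContDiffOn ℝ 2 F O) {q e : V} {t : ℝ}
    (ht : q + t • e ∈ O) :
    HasDerivAt (fun t : ℝ => F (q + t • e)) (fderiv ℝ F (q + t • e) e) t := by
  have hl : HasDerivAt (fun t : ℝ => q + t • e) e t := by
    simpa using ((hasDerivAt_id t).smul_const e).const_add q
  have := ((hF.differentiableOn (by norm_num)).differentiableAt (hO.mem_nhds ht)).hasFDerivAt
  exact this.comp_hasDerivAt t hl

lemma hasDerivAt_deriv_line (hO : IsOpen O) (hF : ContDiffOn ℝ 2 F O) {q e : V} {t : ℝ}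
    (ht : q + t • e ∈ O) :
    HasDerivAt (deriv fun t : ℝ => F (q + t • e))
      (fderiv ℝ (fderiv ℝ F) (q + t • e) e e) t := by
  have hl : HasDerivAt (fun t : ℝ => q + t • e) e t := by
    simpa using ((hasDerivAt_id t).smul_const e).const_add q
  have hF1 : ContDiffOn ℝ 1 (fderiv ℝ F) O := hF.fderiv_of_isOpen hO (by norm_num)
  have := ((hF1.differentiableOn (by norm_num)).differentiableAt (hO.mem_nhds ht)).hasFDerivAt
  have h2 := this.comp_hasDerivAt t hl
  have h3 : HasDerivAt (fun t : ℝ => fderiv ℝ F (q + t • e) e)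
      (fderiv ℝ (fderiv ℝ F) (q + t • e) e e) t :=
    h2.clm_apply (hasDerivAt_const t e) |>.congr_deriv (by simp)
  have h4 : ∀ᶠ τ in nhds t, q + τ • e ∈ O :=
    hl.continuousAt.eventually (hO.mem_nhds ht)
  exact h3.congr_of_eventuallyEq (h4.mono fun τ hτ => (hasDerivAt_line hO hF hτ).deriv)

end Line

section ExtSol

variable {N : ℕ} {α : ℝ} {Ω : Set (Euc N)} {f : Euc N → ℝ} {w : Euc N → ℝ → ℝ}

/-- The second derivative in the horizontal directions. -/
def sliceHess (w : Euc N → ℝ → ℝ) (y : ℝ) (x : Euc N) : Euc N →L[ℝ] Euc N →L[ℝ] ℝ :=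
  (ContinuousLinearMap.precomp ℝ (ContinuousLinearMap.inl ℝ (Euc N) ℝ)).comp
    ((fderiv ℝ (fderiv ℝ fun q : Euc N × ℝ => w q.1 q.2) (x, y)).comp
      (ContinuousLinearMap.inl ℝ (Euc N) ℝ))

lemma sliceHess_apply (y : ℝ) (x z z' : Euc N) :
    sliceHess w y x z z' =
      fderiv ℝ (fderiv ℝ fun q : Euc N × ℝ => w q.1 q.2) (x, y) (z, 0) (z', 0) := rfl

lemma IsExtSol.continuousOn_hess (hw : IsExtSol α Ω f w) (hΩ : IsOpen Ω) :
    ContinuousOn (fderiv ℝ (fderiv ℝ fun q : Euc N × ℝ => w q.1 q.2)) (Ω ×ˢ Ioi (0 : ℝ)) :=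
  ((hw.smooth.fderiv_of_isOpen (m := 1) (hΩ.prod isOpen_Ioi) (by norm_num)).fderiv_of_isOpen
    (m := 0) (hΩ.prod isOpen_Ioi) (by norm_num)).continuousOn

lemma IsExtSol.secondOrder (hw : IsExtSol α Ω f w) (hΩ : IsOpen Ω) {M : ℝ}
    (hM : ∀ p ∈ Ω ×ˢ Ioi (0 : ℝ),
      ‖fderiv ℝ (fderiv ℝ fun q : Euc N × ℝ => w q.1 q.2) p‖ ≤ M) {y : ℝ} (hy : 0 < y) :
    SecondOrder Ω M (fun x => w x y) (sliceHess w y) where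
  cont := by
    refine ContinuousOn.clm_comp continuousOn_const (ContinuousOn.clm_comp ?_ continuousOn_const)
    exact (hw.continuousOn_hess hΩ).comp (by fun_prop) fun x hx => ⟨hx, hy⟩
  bound x hx := by
    have h1 := hM (x, y) ⟨hx, hy⟩
    have hM0 : 0 ≤ M := le_trans (ContinuousLinearMap.opNorm_nonneg _) h1
    refine ContinuousLinearMap.opNorm_le_bound₂ _ hM0 fun z z' => ?_
    rw [sliceHess_apply]
    refine (ContinuousLinearMap.le_opNorm₂ _ _ _).trans ?_
    have e : ∀ z : Euc N, ‖((z, 0) : Euc N × ℝ)‖ = ‖z‖ := fun z => by simp [Prod.norm_def]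
    rw [e, e]
    gcongr
  diff x z k hk hseg := by
    obtain ⟨ζ, hζ, e⟩ := exists_second_diff_line (hΩ.prod isOpen_Ioi) hw.smooth
      (x := ((x, y) : Euc N × ℝ)) (e := (z, 0)) hk
      (fun t ht => ⟨by simpa using hseg t ht, by simpa using hy⟩)
    refine ⟨ζ, hζ, ?_⟩
    rw [sliceHess_apply]
    simpa using e

lemma IsExtSol.lapx_eq (hw : IsExtSol α Ω f w) (hΩ : IsOpen Ω) {x : Euc N} (hx : x ∈ Ω)
    {y : ℝ} (hy : 0 < y) :
    lapx w x y = ∑ i, sliceHess w y x (EuclideanSpace.single i 1) (EuclideanSpace.single i 1) := by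
  refine Finset.sum_congr rfl fun i _ => ?_
  have := hasDerivAt_deriv_line (hΩ.prod isOpen_Ioi) hw.smooth (q := ((x, y) : Euc N × ℝ))
    (e := (EuclideanSpace.single i 1, 0)) (t := 0) ⟨by simpa using hx, by simpa using hy⟩
  rw [sliceHess_apply]
  simpa using this.deriv

lemma IsExtSol.exists_deriv_bound (hw : IsExtSol α Ω f w) (hΩ : IsOpen Ω) :
    ∃ M : ℝ, (∀ y, 0 < y → SecondOrder Ω M (fun x => w x y) (sliceHess w y)) ∧
      (∀ x ∈ Ω, ∀ y, 0 < y → HasDerivAt (w x) (deriv (w x) y) y ∧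
        HasDerivAt (deriv (w x)) (deriv (deriv (w x)) y) y ∧
        ContinuousAt (deriv (deriv (w x))) y ∧
        |deriv (w x) y| ≤ M ∧ |deriv (deriv (w x)) y| ≤ M) := by
  obtain ⟨M, hM⟩ := hw.derivBdd
  have hO := hΩ.prod (isOpen_Ioi (a := (0 : ℝ)))
  refine ⟨M, fun y hy => hw.secondOrder hΩ (fun p hp => (hM p hp).2) hy, fun x hx y hy => ?_⟩
  have hmem : ∀ t : ℝ, 0 < t → ((x, 0) : Euc N × ℝ) + t • ((0, 1) : Euc N × ℝ) ∈
      Ω ×ˢ Ioi (0 : ℝ) := fun t ht => ⟨by simpa using hx, by simpa using ht⟩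
  have hq : ∀ t : ℝ, ((x, 0) : Euc N × ℝ) + t • ((0, 1) : Euc N × ℝ) = (x, t) := fun t => by
    simp
  have a := hasDerivAt_line hO hw.smooth (hmem y hy)
  have b : ∀ t : ℝ, 0 < t → _ := fun t ht => hasDerivAt_deriv_line hO hw.smooth (hmem t ht)
  simp only [hq] at a b
  have hn : ‖((0, 1) : Euc N × ℝ)‖ = 1 := by simp [Prod.norm_def]
  have hxy := hM (x, y) ⟨hx, hy⟩
  refine ⟨a.differentiableAt.hasDerivAt, (b y hy).differentiableAt.hasDerivAt, ?_, ?_, ?_⟩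
  · have h1 : ContinuousAt (fun t : ℝ => fderiv ℝ (fderiv ℝ fun q : Euc N × ℝ => w q.1 q.2)
        (x, t) (0, 1) (0, 1)) y := by
      have h2 : ContinuousAt (fun t : ℝ =>
          fderiv ℝ (fderiv ℝ fun q : Euc N × ℝ => w q.1 q.2) (x, t)) y :=
        ContinuousAt.comp (f := fun t : ℝ => ((x, t) : Euc N × ℝ))
          ((hw.continuousOn_hess hΩ).continuousAt (hO.mem_nhds ⟨hx, hy⟩)) (by fun_prop)
      exact (h2.clm_apply continuousAt_const).clm_apply continuousAt_const
    refine h1.congr ?_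
    filter_upwards [lt_mem_nhds hy] with t ht
    exact (b t ht).deriv.symm
  · rw [a.deriv, ← Real.norm_eq_abs]
    refine (ContinuousLinearMap.le_opNorm _ _).trans ?_
    rw [hn, mul_one]; exact hxy.1
  · rw [(b y hy).deriv, ← Real.norm_eq_abs]
    refine (ContinuousLinearMap.le_opNorm₂ _ _ _).trans ?_
    rw [hn, mul_one, mul_one]; exact hxy.2

lemma mem_closure_cylinder {x : Euc N} (hx : x ∈ closure Ω) {y : ℝ} (hy : 0 ≤ y) :
    ((x, y) : Euc N × ℝ) ∈ closure (Ω ×ˢ Ioi (0 : ℝ)) := by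
  rw [closure_prod_eq, closure_Ioi]
  exact ⟨hx, hy⟩

lemma IsExtSol.continuousOn_slice (hw : IsExtSol α Ω f w) {y : ℝ} (hy : 0 ≤ y) :
    ContinuousOn (fun x => w x y) (closure Ω) :=
  hw.cont.comp (f := fun x : Euc N => ((x, y) : Euc N × ℝ)) (by fun_prop)
    fun _ hx => mem_closure_cylinder hx hy

lemma IsExtSol.continuousOn_fibre (hw : IsExtSol α Ω f w) {x : Euc N} (hx : x ∈ closure Ω) :
    ContinuousOn (w x) (Ici 0) :=
  hw.cont.comp (f := fun y : ℝ => ((x, y) : Euc N × ℝ)) (by fun_prop)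
    fun _ hy => mem_closure_cylinder hx hy

end ExtSol

section OneVariable

variable {γ : ℝ → ℝ} {M y₀ : ℝ}

lemma exists_quotient_eq
    (h1 : ∀ y, 0 < y → HasDerivAt γ (deriv γ y) y)
    (h2 : ∀ y, 0 < y → HasDerivAt (deriv γ) (deriv (deriv γ) y) y) {k : ℝ} (hk : 0 < k)
    (hky : k < y₀) (c : ℝ) :
    ∃ ζ ∈ Ioo (y₀ - k) (y₀ + k), ∃ ζ' ∈ Ioo (y₀ - k) (y₀ + k),
      (γ (y₀ + k) + γ (y₀ - k) - 2 * γ y₀) / k ^ 2 + c * ((γ (y₀ + k) - γ (y₀ - k)) / (2 * k)) =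
        deriv (deriv γ) ζ + c * deriv γ ζ' := by
  obtain ⟨ζ, hζ, e⟩ := exists_second_diff_eq (γ := fun t => γ (y₀ + t))
    (γ' := fun t => deriv γ (y₀ + t)) (γ'' := fun t => deriv (deriv γ) (y₀ + t)) hk
    (fun t ht => (h1 _ (by linarith [ht.1])).comp_const_add y₀ t)
    (fun t ht => (h2 _ (by linarith [ht.1])).comp_const_add y₀ t)
  obtain ⟨ζ', hζ', e'⟩ := exists_hasDerivAt_eq_slope γ (deriv γ)
    (show y₀ - k < y₀ + k by linarith)
    (fun t ht => (h1 t (by linarith [ht.1])).continuousAt.continuousWithinAt)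
    (fun t ht => h1 t (by linarith [ht.1]))
  refine ⟨y₀ + ζ, ⟨by linarith [hζ.1], by linarith [hζ.2]⟩, ζ', hζ', ?_⟩
  rw [e']
  simp only [add_zero, ← sub_eq_add_neg] at e
  rw [e, mul_div_cancel_left₀ _ (by positivity)]
  congr 3
  ring

lemma tendsto_quotient
    (h1 : ∀ y, 0 < y → HasDerivAt γ (deriv γ y) y)
    (h2 : ∀ y, 0 < y → HasDerivAt (deriv γ) (deriv (deriv γ) y) y)
    (hc : ContinuousAt (deriv (deriv γ)) y₀) (hy : 0 < y₀) (c : ℝ) :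
    Tendsto (fun k : ℝ => (γ (y₀ + k) + γ (y₀ - k) - 2 * γ y₀) / k ^ 2 +
      c * ((γ (y₀ + k) - γ (y₀ - k)) / (2 * k))) (nhdsWithin 0 (Ioi 0))
      (nhds (deriv (deriv γ) y₀ + c * deriv γ y₀)) := by
  have hev : ∀ᶠ k : ℝ in nhdsWithin 0 (Ioi 0), 0 < k ∧ k < y₀ := by
    filter_upwards [Ioo_mem_nhdsGT hy] with h hh using hh
  have hex : ∀ k : ℝ, ∃ p : ℝ × ℝ, 0 < k ∧ k < y₀ → p.1 ∈ Ioo (y₀ - k) (y₀ + k) ∧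
      p.2 ∈ Ioo (y₀ - k) (y₀ + k) ∧
      (γ (y₀ + k) + γ (y₀ - k) - 2 * γ y₀) / k ^ 2 + c * ((γ (y₀ + k) - γ (y₀ - k)) / (2 * k)) =
        deriv (deriv γ) p.1 + c * deriv γ p.2 := by
    intro k
    by_cases h : 0 < k ∧ k < y₀
    · obtain ⟨ζ, hζ, ζ', hζ', e⟩ := exists_quotient_eq h1 h2 h.1 h.2 c
      exact ⟨(ζ, ζ'), fun _ => ⟨hζ, hζ', e⟩⟩
    · exact ⟨0, fun h' => absurd h' h⟩
  choose p hp using hex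
  have l1 : Tendsto (fun k : ℝ => y₀ - k) (nhdsWithin 0 (Ioi 0)) (nhds y₀) := by
    have : Tendsto (fun k : ℝ => y₀ - k) (nhds 0) (nhds (y₀ - 0)) :=
      tendsto_const_nhds.sub tendsto_id
    rw [sub_zero] at this
    exact this.mono_left nhdsWithin_le_nhds
  have l2 : Tendsto (fun k : ℝ => y₀ + k) (nhdsWithin 0 (Ioi 0)) (nhds y₀) := by
    have : Tendsto (fun k : ℝ => y₀ + k) (nhds 0) (nhds (y₀ + 0)) :=
      tendsto_const_nhds.add tendsto_id
    rw [add_zero] at this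
    exact this.mono_left nhdsWithin_le_nhds
  have t1 : Tendsto (fun k => (p k).1) (nhdsWithin 0 (Ioi 0)) (nhds y₀) :=
    tendsto_of_tendsto_of_tendsto_of_le_of_le' l1 l2
      (hev.mono fun k hk => (hp k hk).1.1.le) (hev.mono fun k hk => (hp k hk).1.2.le)
  have t2 : Tendsto (fun k => (p k).2) (nhdsWithin 0 (Ioi 0)) (nhds y₀) :=
    tendsto_of_tendsto_of_tendsto_of_le_of_le' l1 l2
      (hev.mono fun k hk => (hp k hk).2.1.1.le) (hev.mono fun k hk => (hp k hk).2.1.2.le)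
  have := (hc.tendsto.comp t1).add (((h2 y₀ hy).continuousAt.tendsto.comp t2).const_mul c)
  refine this.congr' ?_
  filter_upwards [hev] with k hk
  exact (hp k hk).2.2.symm

lemma exists_rpow_quotient_eq {α : ℝ} (hα : 0 < α)
    (hc : ContinuousOn γ (Ici 0)) (h1 : ∀ y, 0 < y → HasDerivAt γ (deriv γ y) y) {k : ℝ}
    (hk : 0 < k) :
    ∃ ζ ∈ Ioo 0 k, (γ k - γ 0) / k ^ α = α⁻¹ * (ζ ^ (1 - α) * deriv γ ζ) := by
  obtain ⟨ζ, hζ, e⟩ := exists_ratio_hasDerivAt_eq_ratio_slope γ (deriv γ) hk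
    (hc.mono Icc_subset_Ici_self) (fun y hy => h1 y hy.1) (fun y => y ^ α)
    (fun y => α * y ^ (α - 1)) (Real.continuous_rpow_const hα.le).continuousOn
    (fun y hy => Real.hasDerivAt_rpow_const (Or.inl hy.1.ne'))
  refine ⟨ζ, hζ, ?_⟩
  have hz := Real.rpow_pos_of_pos hζ.1 (1 - α)
  have hz' : ζ ^ (1 - α) * ζ ^ (α - 1) = 1 := by
    rw [← Real.rpow_add hζ.1]; simp
  have hk' := Real.rpow_pos_of_pos hk α
  rw [Real.zero_rpow hα.ne', sub_zero] at e
  rw [div_eq_iff hk'.ne']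
  have : ζ ^ (1 - α) * (k ^ α * deriv γ ζ) = (γ k - γ 0) * α := by
    rw [e]; linear_combination ((γ k - γ 0) * α) * hz'
  field_simp
  linarith

lemma rpow_mul_deriv_abs_le {α L : ℝ} (hα : α ∈ Ioo (0 : ℝ) 2)
    (h1 : ∀ y, 0 < y → |deriv γ y| ≤ M)
    (h2 : ∀ y, 0 < y → HasDerivAt (deriv γ) (deriv (deriv γ) y) y ∧ |deriv (deriv γ) y| ≤ M)
    (hL : Tendsto (fun y : ℝ => y ^ (1 - α) * deriv γ y) (nhdsWithin 0 (Ioi 0)) (nhds L))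
    {y : ℝ} (hy : 0 < y) (hy1 : y ≤ 1) : |y ^ (1 - α) * deriv γ y| ≤ M := by
  have hM : 0 ≤ M := (abs_nonneg _).trans (h1 y hy)
  have hp := Real.rpow_pos_of_pos hy (1 - α)
  rw [abs_mul, abs_of_pos hp]
  rcases le_or_gt α 1 with h | h
  · have : y ^ (1 - α) ≤ 1 := Real.rpow_le_one hy.le hy1 (by linarith)
    nlinarith [h1 y hy, abs_nonneg (deriv γ y)]
  · have hd0 : Tendsto (deriv γ) (nhdsWithin 0 (Ioi 0)) (nhds 0) := by
      have t : Tendsto (fun y : ℝ => y ^ (α - 1)) (nhdsWithin 0 (Ioi 0)) (nhds 0) := by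
        have := (Real.continuousAt_rpow_const 0 (α - 1) (Or.inr (by linarith))).tendsto
        rw [Real.zero_rpow (by linarith)] at this
        exact this.mono_left nhdsWithin_le_nhds
      have := t.mul hL
      rw [zero_mul] at this
      refine this.congr' ?_
      filter_upwards [self_mem_nhdsWithin] with z hz
      have hz : 0 < z := hz
      rw [← mul_assoc, ← Real.rpow_add hz]
      simp
    have hb : |deriv γ y| ≤ M * y := by
      have t2 : Tendsto (fun z => |deriv γ y - deriv γ z|) (nhdsWithin 0 (Ioi 0))
          (nhds |deriv γ y - 0|) := (tendsto_const_nhds.sub hd0).abs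
      rw [sub_zero] at t2
      refine le_of_tendsto t2 ?_
      filter_upwards [Ioo_mem_nhdsGT hy] with z hz
      have := Convex.norm_image_sub_le_of_norm_hasDerivWithin_le (f := deriv γ)
        (f' := deriv (deriv γ)) (C := M) (s := Ioi 0) (x := z) (y := y)
        (fun t ht => (h2 t ht).1.hasDerivWithinAt) (fun t ht => (h2 t ht).2) (convex_Ioi 0)
        hz.1 hy
      rw [Real.norm_eq_abs, Real.norm_eq_abs, abs_of_pos (by linarith [hz.2] : 0 < y - z)] at this
      nlinarith [hz.1]
    have h3 : y ^ (1 - α) * y ≤ 1 := by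
      have e : y ^ (1 - α) * y = y ^ (2 - α) := by
        nth_rewrite 2 [← Real.rpow_one y]
        rw [← Real.rpow_add hy]; congr 1; ring
      rw [e]
      exact Real.rpow_le_one hy.le hy1 (by linarith [hα.2])
    nlinarith

lemma tendsto_rpow_quotient {α L : ℝ} (hα : 0 < α)
    (hc : ContinuousOn γ (Ici 0)) (h1 : ∀ y, 0 < y → HasDerivAt γ (deriv γ y) y)
    (hL : Tendsto (fun y : ℝ => y ^ (1 - α) * deriv γ y) (nhdsWithin 0 (Ioi 0)) (nhds L)) :
    Tendsto (fun k : ℝ => (γ k - γ 0) / k ^ α) (nhdsWithin 0 (Ioi 0)) (nhds (α⁻¹ * L)) := by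
  have hex : ∀ k : ℝ, ∃ ζ : ℝ, 0 < k → ζ ∈ Ioo 0 k ∧
      (γ k - γ 0) / k ^ α = α⁻¹ * (ζ ^ (1 - α) * deriv γ ζ) := by
    intro k
    by_cases h : 0 < k
    · obtain ⟨ζ, hζ, e⟩ := exists_rpow_quotient_eq hα hc h1 h
      exact ⟨ζ, fun _ => ⟨hζ, e⟩⟩
    · exact ⟨0, fun h' => absurd h' h⟩
  choose p hp using hex
  have hev : ∀ᶠ k : ℝ in nhdsWithin 0 (Ioi 0), 0 < k := self_mem_nhdsWithin
  have t : Tendsto p (nhdsWithin 0 (Ioi 0)) (nhdsWithin 0 (Ioi 0)) := by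
    refine tendsto_nhdsWithin_iff.2 ⟨?_, hev.mono fun k hk => (hp k hk).1.1⟩
    exact tendsto_of_tendsto_of_tendsto_of_le_of_le' tendsto_const_nhds
      (tendsto_id.mono_left nhdsWithin_le_nhds)
      (hev.mono fun k hk => (hp k hk).1.1.le) (hev.mono fun k hk => (hp k hk).1.2.le)
  refine ((hL.comp t).const_mul α⁻¹).congr' ?_
  filter_upwards [hev] with k hk
  exact (hp k hk).2.symm

end OneVariable

section ExtSolIntegral

variable {N : ℕ} {α : ℝ} {Ω : Set (Euc N)} {f : Euc N → ℝ} {w : Euc N → ℝ → ℝ}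
  {A : Set (Euc N)} {s : Euc N → ℝ}

lemma IsExtSol.integrableOn_mul (hw : IsExtSol α Ω f w) (hΩ : IsOpen Ω) (hΩf : volume Ω ≠ ⊤)
    (mA : MeasurableSet A) (hA : A ⊆ Ω) (hs : AEStronglyMeasurable s (volume.restrict A))
    (hs1 : ∀ x, |s x| ≤ 1) {y : ℝ} (hy : 0 ≤ y) :
    IntegrableOn (fun x => s x * w x y) A := by
  obtain ⟨M, hM⟩ := hw.bdd
  refine IntegrableOn.of_bound ((measure_mono hA).trans_lt hΩf.lt_top)
    (hs.mul (((hw.continuousOn_slice hy).mono subset_closure).aestronglyMeasurable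
      hΩ.measurableSet |>.mono_measure (Measure.restrict_mono hA le_rfl))) M ?_
  filter_upwards [ae_restrict_mem mA] with x hx
  have := hM (x, y) (mem_closure_cylinder (subset_closure (hA hx)) hy)
  rw [norm_mul, Real.norm_eq_abs, Real.norm_eq_abs]
  nlinarith [hs1 x, abs_nonneg (s x), abs_nonneg (w x y)]

/-- The extension equation for weighted integrals over horizontal slices. -/
lemma IsExtSol.tendsto_integral_quotient (hw : IsExtSol α Ω f w) (hΩ : IsOpen Ω)
    (hΩf : volume Ω ≠ ⊤) (mA : MeasurableSet A) (hA : A ⊆ Ω)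
    (hs : AEStronglyMeasurable s (volume.restrict A)) (hs1 : ∀ x, |s x| ≤ 1) {y : ℝ}
    (hy : 0 < y) :
    Tendsto (fun k : ℝ =>
      ((∫ x in A, s x * w x (y + k)) + (∫ x in A, s x * w x (y - k))
        - 2 * ∫ x in A, s x * w x y) / k ^ 2 +
      (1 - α) / y * (((∫ x in A, s x * w x (y + k)) - ∫ x in A, s x * w x (y - k)) / (2 * k)))
      (nhdsWithin 0 (Ioi 0)) (nhds (∫ x in A, s x * -lapx w x y)) := by
  obtain ⟨M, -, hd⟩ := hw.exists_deriv_bound hΩ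
  have hAf : volume A ≠ ⊤ := ((measure_mono hA).trans_lt hΩf.lt_top).ne
  have hev : ∀ᶠ k : ℝ in nhdsWithin 0 (Ioi 0), 0 < k ∧ k < y := by
    filter_upwards [Ioo_mem_nhdsGT hy] with h hh using hh
  have hi : ∀ t, 0 ≤ t → IntegrableOn (fun x => s x * w x t) A :=
    fun t ht => hw.integrableOn_mul hΩ hΩf mA hA hs hs1 ht
  set Q : ℝ → Euc N → ℝ := fun k x => s x * ((w x (y + k) + w x (y - k) - 2 * w x y) / k ^ 2 +
    (1 - α) / y * ((w x (y + k) - w x (y - k)) / (2 * k))) with hQ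
  have hQe : ∀ k, 0 < k → k < y → IntegrableOn (Q k) A ∧ ∫ x in A, Q k x =
      ((∫ x in A, s x * w x (y + k)) + (∫ x in A, s x * w x (y - k))
        - 2 * ∫ x in A, s x * w x y) / k ^ 2 +
      (1 - α) / y *
        (((∫ x in A, s x * w x (y + k)) - ∫ x in A, s x * w x (y - k)) / (2 * k)) := by
    intro k hk hky
    have i1 := hi (y + k) (by linarith)
    have i2 := hi (y - k) (by linarith)
    have i0 := (hi y hy.le).const_mul 2
    have j1 := ((i1.add i2).sub i0).div_const (k ^ 2)
    have j2 := ((i1.sub i2).div_const (2 * k)).const_mul ((1 - α) / y)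
    have e : Q k = fun x => (s x * w x (y + k) + s x * w x (y - k) - 2 * (s x * w x y)) / k ^ 2 +
        (1 - α) / y * ((s x * w x (y + k) - s x * w x (y - k)) / (2 * k)) := by
      funext x; simp only [hQ]; ring
    rw [e]
    refine ⟨j1.add j2, ?_⟩
    have e1 := integral_add j1 j2
    have e2 := integral_sub (i1.add i2) i0
    have e3 := integral_add i1 i2
    have e4 := integral_sub i1 i2
    simp only [Pi.add_apply, Pi.sub_apply] at e1 e2 e3 e4
    rw [e1, integral_div, integral_const_mul, integral_div, e2, e3, e4, integral_const_mul]
  have key : Tendsto (fun k : ℝ => ∫ x in A, Q k x) (nhdsWithin 0 (Ioi 0))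
      (nhds (∫ x in A, s x * -lapx w x y)) := by
    refine tendsto_integral_filter_of_dominated_convergence
      (fun _ => M + |(1 - α) / y| * M) ?_ ?_ (integrableOn_const hAf) ?_
    · filter_upwards [hev] with k hk
      exact (hQe k hk.1 hk.2).1.aestronglyMeasurable
    · filter_upwards [hev] with k hk
      filter_upwards [ae_restrict_mem mA] with x hx
      have hdx := hd x (hA hx)
      obtain ⟨ζ, hζ, ζ', hζ', e⟩ := exists_quotient_eq (fun y hy => (hdx y hy).1)
        (fun y hy => (hdx y hy).2.1) hk.1 hk.2 ((1 - α) / y)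
      have b1 := (hdx ζ (by linarith [hζ.1, hk.2])).2.2.2.2
      have b2 := (hdx ζ' (by linarith [hζ'.1, hk.2])).2.2.2.1
      simp only [hQ]
      rw [e, norm_mul, Real.norm_eq_abs, Real.norm_eq_abs]
      have b3 : |deriv (deriv (w x)) ζ + (1 - α) / y * deriv (w x) ζ'| ≤
          M + |(1 - α) / y| * M := by
        refine (abs_add_le _ _).trans ?_
        rw [abs_mul]
        gcongr
      calc _ ≤ 1 * (M + |(1 - α) / y| * M) :=
            mul_le_mul (hs1 x) b3 (abs_nonneg _) zero_le_one
        _ = _ := one_mul _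
    · filter_upwards [ae_restrict_mem mA] with x hx
      have hdx := hd x (hA hx)
      have := tendsto_quotient (fun y hy => (hdx y hy).1) (fun y hy => (hdx y hy).2.1)
        (hdx y hy).2.2.1 hy ((1 - α) / y)
      have e := hw.pde x (hA hx) y hy
      rw [show deriv (deriv (w x)) y + (1 - α) / y * deriv (w x) y = -lapx w x y by
        linarith] at this
      exact this.const_mul _
  refine key.congr' ?_
  filter_upwards [hev] with k hk
  exact (hQe k hk.1 hk.2).2

/-- The Neumann condition for weighted integrals over horizontal slices. -/
lemma IsExtSol.tendsto_integral_rpow_quotient (hw : IsExtSol α Ω f w) (hα : α ∈ Ioo (0 : ℝ) 2)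
    (hΩ : IsOpen Ω) (hΩf : volume Ω ≠ ⊤) (mA : MeasurableSet A) (hA : A ⊆ Ω)
    (hs : AEStronglyMeasurable s (volume.restrict A)) (hs1 : ∀ x, |s x| ≤ 1) :
    Tendsto (fun k : ℝ => ((∫ x in A, s x * w x k) - ∫ x in A, s x * w x 0) / k ^ α)
      (nhdsWithin 0 (Ioi 0)) (nhds (∫ x in A, s x * (α⁻¹ * (-(kappa α) * f x)))) := by
  obtain ⟨M, -, hd⟩ := hw.exists_deriv_bound hΩ
  have hAf : volume A ≠ ⊤ := ((measure_mono hA).trans_lt hΩf.lt_top).ne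
  have hev : ∀ᶠ k : ℝ in nhdsWithin 0 (Ioi 0), 0 < k ∧ k ≤ 1 := by
    filter_upwards [Ioc_mem_nhdsGT one_pos] with h hh using hh
  have hi : ∀ t, 0 ≤ t → IntegrableOn (fun x => s x * w x t) A :=
    fun t ht => hw.integrableOn_mul hΩ hΩf mA hA hs hs1 ht
  have hQe : ∀ k, 0 < k → IntegrableOn (fun x => s x * ((w x k - w x 0) / k ^ α)) A ∧
      ∫ x in A, s x * ((w x k - w x 0) / k ^ α) =
      ((∫ x in A, s x * w x k) - ∫ x in A, s x * w x 0) / k ^ α := by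
    intro k hk
    have i1 := hi k hk.le
    have i0 := hi 0 le_rfl
    have e : (fun x => s x * ((w x k - w x 0) / k ^ α)) =
        fun x => (s x * w x k - s x * w x 0) / k ^ α := by
      funext x; ring
    rw [e]
    refine ⟨(i1.sub i0).div_const _, ?_⟩
    have e2 := integral_sub i1 i0
    rw [integral_div, e2]
  have key : Tendsto (fun k : ℝ => ∫ x in A, s x * ((w x k - w x 0) / k ^ α))
      (nhdsWithin 0 (Ioi 0)) (nhds (∫ x in A, s x * (α⁻¹ * (-(kappa α) * f x)))) := by
    refine tendsto_integral_filter_of_dominated_convergence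
      (fun _ => α⁻¹ * M) ?_ ?_ (integrableOn_const hAf) ?_
    · filter_upwards [hev] with k hk
      exact (hQe k hk.1).1.aestronglyMeasurable
    · filter_upwards [hev] with k hk
      filter_upwards [ae_restrict_mem mA] with x hx
      have hdx := hd x (hA hx)
      obtain ⟨ζ, hζ, e⟩ := exists_rpow_quotient_eq hα.1
        (hw.continuousOn_fibre (subset_closure (hA hx))) (fun y hy => (hdx y hy).1) hk.1
      have b := rpow_mul_deriv_abs_le hα (fun y hy => (hdx y hy).2.2.2.1)
        (fun y hy => ⟨(hdx y hy).2.1, (hdx y hy).2.2.2.2⟩) (hw.neumann x (hA hx)) hζ.1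
        (hζ.2.le.trans hk.2)
      have hα0 := hα.1
      rw [e, norm_mul, Real.norm_eq_abs, Real.norm_eq_abs, abs_mul α⁻¹,
        abs_of_pos (inv_pos.2 hα0)]
      calc _ ≤ 1 * (α⁻¹ * M) := by
            refine mul_le_mul (hs1 x) ?_ (by positivity) zero_le_one
            gcongr
        _ = _ := one_mul _
    · filter_upwards [ae_restrict_mem mA] with x hx
      have hdx := hd x (hA hx)
      exact (tendsto_rpow_quotient hα.1 (hw.continuousOn_fibre (subset_closure (hA hx)))
        (fun y hy => (hdx y hy).1) (hw.neumann x (hA hx))).const_mul _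
  refine key.congr' ?_
  filter_upwards [hev] with k hk
  exact (hQe k hk.1).2

end ExtSolIntegral

/-- An inequality between ball averages yields one between integrated Laplacians. -/
lemma integral_lapx_le {N : ℕ} {α y M : ℝ} {Ω B : Set (Euc N)} {f g : Euc N → ℝ}
    {w v : Euc N → ℝ → ℝ} (hN : N ≠ 0) (hw : IsExtSol α Ω f w) (hv : IsExtSol α B g v)
    (hΩ : IsOpen Ω) (hΩf : volume Ω ≠ ⊤) (hB : IsOpen B) (hBf : volume B ≠ ⊤) (hy : 0 < y)
    {u : Euc N → ℝ} (hu : Continuous u) (hub : ∀ x, 0 ≤ u x ∧ u x ≤ M)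
    (huw : ∀ x ∈ Ω, u x = |w x y|)
    {A A' : Set (Euc N)} (mA : MeasurableSet A) (mA' : MeasurableSet A') {r : ℝ} (hr : 0 < r)
    (hrA : ∀ x ∈ A, Metric.ball x r ⊆ Ω) (hrA' : ∀ x ∈ A', Metric.ball x r ⊆ B)
    {s : Euc N → ℝ} (hs : AEStronglyMeasurable s (volume.restrict A)) (hs1 : ∀ x, |s x| ≤ 1)
    (hsw : ∀ x ∈ A, s x * w x y = |w x y|)
    (havg : ∀ h, 0 < h → h ≤ r →
      ∫ x in A, ((∫ y in Metric.ball x h, u y) - volume.real (Metric.ball (0 : Euc N) h) * u x) ≤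
      ∫ x in A', ((∫ z in Metric.ball x h, v z y) -
        volume.real (Metric.ball (0 : Euc N) h) * v x y)) :
    ∫ x in A, s x * lapx w x y ≤ ∫ x in A', lapx v x y := by
  obtain ⟨M₁, hD, -⟩ := hw.exists_deriv_bound hΩ
  obtain ⟨M₂, hD', -⟩ := hv.exists_deriv_bound hB
  obtain ⟨Mw, hMw⟩ := hw.bdd
  obtain ⟨Mv, hMv⟩ := hv.bdd
  let i₀ : Fin N := ⟨0, Nat.pos_of_ne_zero hN⟩
  have hAΩ : A ⊆ Ω := fun x hx => hrA x hx (Metric.mem_ball_self hr)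
  have hAB : A' ⊆ B := fun x hx => hrA' x hx (Metric.mem_ball_self hr)
  have hAf : volume A ≠ ⊤ := ((measure_mono hAΩ).trans_lt hΩf.lt_top).ne
  have cw : ContinuousOn (fun x => w x y) Ω := (hw.continuousOn_slice hy.le).mono subset_closure
  have cv : ContinuousOn (fun x => v x y) B := (hv.continuousOn_slice hy.le).mono subset_closure
  obtain ⟨I1, T1⟩ := (hD y hy).tendsto_integral_ballDiff hΩ hΩf cw
    (fun x hx => hMw (x, y) (mem_closure_cylinder (subset_closure hx) hy.le)) hr mA hrA hs hs1 i₀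
  obtain ⟨I2, T2⟩ := (hD' y hy).tendsto_integral_ballDiff hB hBf cv
    (fun x hx => hMv (x, y) (mem_closure_cylinder (subset_closure hx) hy.le)) hr mA' hrA'
    (s := fun _ => 1) aestronglyMeasurable_const (fun _ => by simp) i₀
  have ui : IntegrableOn u Ω := IntegrableOn.of_bound hΩf.lt_top
    hu.aestronglyMeasurable M (Eventually.of_forall fun x => by
      rw [Real.norm_eq_abs, abs_of_nonneg (hub x).1]; exact (hub x).2)
  have wi : IntegrableOn (fun x => w x y) Ω := IntegrableOn.of_bound hΩf.lt_top
    (cw.aestronglyMeasurable hΩ.measurableSet) Mw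
    ((ae_restrict_mem hΩ.measurableSet).mono fun x hx =>
      hMw (x, y) (mem_closure_cylinder (subset_closure hx) hy.le))
  have key := le_of_tendsto_of_tendsto T1 T2 (by
    filter_upwards [Ioc_mem_nhdsGT hr] with h hh
    have iu : IntegrableOn (fun x => (∫ y in Metric.ball x h, u y) -
        volume.real (Metric.ball (0 : Euc N) h) * u x) A :=
      (integrableOn_ball_integral mA hAf
        (fun x hx => (Metric.ball_subset_ball hh.2).trans (hrA x hx)) ui).sub
        ((ui.mono_set hAΩ).const_mul _)
    have hp : (0 : ℝ) ≤ (h ^ (N + 2))⁻¹ := inv_nonneg.2 (pow_nonneg hh.1.le _)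
    calc ∫ x in A, s x * ballDiff (fun x => w x y) h x
        ≤ ∫ x in A, (h ^ (N + 2))⁻¹ * ((∫ y in Metric.ball x h, u y) -
            volume.real (Metric.ball (0 : Euc N) h) * u x) := by
          refine setIntegral_mono_on (I1 h hh.1 hh.2) (iu.const_mul _) mA fun x hx => ?_
          have hball : Metric.ball x h ⊆ Ω := (Metric.ball_subset_ball hh.2).trans (hrA x hx)
          have h1 : s x * ∫ z in Metric.ball x h, w z y ≤ ∫ z in Metric.ball x h, u z := by
            rw [← integral_const_mul]
            refine setIntegral_mono_on ((wi.mono_set hball).const_mul _) (ui.mono_set hball)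
              measurableSet_ball fun z hz => ?_
            rw [huw z (hball hz)]
            refine (le_abs_self _).trans ?_
            rw [abs_mul]
            exact mul_le_of_le_one_left (abs_nonneg _) (hs1 x)
          have h2 := hsw x hx
          rw [huw x (hAΩ hx), ← h2, ballDiff]
          calc _ = (h ^ (N + 2))⁻¹ * (s x * (∫ z in Metric.ball x h, w z y) -
                volume.real (Metric.ball (0 : Euc N) h) * (s x * w x y)) := by ring
            _ ≤ _ := by gcongr
      _ ≤ ∫ x in A', 1 * ballDiff (fun x => v x y) h x := by
          simp only [ballDiff, one_mul]
          rw [integral_const_mul, integral_const_mul]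
          exact mul_le_mul_of_nonneg_left (havg h hh.1 hh.2) hp)
  have hm := momentB_pos i₀
  have e1 : ∫ x in A, s x * (2⁻¹ * (momentB N i₀ * ∑ i, sliceHess w y x
      (EuclideanSpace.single i 1) (EuclideanSpace.single i 1))) =
      (2⁻¹ * momentB N i₀) * ∫ x in A, s x * lapx w x y := by
    rw [← integral_const_mul]
    refine setIntegral_congr_fun mA fun x hx => ?_
    rw [hw.lapx_eq hΩ (hAΩ hx) hy]
    ring
  have e2 : ∫ x in A', 1 * (2⁻¹ * (momentB N i₀ * ∑ i, sliceHess v y x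
      (EuclideanSpace.single i 1) (EuclideanSpace.single i 1))) =
      (2⁻¹ * momentB N i₀) * ∫ x in A', lapx v x y := by
    rw [← integral_const_mul]
    refine setIntegral_congr_fun mA' fun x hx => ?_
    rw [hv.lapx_eq hB (hAB hx) hy]
    ring
  rw [e1, e2] at key
  exact le_of_mul_le_mul_left key (by positivity)

section Touching

variable {N : ℕ} {α : ℝ}

lemma quotient_nonpos_of_max {ψ : ℝ → ℝ} {y₀ Y : ℝ} (hy : 0 < y₀) (hY : y₀ < Y)
    (hmax : ∀ y ∈ Icc 0 Y, ψ y ≤ ψ y₀) (c : ℝ) :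
    ∀ᶠ k : ℝ in nhdsWithin 0 (Ioi 0),
      (ψ (y₀ + k) + ψ (y₀ - k) - 2 * ψ y₀) / k ^ 2 +
        c * ((ψ (y₀ + k) - ψ (y₀ - k)) / (2 * k)) ≤ 0 := by
  have hc : 0 < 2 / (|c| + 1) := by positivity
  filter_upwards [Ioo_mem_nhdsGT hy, Ioo_mem_nhdsGT (sub_pos.2 hY), Ioo_mem_nhdsGT hc]
    with k h1 h2 h3
  have hk : 0 < k := h1.1
  have a := hmax (y₀ + k) ⟨by linarith, by linarith [h2.2]⟩
  have b := hmax (y₀ - k) ⟨by linarith [h1.2], by linarith [h2.2]⟩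
  have h4 : |c * k / 2| ≤ 1 := by
    have h5 := (lt_div_iff₀ (by positivity)).1 h3.2
    rw [abs_div, abs_mul, abs_of_pos hk, abs_of_pos (by norm_num : (0 : ℝ) < 2)]
    nlinarith [abs_nonneg c]
  have e : (ψ (y₀ + k) + ψ (y₀ - k) - 2 * ψ y₀) / k ^ 2 +
      c * ((ψ (y₀ + k) - ψ (y₀ - k)) / (2 * k)) =
      ((ψ (y₀ + k) - ψ y₀) * (1 + c * k / 2) + (ψ (y₀ - k) - ψ y₀) * (1 - c * k / 2)) / k ^ 2 := by
    field_simp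
    ring
  rw [e]
  refine div_nonpos_of_nonpos_of_nonneg ?_ (by positivity)
  obtain ⟨h6, h7⟩ := abs_le.1 h4
  nlinarith [mul_nonneg (sub_nonneg.2 a) (by linarith : 0 ≤ 1 + c * k / 2),
    mul_nonneg (sub_nonneg.2 b) (by linarith : 0 ≤ 1 - c * k / 2)]

/-- The barrier in the vertical variable. -/
def barrier (α y : ℝ) : ℝ := y ^ α + y ^ 2

lemma tendsto_quotient_barrier {y : ℝ} (hy : 0 < y) :
    Tendsto (fun k : ℝ => (barrier α (y + k) + barrier α (y - k) - 2 * barrier α y) / k ^ 2 +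
      (1 - α) / y * ((barrier α (y + k) - barrier α (y - k)) / (2 * k))) (nhdsWithin 0 (Ioi 0))
      (nhds (4 - 2 * α)) := by
  have d1 : ∀ y : ℝ, 0 < y → HasDerivAt (barrier α) (α * y ^ (α - 1) + 2 * y) y := by
    intro y hy
    have := (Real.hasDerivAt_rpow_const (p := α) (Or.inl hy.ne')).add (hasDerivAt_pow 2 y)
    exact this.congr_deriv (by norm_num)
  have d2 : ∀ y : ℝ, 0 < y →
      HasDerivAt (deriv (barrier α)) (α * ((α - 1) * y ^ (α - 1 - 1)) + 2 * 1) y := by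
    intro y hy
    have := ((Real.hasDerivAt_rpow_const (p := α - 1) (Or.inl hy.ne')).const_mul α).add
      ((hasDerivAt_id y).const_mul 2)
    refine this.congr_of_eventuallyEq ?_
    filter_upwards [lt_mem_nhds hy] with t ht
    exact (d1 t ht).deriv
  have hc : ContinuousAt (deriv (deriv (barrier α))) y := by
    have : ContinuousAt (fun y : ℝ => α * ((α - 1) * y ^ (α - 1 - 1)) + 2 * 1) y :=
      (((Real.continuousAt_rpow_const _ _ (Or.inl hy.ne')).const_mul _).const_mul _).add
        continuousAt_const
    refine this.congr ?_
    filter_upwards [lt_mem_nhds hy] with t ht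
    exact (d2 t ht).deriv.symm
  have := tendsto_quotient (fun y hy => (d1 y hy).differentiableAt.hasDerivAt)
    (fun y hy => (d2 y hy).differentiableAt.hasDerivAt) hc hy ((1 - α) / y)
  rw [(d2 y hy).deriv, (d1 y hy).deriv] at this
  convert this using 2
  have e : y ^ (α - 1 - 1) = y ^ (α - 1) / y := by
    rw [Real.rpow_sub_one hy.ne']
  rw [e]
  field_simp
  ring

lemma kappa_pos (hα : α ∈ Ioo (0 : ℝ) 2) : 0 < kappa α := by
  have h1 := Real.Gamma_pos_of_pos (show 0 < 1 - α / 2 by linarith [hα.2])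
  have h2 := Real.Gamma_pos_of_pos (show 0 < α / 2 by linarith [hα.1])
  unfold kappa
  positivity

variable {Ω B A A' : Set (Euc N)} {f g s : Euc N → ℝ} {w v : Euc N → ℝ → ℝ} {δ y₀ Y : ℝ}

/-- Maximum principle for weighted slice integrals in the interior. -/
lemma not_max_of_integral_lapx_le (hw : IsExtSol α Ω f w) (hv : IsExtSol α B g v)
    (hα : α ∈ Ioo (0 : ℝ) 2) (hΩ : IsOpen Ω) (hΩf : volume Ω ≠ ⊤) (hB : IsOpen B)
    (hBf : volume B ≠ ⊤) (mA : MeasurableSet A) (mA' : MeasurableSet A') (hA : A ⊆ Ω)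
    (hA' : A' ⊆ B) (hs : AEStronglyMeasurable s (volume.restrict A)) (hs1 : ∀ x, |s x| ≤ 1)
    (hδ : 0 < δ) (hy : 0 < y₀) (hY : y₀ < Y)
    (hle : ∫ x in A, s x * lapx w x y₀ ≤ ∫ x in A', lapx v x y₀) :
    ¬ ∀ y ∈ Icc 0 Y, (∫ x in A, s x * w x y) - (∫ x in A', v x y) + δ * barrier α y ≤
      (∫ x in A, s x * w x y₀) - (∫ x in A', v x y₀) + δ * barrier α y₀ := by
  intro hmax
  have T1 := hw.tendsto_integral_quotient hΩ hΩf mA hA hs hs1 hy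
  have T2 := hv.tendsto_integral_quotient hB hBf mA' hA' (s := fun _ => 1)
    aestronglyMeasurable_const (fun _ => by simp) hy
  have T3 := (tendsto_quotient_barrier (α := α) hy).const_mul δ
  have hq := quotient_nonpos_of_max
    (ψ := fun y => (∫ x in A, s x * w x y) - (∫ x in A', v x y) + δ * barrier α y) hy hY hmax
    ((1 - α) / y₀)
  have := le_of_tendsto ((T1.sub T2).add T3) (b := 0) (by
    filter_upwards [hq] with k hk
    simp only [one_mul]
    refine le_trans (le_of_eq ?_) hk
    ring)
  simp only [mul_neg, one_mul, integral_neg] at this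
  nlinarith [hα.2]

/-- Maximum principle for weighted slice integrals on the Neumann boundary. -/
lemma not_max_of_integral_data_le (hw : IsExtSol α Ω f w) (hv : IsExtSol α B g v)
    (hα : α ∈ Ioo (0 : ℝ) 2) (hΩ : IsOpen Ω) (hΩf : volume Ω ≠ ⊤) (hB : IsOpen B)
    (hBf : volume B ≠ ⊤) (mA : MeasurableSet A) (mA' : MeasurableSet A') (hA : A ⊆ Ω)
    (hA' : A' ⊆ B) (hs : AEStronglyMeasurable s (volume.restrict A)) (hs1 : ∀ x, |s x| ≤ 1)
    (hδ : 0 < δ) (hY : 0 < Y) (hle : ∫ x in A, s x * f x ≤ ∫ x in A', g x) :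
    ¬ ∀ y ∈ Icc 0 Y, (∫ x in A, s x * w x y) - (∫ x in A', v x y) + δ * barrier α y ≤
      (∫ x in A, s x * w x 0) - (∫ x in A', v x 0) + δ * barrier α 0 := by
  intro hmax
  have T1 := hw.tendsto_integral_rpow_quotient hα hΩ hΩf mA hA hs hs1
  have T2 := hv.tendsto_integral_rpow_quotient hα hB hBf mA' hA' (s := fun _ => 1)
    aestronglyMeasurable_const (fun _ => by simp)
  have := le_of_tendsto ((T1.sub T2).add (tendsto_const_nhds (x := δ))) (b := 0) (by
    filter_upwards [Ioo_mem_nhdsGT hY] with k hk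
    have h := hmax k ⟨hk.1.le, hk.2.le⟩
    have hp := Real.rpow_pos_of_pos hk.1 α
    have hb : barrier α k - barrier α 0 ≥ k ^ α := by
      simp only [barrier, Real.zero_rpow hα.1.ne']
      nlinarith [sq_nonneg k]
    simp only [one_mul]
    rw [← sub_div, ← le_neg_iff_add_nonpos_right, div_le_iff₀ hp]
    nlinarith)
  have e1 : ∫ x in A, s x * (α⁻¹ * (-(kappa α) * f x)) =
      -(α⁻¹ * kappa α) * ∫ x in A, s x * f x := by
    rw [← integral_const_mul]; congr 1; funext x; ring
  have e2 : ∫ x in A', 1 * (α⁻¹ * (-(kappa α) * g x)) = -(α⁻¹ * kappa α) * ∫ x in A', g x := by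
    rw [← integral_const_mul]; congr 1; funext x; ring
  rw [e1, e2] at this
  have hp : 0 < α⁻¹ * kappa α := mul_pos (inv_pos.2 hα.1) (kappa_pos hα)
  nlinarith [mul_le_mul_of_nonneg_left hle hp.le]

end Touching

section Concentration

variable {N : ℕ} {α : ℝ} {Ω : Set (Euc N)} {f : Euc N → ℝ} {w : Euc N → ℝ → ℝ}

lemma IsExtSol.exists_bound (hw : IsExtSol α Ω f w) :
    ∃ M : ℝ, 0 ≤ M ∧ ∀ y, 0 ≤ y → ∀ x ∈ Ω, |w x y| ≤ M := by
  obtain ⟨M, hM⟩ := hw.bdd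
  exact ⟨max M 0, le_max_right _ _, fun y hy x hx =>
    (hM (x, y) (mem_closure_cylinder (subset_closure hx) hy)).trans (le_max_left _ _)⟩

lemma IsExtSol.exists_modulus (hw : IsExtSol α Ω f w) (hΩ : Bornology.IsBounded Ω) (Y : ℝ)
    {ε : ℝ} (hε : 0 < ε) :
    ∃ δ > 0, ∀ y ∈ Icc 0 Y, ∀ y' ∈ Icc 0 Y, dist y y' < δ → ∀ x ∈ Ω, |w x y - w x y'| ≤ ε := by
  have hK : IsCompact (closure Ω ×ˢ Icc (0 : ℝ) Y) := hΩ.isCompact_closure.prod isCompact_Icc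
  have hc : ContinuousOn (fun p : Euc N × ℝ => w p.1 p.2) (closure Ω ×ˢ Icc (0 : ℝ) Y) :=
    hw.cont.mono fun p hp => mem_closure_cylinder hp.1 hp.2.1
  obtain ⟨δ, hδ, h⟩ := Metric.uniformContinuousOn_iff.1
    (hK.uniformContinuousOn_of_continuous hc) ε hε
  refine ⟨δ, hδ, fun y hy y' hy' hd x hx => ?_⟩
  have := h (x, y) ⟨subset_closure hx, hy⟩ (x, y') ⟨subset_closure hx, hy'⟩ (by
    rw [Prod.dist_eq, dist_self]
    exact max_lt hδ hd)
  exact this.le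

lemma IsExtSol.continuousOn_concentration (hw : IsExtSol α Ω f w) (hΩ : Bornology.IsBounded Ω)
    (S Y : ℝ) :
    ContinuousOn (fun p : ℝ × ℝ => ∫ σ in (0 : ℝ)..p.1, rearr Ω (fun x => w x p.2) σ)
      (Icc 0 S ×ˢ Icc 0 Y) := by
  obtain ⟨M, hM0, hM⟩ := hw.exists_bound
  refine continuousOn_prod_of_continuousOn_lipschitzOnWith _ ⟨M, hM0⟩ (fun s hs => ?_)
    (fun y hy => ?_)
  · rw [Metric.continuousOn_iff]
    intro y hy ε hε
    have hs0 : 0 < s + 1 := by linarith [hs.1]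
    obtain ⟨δ, hδ, h⟩ := hw.exists_modulus hΩ Y (div_pos hε hs0)
    refine ⟨δ, hδ, fun y' hy' hd => ?_⟩
    have hd' := h y' hy' y hy hd
    have ip := div_pos hε hs0
    have b : ∀ σ, ‖rearr Ω (fun x => w x y') σ - rearr Ω (fun x => w x y) σ‖ ≤ ε / (s + 1) := by
      intro σ
      rw [Real.norm_eq_abs, abs_sub_le_iff]
      constructor
      · have := rearr_le_add (σ := σ) (hM y' hy'.1) (hM y hy.1) ip.le fun x hx => by
          have := abs_sub_abs_le_abs_sub (w x y') (w x y)
          linarith [hd' x hx]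
        linarith
      · have := rearr_le_add (σ := σ) (hM y hy.1) (hM y' hy'.1) ip.le fun x hx => by
          have := abs_sub_abs_le_abs_sub (w x y) (w x y')
          rw [abs_sub_comm] at this
          linarith [hd' x hx]
        linarith
    rw [Real.dist_eq, ← intervalIntegral.integral_sub (intervalIntegrable_rearr (hM y' hy'.1) _ _)
      (intervalIntegrable_rearr (hM y hy.1) _ _), ← Real.norm_eq_abs]
    refine (intervalIntegral.norm_integral_le_of_norm_le_const fun σ _ => b σ).trans_lt ?_
    rw [sub_zero, abs_of_nonneg hs.1, div_mul_eq_mul_div, div_lt_iff₀ hs0]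
    nlinarith
  · refine LipschitzOnWith.of_dist_le_mul fun s _ s' _ => ?_
    have hi := fun a b => intervalIntegrable_rearr (hM y hy.1) a b
    simp only
    rw [Real.dist_eq, intervalIntegral.integral_interval_sub_left (hi _ _) (hi _ _),
      ← Real.norm_eq_abs]
    exact intervalIntegral.norm_integral_le_of_norm_le_const fun σ _ => by
      rw [Real.norm_eq_abs, abs_of_nonneg (rearr_nonneg _ _ _)]
      exact rearr_le hM0 (hM y hy.1)

end Concentration

/-- Replacing a maximal point of the difference of concentrations by the measure of the
superlevel set of the corresponding height. -/
lemma integral_rearr_level_le {N : ℕ} {E B : Set (Euc N)} {u v : Euc N → ℝ} {M M' t ε s : ℝ}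
    (hu : ∀ x ∈ E, |u x| ≤ M) (hv : ∀ x ∈ B, |v x| ≤ M') (hE : volume E ≠ ⊤)
    (hs : 0 ≤ s) (ht0 : 0 ≤ t) (ht : t = rearr B v s + ε) :
    (∫ σ in (0 : ℝ)..s, rearr E u σ) - (∫ σ in (0 : ℝ)..s, rearr B v σ) - ε * s ≤
      (∫ σ in (0 : ℝ)..(volume {x | x ∈ E ∧ t ≤ |u x|}).toReal, rearr E u σ) -
        (∫ σ in (0 : ℝ)..(volume {x | x ∈ E ∧ t ≤ |u x|}).toReal, rearr B v σ) -
          ε * (volume {x | x ∈ E ∧ t ≤ |u x|}).toReal := by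
  set b := (volume {x | x ∈ E ∧ t ≤ |u x|}).toReal with hb
  have hfin : volume {x | x ∈ E ∧ t ≤ |u x|} ≠ ⊤ :=
    ((measure_mono fun x hx => hx.1).trans_lt hE.lt_top).ne
  have hiu := fun a b => intervalIntegrable_rearr hu a b
  have hiv := fun a b => intervalIntegrable_rearr hv a b
  have hic : ∀ a b : ℝ, IntervalIntegrable (fun _ => ε) volume a b :=
    fun a b => intervalIntegrable_const
  have av := rearr_antitone hv
  have hconst : ∀ a b : ℝ, ∫ σ in a..b, (rearr B v σ + ε) =
      (∫ σ in a..b, rearr B v σ) + ε * (b - a) := fun a b => by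
    rw [intervalIntegral.integral_add (hiv a b) (hic a b), intervalIntegral.integral_const,
      smul_eq_mul, mul_comm]
  have su := intervalIntegral.integral_interval_sub_left (hiu 0 b) (hiu 0 s)
  have sv := intervalIntegral.integral_interval_sub_left (hiv 0 b) (hiv 0 s)
  rcases le_total s b with h | h
  · have key : ∫ σ in s..b, (rearr B v σ + ε) ≤ ∫ σ in s..b, rearr E u σ := by
      refine intervalIntegral.integral_mono_on_of_le_Ioo h ((hiv s b).add (hic s b)) (hiu s b)
        fun σ hσ => ?_
      have h1 : rearr B v σ + ε ≤ t := by
        rw [ht]; linarith [av hσ.1.le]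
      refine h1.trans (le_of_forall_lt_imp_le_of_dense fun τ hτ => ?_)
      rcases lt_or_ge τ 0 with h0 | h0
      · exact h0.le.trans (rearr_nonneg _ _ _)
      · refine ((lt_rearr_iff hu h0).2 ?_).le
        refine lt_of_lt_of_le ?_ (measure_mono (s := {x | x ∈ E ∧ t ≤ |u x|})
          fun x hx => ⟨hx.1, hτ.trans_le hx.2⟩)
        rw [← ENNReal.ofReal_toReal hfin]
        exact (ENNReal.ofReal_lt_ofReal_iff (hs.trans_lt (hσ.1.trans hσ.2))).2 hσ.2
    rw [hconst] at key
    linarith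
  · have key : ∫ σ in b..s, rearr E u σ ≤ ∫ σ in b..s, (rearr B v σ + ε) := by
      refine intervalIntegral.integral_mono_on_of_le_Ioo h (hiu b s) ((hiv b s).add (hic b s))
        fun σ hσ => ?_
      have h1 : t ≤ rearr B v σ + ε := by
        rw [ht]; linarith [av hσ.2.le]
      refine le_trans ?_ h1
      by_contra hlt
      rw [not_le] at hlt
      have h2 := (lt_rearr_iff hu ht0).1 hlt
      have h3 := h2.trans_le (measure_mono (t := {x | x ∈ E ∧ t ≤ |u x|})
          fun x hx => ⟨hx.1, hx.2.le⟩)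
      rw [← ENNReal.ofReal_toReal hfin] at h3
      exact absurd ((ENNReal.ofReal_lt_ofReal_iff'.1 h3).1) (not_lt.2 hσ.1.le)
    rw [hconst] at key
    have su' := intervalIntegral.integral_symm (f := rearr E u) (μ := volume) s b
    have sv' := intervalIntegral.integral_symm (f := rearr B v) (μ := volume) s b
    linarith

lemma ballRad_pos {N : ℕ} (hN : N ≠ 0) {Ω : Set (Euc N)} (hΩo : IsOpen Ω) (hΩf : volume Ω ≠ ⊤)
    (hne : Ω.Nonempty) : 0 < ballRad Ω := by
  by_contra h
  have h1 := volume_symmBall hN hΩf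
  rw [symmBall, Metric.ball_eq_empty.2 (not_lt.1 h), measure_empty] at h1
  exact (hΩo.measure_pos volume hne).ne h1

lemma IsExtSol.nonneg_of_radialDecr {N : ℕ} {α R : ℝ} {g : Euc N → ℝ} {v : Euc N → ℝ → ℝ}
    (hN : N ≠ 0) (hR : 0 < R) (hv : IsExtSol α (Metric.ball 0 R) g v) (hvrad : RadialDecr v)
    {y : ℝ} (hy : 0 ≤ y) {x : Euc N} (hx : x ∈ Metric.ball 0 R) : 0 ≤ v x y := by
  let i₀ : Fin N := ⟨0, Nat.pos_of_ne_zero hN⟩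
  have hn : ‖EuclideanSpace.single i₀ R‖ = R := by
    rw [PiLp.norm_single, Real.norm_eq_abs, abs_of_pos hR]
  have h0 := hv.lateral (EuclideanSpace.single i₀ R) (by
    rw [frontier_ball _ hR.ne', mem_sphere_zero_iff_norm]; exact hn) y hy
  rw [← h0]
  exact hvrad y hy _ _ ((mem_ball_zero_iff.1 hx).le.trans hn.ge)

/-- A version of the sign that takes the value `1` at zero. -/
def signOne (a : ℝ) : ℝ := if 0 ≤ a then 1 else -1

lemma signOne_mul_self (a : ℝ) : signOne a * a = |a| := by
  unfold signOne
  split_ifs with h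
  · rw [abs_of_nonneg h, one_mul]
  · rw [abs_of_neg (not_le.1 h), neg_one_mul]

lemma abs_signOne (a : ℝ) : |signOne a| ≤ 1 := by
  unfold signOne
  split_ifs <;> simp

lemma measurable_signOne : Measurable signOne :=
  Measurable.ite measurableSet_Ici measurable_const measurable_const

lemma measurable_schwarz {N : ℕ} {Ω : Set (Euc N)} {f : Euc N → ℝ} {M : ℝ}
    (hf : ∀ x ∈ Ω, |f x| ≤ M) : Measurable (schwarz Ω f) :=
  (rearr_antitone hf).measurable.comp (by fun_prop)

/-- The penalized difference of the concentrations has no maximum below the top level. -/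
lemma not_max_penalized {N : ℕ} (hN : N ≠ 0) {α : ℝ} (hα : α ∈ Ioo (0 : ℝ) 2) {Ω : Set (Euc N)}
    (hΩo : IsOpen Ω) (hΩb : Bornology.IsBounded Ω) (hne : Ω.Nonempty) {f : Euc N → ℝ}
    (hfc : ContinuousOn f Ω) {Mf : ℝ} (hf : ∀ x ∈ Ω, |f x| ≤ Mf) {w v : Euc N → ℝ → ℝ}
    (hw : IsExtSol α Ω f w) (hv : IsExtSol α (symmBall Ω) (schwarz Ω f) v)
    (hvrad : RadialDecr v) {ε δ Y s₀ y₀ : ℝ} (hε : 0 < ε) (hδ : 0 < δ)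
    (hs₀ : 0 ≤ s₀) (hy₀ : 0 ≤ y₀) (hY : y₀ < Y)
    (hmax : ∀ s ∈ Icc 0 (volume Ω).toReal, ∀ y ∈ Icc 0 Y,
      (∫ σ in (0 : ℝ)..s, rearr Ω (fun x => w x y) σ) -
        (∫ σ in (0 : ℝ)..s, rearr (symmBall Ω) (fun x => v x y) σ) - ε * s + δ * barrier α y ≤
      (∫ σ in (0 : ℝ)..s₀, rearr Ω (fun x => w x y₀) σ) -
        (∫ σ in (0 : ℝ)..s₀, rearr (symmBall Ω) (fun x => v x y₀) σ) - ε * s₀ +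
          δ * barrier α y₀) : False := by
  have hΩf : volume Ω ≠ ⊤ := hΩb.measure_lt_top.ne
  have hB : volume (symmBall Ω) = volume Ω := volume_symmBall hN hΩf
  have hBf : volume (symmBall Ω) ≠ ⊤ := hB ▸ hΩf
  have hBo : IsOpen (symmBall Ω) := Metric.isOpen_ball
  have hR := ballRad_pos hN hΩo hΩf hne
  obtain ⟨M, hM0, hM⟩ := hw.exists_bound
  obtain ⟨M', hM0', hM'⟩ := hv.exists_bound
  have hv0 : ∀ y, 0 ≤ y → ∀ x ∈ symmBall Ω, 0 ≤ v x y := fun y hy x hx =>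
    IsExtSol.nonneg_of_radialDecr hN hR hv hvrad hy hx
  set u : Euc N → ℝ := Ω.indicator fun x => |w x y₀| with hu
  have huw : ∀ x ∈ Ω, u x = |w x y₀| := fun x hx => indicator_of_mem hx _
  have hu0 : ∀ x ∉ Ω, u x = 0 := fun x hx => indicator_of_notMem hx _
  have huc : Continuous u := continuous_indicator
    (fun x hx => by rw [hw.lateral x hx y₀ hy₀, abs_zero]) (hw.continuousOn_slice hy₀).abs
  have hub : ∀ x, 0 ≤ u x ∧ u x ≤ M := by
    intro x
    by_cases hx : x ∈ Ω
    · rw [huw x hx]; exact ⟨abs_nonneg _, hM y₀ hy₀ x hx⟩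
    · rw [hu0 x hx]; exact ⟨le_rfl, hM0⟩
  have hru : rearr Ω u = rearr Ω fun x => w x y₀ := by
    refine rearr_congr fun τ _ => ?_
    congr 1
    ext x
    refine and_congr_right fun hx => ?_
    rw [huw x hx, abs_abs]
  set t := rearr (symmBall Ω) (fun x => v x y₀) s₀ + ε with ht
  have ht0 : 0 < t := add_pos_of_nonneg_of_pos (rearr_nonneg _ _ _) hε
  set A : Set (Euc N) := {x | t ≤ u x} with hAdef
  have hAc : IsClosed A := isClosed_le continuous_const huc
  have hAΩ : A ⊆ Ω := fun x hx => by
    by_contra h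
    have : t ≤ u x := hx
    rw [hu0 x h] at this
    exact absurd this (not_le.2 ht0)
  have mA : MeasurableSet A := hAc.measurableSet
  have hAf : volume A ≠ ⊤ := ((measure_mono hAΩ).trans_lt hΩf.lt_top).ne
  have hAeq : {x | x ∈ Ω ∧ t ≤ |w x y₀|} = A := by
    ext x
    constructor
    · rintro ⟨h1, h2⟩
      change t ≤ u x
      rwa [huw x h1]
    · intro h
      have h' : t ≤ u x := h
      refine ⟨hAΩ h, ?_⟩
      rwa [huw x (hAΩ h)] at h'
  set b := (volume A).toReal with hb
  have hbS : b ∈ Icc 0 (volume Ω).toReal :=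
    ⟨ENNReal.toReal_nonneg, ENNReal.toReal_mono hΩf (measure_mono hAΩ)⟩
  have hlev := integral_rearr_level_le (hM y₀ hy₀) (hM' y₀ hy₀) hΩf hs₀ ht0.le ht
  rw [hAeq, ← hb] at hlev
  have hq : ∀ s ∈ Icc 0 (volume Ω).toReal, ∀ y ∈ Icc 0 Y,
      (∫ σ in (0 : ℝ)..s, rearr Ω (fun x => w x y) σ) -
        (∫ σ in (0 : ℝ)..s, rearr (symmBall Ω) (fun x => v x y) σ) - ε * s + δ * barrier α y ≤
      (∫ σ in (0 : ℝ)..b, rearr Ω (fun x => w x y₀) σ) -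
        (∫ σ in (0 : ℝ)..b, rearr (symmBall Ω) (fun x => v x y₀) σ) - ε * b +
          δ * barrier α y₀ := fun s hs y hy => by
    linarith [hmax s hs y hy]
  obtain ⟨A', mA', hA'd, hA'v, r, hr, hA'r, havg⟩ := exists_downClosed_ball_average_le hN hΩo hΩb
    hne (v₀ := fun x => v x y₀) (ε := ε) huc hub hu0 (hv0 y₀ hy₀) (hM' y₀ hy₀) (hvrad y₀ hy₀)
    ((hv.continuousOn_slice hy₀).mono subset_closure) ht0 (fun s hs => by
      rw [hru]
      linarith [hq s hs y₀ ⟨hy₀, hY.le⟩])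
  have hA'B : A' ⊆ symmBall Ω := hA'r.trans (Metric.closedBall_subset_ball hr)
  have hA'f : volume A' ≠ ⊤ := hA'v ▸ hAf
  have hWA : ∀ y, 0 ≤ y → AEStronglyMeasurable (fun x => w x y) (volume.restrict A) :=
    fun y hy => (((hw.continuousOn_slice hy).mono subset_closure).mono hAΩ).aestronglyMeasurable mA
  have hVA : ∀ y, 0 ≤ y → ∫ x in A', v x y =
      ∫ σ in (0 : ℝ)..b, rearr (symmBall Ω) (fun x => v x y) σ := fun y hy => by
    rw [setIntegral_downClosed_eq_rearr (hM' y hy) (hv0 y hy) (hvrad y hy) mA' hA'd hA'B hA'f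
      ((((hv.continuousOn_slice hy).mono subset_closure).mono hA'B).aestronglyMeasurable mA'),
      hA'v]
  set s : Euc N → ℝ := fun x => signOne (w x y₀) with hs
  have hs1 : ∀ x, |s x| ≤ 1 := fun x => abs_signOne _
  have hsm : AEStronglyMeasurable s (volume.restrict A) :=
    (measurable_signOne.comp_aemeasurable (hWA y₀ hy₀).aemeasurable).aestronglyMeasurable
  have hsw : ∀ x, s x * w x y₀ = |w x y₀| := fun x => signOne_mul_self _
  have hWle : ∀ y, 0 ≤ y → ∫ x in A, s x * w x y ≤
      ∫ σ in (0 : ℝ)..b, rearr Ω (fun x => w x y) σ := fun y hy => by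
    refine le_trans ?_ (setIntegral_abs_le_rearr (hM y hy) mA hAΩ hAf (hWA y hy))
    have i := hw.integrableOn_mul (s := fun _ => 1) hΩo hΩf mA hAΩ aestronglyMeasurable_const
      (fun _ => by simp) hy
    simp only [one_mul] at i
    refine setIntegral_mono_on (hw.integrableOn_mul hΩo hΩf mA hAΩ hsm hs1 hy) i.abs mA
      fun x _ => (le_abs_self _).trans ?_
    rw [abs_mul]
    exact mul_le_of_le_one_left (abs_nonneg _) (hs1 x)
  have hWeq : ∫ x in A, s x * w x y₀ = ∫ σ in (0 : ℝ)..b, rearr Ω (fun x => w x y₀) σ := by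
    simp only [hsw]
    refine setIntegral_abs_eq_rearr (hM y₀ hy₀) mA hAΩ hAf (hWA y₀ hy₀) fun τ _ => ?_
    rw [← hAeq]
    rcases lt_or_ge τ t with h | h
    · exact Or.inl fun x hx => h.trans_le hx.2
    · exact Or.inr fun x hx hx' => ⟨hx, h.trans hx'.le⟩
  have hψ : ∀ y ∈ Icc 0 Y, (∫ x in A, s x * w x y) - (∫ x in A', v x y) + δ * barrier α y ≤
      (∫ x in A, s x * w x y₀) - (∫ x in A', v x y₀) + δ * barrier α y₀ := fun y hy => by
    rw [hVA y hy.1, hVA y₀ hy₀, hWeq]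
    linarith [hq b hbS y hy, hWle y hy.1]
  rcases hy₀.eq_or_lt with h0 | hpos
  · subst h0
    refine not_max_of_integral_data_le hw hv hα hΩo hΩf hBo hBf mA mA' hAΩ hA'B hsm hs1 hδ hY ?_ hψ
    have hfm : AEStronglyMeasurable f (volume.restrict A) :=
      (hfc.mono hAΩ).aestronglyMeasurable mA
    have hfi : IntegrableOn f A := IntegrableOn.of_bound hAf.lt_top hfm Mf
      ((ae_restrict_mem mA).mono fun x hx => hf x (hAΩ hx))
    have hMf : 0 ≤ Mf := by
      obtain ⟨x, hx⟩ := hne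
      exact (abs_nonneg _).trans (hf x hx)
    have e := setIntegral_downClosed_eq_rearr (B := symmBall Ω) (g := schwarz Ω f) (M := Mf)
      (fun x _ => by
        rw [abs_of_nonneg (schwarz_nonneg _ _ _)]
        exact rearr_le hMf hf)
      (fun x _ => schwarz_nonneg _ _ _) (fun x x' h => schwarz_anti hf h) mA' hA'd hA'B hA'f
      (measurable_schwarz hf).aestronglyMeasurable
    rw [e, rearr_schwarz hN hΩf hf, hA'v]
    refine le_trans ?_ (setIntegral_abs_le_rearr hf mA hAΩ hAf hfm)
    refine setIntegral_mono_on (IntegrableOn.of_bound hAf.lt_top (hsm.mul hfm) Mf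
      ((ae_restrict_mem mA).mono fun x hx => ?_)) hfi.abs mA fun x _ => (le_abs_self _).trans ?_
    · rw [norm_mul, Real.norm_eq_abs, Real.norm_eq_abs]
      exact (mul_le_of_le_one_left (abs_nonneg _) (hs1 x)).trans (hf x (hAΩ hx))
    · rw [abs_mul]
      exact mul_le_of_le_one_left (abs_nonneg _) (hs1 x)
  · have hAk : IsCompact A := Metric.isCompact_of_isClosed_isBounded hAc (hΩb.subset hAΩ)
    obtain ⟨ρ, hρ, hρΩ⟩ := hAk.exists_cthickening_subset_open hΩo hAΩ
    have hmin : 0 < min ρ (ballRad Ω - r) := lt_min hρ (sub_pos.2 hr)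
    refine not_max_of_integral_lapx_le hw hv hα hΩo hΩf hBo hBf mA mA' hAΩ hA'B hsm hs1 hδ hpos hY
      ?_ hψ
    refine integral_lapx_le hN hw hv hΩo hΩf hBo hBf hpos huc hub huw mA mA' hmin ?_ ?_ hsm hs1
      (fun x _ => hsw x) fun h h0 hh => havg h h0 (by linarith [min_le_right ρ (ballRad Ω - r)])
    · intro x hx
      refine Subset.trans ?_ hρΩ
      refine Subset.trans ?_ (Metric.closedBall_subset_cthickening hx ρ)
      exact (Metric.ball_subset_ball (min_le_left _ _)).trans Metric.ball_subset_closedBall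
    · intro x hx
      refine Metric.ball_subset_ball' ?_
      have := Metric.mem_closedBall.1 (hA'r hx)
      linarith [min_le_right ρ (ballRad Ω - r)]

/-- comparison of concentrations of the extension `w` of the solution on `Ω`
and the extension `v` of the solution of the symmetrized problem, for every level `y ≥ 0`:
`∫_0^s w*(σ,y) dσ ≤ ∫_0^s v*(σ,y) dσ` for all `s ∈ [0,|Ω|]`. -/
theorem comparison_of_concentrations
    {N : ℕ} (hN : 2 ≤ N) (α : ℝ) (hα : α ∈ Ioo (0 : ℝ) 2) (hαN : α < N)
    (Ω : Set (Euc N)) (hΩo : IsOpen Ω) (hΩb : Bornology.IsBounded Ω)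
    (f : Euc N → ℝ) (hfc : ContinuousOn f Ω) (hfb : ∃ M : ℝ, ∀ x ∈ Ω, |f x| ≤ M)
    (w v : Euc N → ℝ → ℝ)
    (hw : IsExtSol α Ω f w)
    (hv : IsExtSol α (symmBall Ω) (schwarz Ω f) v)
    (hvrad : RadialDecr v) :
    ∀ y : ℝ, 0 ≤ y → ∀ s ∈ Icc (0 : ℝ) (volume Ω).toReal,
      (∫ σ in (0 : ℝ)..s, rearr Ω (fun x => w x y) σ) ≤
        ∫ σ in (0 : ℝ)..s, rearr (symmBall Ω) (fun x => v x y) σ := by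
  intro y₁ hy₁ s₁ hs₁
  rcases Ω.eq_empty_or_nonempty with rfl | hne
  · have : s₁ = 0 := by simpa using hs₁
    simp [this]
  have hN0 : N ≠ 0 := by omega
  by_contra hlt
  rw [not_le] at hlt
  obtain ⟨Mf, hf⟩ := hfb
  set S := (volume Ω).toReal with hS
  have hS0 : 0 ≤ S := ENNReal.toReal_nonneg
  set W : ℝ → ℝ → ℝ := fun s y => ∫ σ in (0 : ℝ)..s, rearr Ω (fun x => w x y) σ with hW
  set V : ℝ → ℝ → ℝ := fun s y => ∫ σ in (0 : ℝ)..s, rearr (symmBall Ω) (fun x => v x y) σ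
    with hV
  have hm : 0 < W s₁ y₁ - V s₁ y₁ := sub_pos.2 hlt
  set m := W s₁ y₁ - V s₁ y₁ with hmdef
  have hε : 0 < m / (4 * (S + 1)) := by positivity
  set ε := m / (4 * (S + 1)) with hεdef
  have hεS : ε * S ≤ m / 4 := by
    rw [hεdef, div_mul_eq_mul_div, div_le_div_iff₀ (by positivity) (by norm_num)]
    nlinarith
  obtain ⟨Y₁, hY₁⟩ := hw.decay ε hε
  set Y := max Y₁ (y₁ + 1) with hYdef
  have hYy : y₁ < Y := lt_of_lt_of_le (by linarith) (le_max_right _ _)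
  have hY0 : 0 < Y := hy₁.trans_lt hYy
  have hb0 : ∀ y, 0 ≤ y → 0 ≤ barrier α y := fun y hy => by
    have := Real.rpow_nonneg hy α
    unfold barrier; positivity
  have hbY := hb0 Y hY0.le
  have hδ : 0 < m / (4 * (barrier α Y + 1)) := by positivity
  set δ := m / (4 * (barrier α Y + 1)) with hδdef
  have hδY : δ * barrier α Y < m / 4 := by
    rw [hδdef, div_mul_eq_mul_div, div_lt_div_iff₀ (by positivity) (by norm_num)]
    nlinarith
  have hWY : ∀ s ∈ Icc 0 S, W s Y ≤ m / 4 := fun s hs => by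
    have hbd : ∀ x ∈ Ω, |w x Y| ≤ ε := hY₁ Y (le_max_left _ _)
    have : W s Y ≤ ∫ _ in (0 : ℝ)..s, ε :=
      intervalIntegral.integral_mono_on hs.1 (intervalIntegrable_rearr hbd _ _)
        intervalIntegrable_const fun σ _ => rearr_le hε.le hbd
    rw [intervalIntegral.integral_const, smul_eq_mul, sub_zero] at this
    nlinarith [hs.2]
  have hV0 : ∀ s ∈ Icc 0 S, 0 ≤ V s Y := fun s hs =>
    intervalIntegral.integral_nonneg hs.1 fun σ _ => rearr_nonneg _ _ _
  have hc : ContinuousOn (fun p : ℝ × ℝ => W p.1 p.2 - V p.1 p.2 - ε * p.1 + δ * barrier α p.2)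
      (Icc 0 S ×ˢ Icc 0 Y) := by
    have h1 := hw.continuousOn_concentration hΩb S Y
    have h2 := hv.continuousOn_concentration Metric.isBounded_ball S Y
    have h3 : Continuous (barrier α) :=
      (Real.continuous_rpow_const hα.1.le).add (continuous_pow 2)
    exact ((h1.sub h2).sub (by fun_prop)).add
      (continuousOn_const.mul (h3.comp continuous_snd).continuousOn)
  obtain ⟨⟨s₀, y₀⟩, ⟨hs₀, hy₀⟩, hmax⟩ := (isCompact_Icc.prod isCompact_Icc).exists_isMaxOn
    ⟨(s₁, y₁), hs₁, hy₁, hYy.le⟩ hc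
  have hmax' : ∀ s ∈ Icc 0 S, ∀ y ∈ Icc 0 Y, W s y - V s y - ε * s + δ * barrier α y ≤
      W s₀ y₀ - V s₀ y₀ - ε * s₀ + δ * barrier α y₀ := fun s hs y hy =>
    isMaxOn_iff.1 hmax (s, y) ⟨hs, hy⟩
  have hyY : y₀ < Y := by
    refine lt_of_le_of_ne hy₀.2 fun h => ?_
    have h1 := hmax' s₁ hs₁ y₁ ⟨hy₁, hYy.le⟩
    rw [h] at h1
    have h2 := hWY s₀ hs₀
    have h3 := hV0 s₀ hs₀
    have h4 := mul_nonneg hε.le hs₀.1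
    have h5 := mul_nonneg hδ.le (hb0 y₁ hy₁)
    have h6 := mul_le_mul_of_nonneg_left hs₁.2 hε.le
    linarith
  exact not_max_penalized hN0 hα hΩo hΩb hne hfc hf hw hv hvrad hε hδ hs₀.1 hy₀.1 hyY hmax'
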